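/- arXiv:1803.00165 — 5 statements merged into one kernel-verified Lean document; each statement's English description precedes it below -/
import Mathlib

section
/- For every integer k ≥ 3 and every ε > 0 there exists N such that the following holds for all n ≥ N: every simple graph G on n vertices with at least (1 − 1/k)·n(n−1)/2 edges contains at least (λ_k − ε)·n^5 copies of the 5-cycle C₅, where λ_k = 1/10 − 1/(2k) + 1/k² − 1/k³ + 2/(5k⁴). -/
/-- The number of (unordered) copies of the 5-cycle `C₅` in a simple graph `G`:
one tenth of the number of injective graph homomorphisms from `C₅` into `G`. -/
noncomputable def c5Count {V : Type*} (G : SimpleGraph V) : ℕ :=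
  Nat.card {v : Fin 5 → V //
    Function.Injective v ∧ ∀ i : Fin 5, G.Adj (v i) (v (i + 1))} / 10

/-- The number of edges of a simple graph. -/
noncomputable def edgeCount {V : Type*} (G : SimpleGraph V) : ℕ :=
  Nat.card G.edgeSet

/-- `λ_k = 1/10 − 1/(2k) + 1/k² − 1/k³ + 2/(5k⁴)`. -/
noncomputable def lam (k : ℕ) : ℝ :=
  1/10 - 1/(2*(k:ℝ)) + 1/(k:ℝ)^2 - 1/(k:ℝ)^3 + 2/(5*(k:ℝ)^4)

open Finset

section WalkSums

variable {V : Type*} [Fintype V]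

/-- Moving a symmetric kernel from one side of a bilinear pairing to the other. -/
lemma sum_mul_kernel_comm (H : V → V → ℝ) (symm : ∀ x y, H x y = H y x) (f g : V → ℝ) :
    ∑ x, f x * ∑ y, H x y * g y = ∑ x, (∑ y, H x y * f y) * g x := by
  simp only [mul_sum, sum_mul]
  rw [sum_comm]
  refine sum_congr rfl fun y _ => sum_congr rfl fun x _ => ?_
  rw [symm x y]
  ring

/-- Cyclic rotation of the summation variables. -/
lemma sum_five_rotate (F : V → V → V → V → V → ℝ) :
    ∑ a, ∑ b, ∑ c, ∑ d, ∑ e, F b c d e a = ∑ a, ∑ b, ∑ c, ∑ d, ∑ e, F a b c d e := by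
  rw [sum_comm]
  refine sum_congr rfl fun b _ => ?_
  rw [sum_comm]
  refine sum_congr rfl fun c _ => ?_
  rw [sum_comm]
  refine sum_congr rfl fun d _ => ?_
  rw [sum_comm]

/-- A lower bound for `∏ (1 - hᵢ)` obtained from the full expansion by replacing the top product
by a product of four factors; the right-hand side is grouped into cyclic rotations. -/
lemma prod_five_one_sub_ge (p q r s t : ℝ) (hp : 0 ≤ p) (hq : 0 ≤ q) (hr : 0 ≤ r) (hs : 0 ≤ s)
    (ht : 0 ≤ t) (hp' : p ≤ 1) (hq' : q ≤ 1) (hr' : r ≤ 1) (hs' : s ≤ 1) (ht' : t ≤ 1)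
    (R : ℝ → ℝ → ℝ → ℝ → ℝ)
    (hR : ∀ x y z w, R x y z w =
      1 / 5 - x + x * y + x * z - x * y * z - x * y * w + 4 / 5 * (x * y * z * w)) :
    R p q r s + R q r s t + R r s t p + R s t p q + R t p q r ≤
      (1 - p) * (1 - q) * (1 - r) * (1 - s) * (1 - t) := by
  have bound : ∀ x y : ℝ, 0 ≤ x → y ≤ 1 → 0 ≤ x * (1 - y) := fun x y hx hy =>
    mul_nonneg hx (by linarith)
  have e1 := bound (p * q * r * s) t (by positivity) ht'
  have e2 := bound (q * r * s * t) p (by positivity) hp'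
  have e3 := bound (r * s * t * p) q (by positivity) hq'
  have e4 := bound (s * t * p * q) r (by positivity) hr'
  have e5 := bound (t * p * q * r) s (by positivity) hs'
  simp only [hR]
  linarith

/-- The number of closed walks of length five in the complementary kernel `1 - H`, bounded below
through the total mass `h n²` of `H`. -/
lemma sum_five_cycle_ge (H : V → V → ℝ) (symm : ∀ x y, H x y = H y x)
    (nonneg : ∀ x y, 0 ≤ H x y) (le_one : ∀ x y, H x y ≤ 1) (n h : ℝ)
    (hn : n = Fintype.card V) (hh : ∑ x, ∑ y, H x y = h * n ^ 2) :
    n ^ 5 * (1 - 5 * h + 10 * h ^ 2 - 10 * h ^ 3 + 4 * h ^ 4) ≤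
      ∑ a, ∑ b, ∑ c, ∑ d, ∑ e,
        (1 - H a b) * (1 - H b c) * (1 - H c d) * (1 - H d e) * (1 - H e a) := by
  set u : V → ℝ := fun x => ∑ y, H x y
  set v : V → ℝ := fun x => ∑ y, H x y * u y
  have u_apply : ∀ x, ∑ y, H x y = u x := fun _ => rfl
  have v_apply : ∀ x, ∑ y, H x y * u y = v x := fun _ => rfl
  have pair : ∀ g : V → ℝ, ∑ x, ∑ y, H x y * g y = ∑ x, u x * g x := fun g => by
    simpa using sum_mul_kernel_comm H symm (fun _ => 1) g
  have pair' : ∀ g : V → ℝ, ∑ x, u x * ∑ y, H x y * g y = ∑ x, v x * g x := fun g =>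
    sum_mul_kernel_comm H symm u g
  have sum_u : ∑ x, u x = h * n ^ 2 := hh
  have sum_v : ∑ x, v x = ∑ x, u x * u x := pair u
  set S2 := ∑ x, u x * u x with hS2
  set S3 := ∑ x, v x * u x with hS3
  set S4 := ∑ x, v x * v x with hS4
  set R : ℝ → ℝ → ℝ → ℝ → ℝ := fun x y z w =>
    1 / 5 - x + x * y + x * z - x * y * z - x * y * w + 4 / 5 * (x * y * z * w) with hR
  set F : V → V → V → V → V → ℝ := fun a b c d e => R (H a b) (H b c) (H c d) (H d e) with hF
  have t1 : ∑ a, ∑ b, ∑ _c : V, ∑ _d : V, ∑ _e : V, H a b = n ^ 3 * (h * n ^ 2) := by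
    simp only [sum_const, card_univ, nsmul_eq_mul, ← hn, ← mul_sum, u_apply, sum_u]
    ring
  have t2 : ∑ a, ∑ b, ∑ c, ∑ _d : V, ∑ _e : V, H a b * H b c = n ^ 2 * S2 := by
    simp only [sum_const, card_univ, nsmul_eq_mul, ← hn, ← mul_sum, u_apply, v_apply, sum_v]
    ring
  have t11 : ∑ a, ∑ b, ∑ c, ∑ d, ∑ _e : V, H a b * H c d = n * (h * n ^ 2) ^ 2 := by
    simp only [sum_const, card_univ, nsmul_eq_mul, ← hn, ← mul_sum, ← sum_mul, u_apply, sum_u]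
    ring
  have t3 : ∑ a, ∑ b, ∑ c, ∑ d, ∑ _e : V, H a b * H b c * H c d = n * S3 := by
    simp only [sum_const, card_univ, nsmul_eq_mul, ← hn, mul_assoc, ← mul_sum, u_apply, v_apply,
      pair]
    simp only [hS3, mul_comm]
  have t21 : ∑ a, ∑ b, ∑ c, ∑ d, ∑ e, H a b * H b c * H d e = S2 * (h * n ^ 2) := by
    simp only [← mul_sum, ← sum_mul, u_apply, v_apply, sum_u, sum_v]
  have t4 : ∑ a, ∑ b, ∑ c, ∑ d, ∑ e, H a b * H b c * H c d * H d e = S4 := by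
    simp only [mul_assoc, ← mul_sum, u_apply, v_apply, pair, pair', hS4]
  have sumF : ∑ a, ∑ b, ∑ c, ∑ d, ∑ e, F a b c d e =
      n ^ 5 / 5 - n ^ 3 * (h * n ^ 2) + n ^ 2 * S2 + n * (h * n ^ 2) ^ 2 - n * S3
        - S2 * (h * n ^ 2) + 4 / 5 * S4 := by
    have t0 : ∑ _a : V, ∑ _b : V, ∑ _c : V, ∑ _d : V, ∑ _e : V, (1 / 5 : ℝ) = n ^ 5 / 5 := by
      simp only [sum_const, card_univ, nsmul_eq_mul, ← hn]
      ring
    rw [← t0, ← t1, ← t2, ← t11, ← t3, ← t21, ← t4]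
    simp only [hF, hR, sum_add_distrib, sum_sub_distrib, mul_sum]
  have cyc : 5 * ∑ a, ∑ b, ∑ c, ∑ d, ∑ e, F a b c d e ≤ ∑ a, ∑ b, ∑ c, ∑ d, ∑ e,
      (1 - H a b) * (1 - H b c) * (1 - H c d) * (1 - H d e) * (1 - H e a) := by
    have r1 := sum_five_rotate F
    have r2 := sum_five_rotate fun a b c d e => F b c d e a
    have r3 := sum_five_rotate fun a b c d e => F c d e a b
    have r4 := sum_five_rotate fun a b c d e => F d e a b c
    calc 5 * ∑ a, ∑ b, ∑ c, ∑ d, ∑ e, F a b c d e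
        = ∑ a, ∑ b, ∑ c, ∑ d, ∑ e,
          (F a b c d e + F b c d e a + F c d e a b + F d e a b c + F e a b c d) := by
          simp only [sum_add_distrib]
          linarith
      _ ≤ _ := by
          gcongr with a _ b _ c _ d _ e _
          exact prod_five_one_sub_ge _ _ _ _ _ (nonneg _ _) (nonneg _ _) (nonneg _ _)
            (nonneg _ _) (nonneg _ _) (le_one _ _) (le_one _ _) (le_one _ _) (le_one _ _)
            (le_one _ _) R fun _ _ _ _ => rfl
  have sos : 0 ≤ ∑ x, (4 * (v x - 5 / 8 * n * u x - h * (8 * h - 5) / 8 * n ^ 2) ^ 2 +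
      (128 * h ^ 2 - 160 * h + 55) / 16 * n ^ 2 * (u x - h * n) ^ 2) := by
    refine sum_nonneg fun x _ => ?_
    have : 0 ≤ 128 * h ^ 2 - 160 * h + 55 := by nlinarith [sq_nonneg (8 * h - 5)]
    positivity
  have expand : ∑ x, (4 * (v x - 5 / 8 * n * u x - h * (8 * h - 5) / 8 * n ^ 2) ^ 2 +
      (128 * h ^ 2 - 160 * h + 55) / 16 * n ^ 2 * (u x - h * n) ^ 2) =
      4 * S4 - 5 * n * S3 + 5 * (1 - h) * n ^ 2 * S2
        - (5 * h ^ 2 - 10 * h ^ 3 + 4 * h ^ 4) * n ^ 5 := by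
    have key : ∀ x, 4 * (v x - 5 / 8 * n * u x - h * (8 * h - 5) / 8 * n ^ 2) ^ 2 +
        (128 * h ^ 2 - 160 * h + 55) / 16 * n ^ 2 * (u x - h * n) ^ 2 =
        4 * (v x * v x) - 5 * n * (v x * u x)
          + (25 / 16 + (128 * h ^ 2 - 160 * h + 55) / 16) * n ^ 2 * (u x * u x)
          - h * (8 * h - 5) * n ^ 2 * v x
          + (5 / 8 * h * (8 * h - 5) - (128 * h ^ 2 - 160 * h + 55) / 8 * h) * n ^ 3 * u x
          + (h ^ 2 * (8 * h - 5) ^ 2 / 16 + (128 * h ^ 2 - 160 * h + 55) / 16 * h ^ 2) * n ^ 4 := by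
      intro x
      ring
    simp only [key, sum_add_distrib, sum_sub_distrib, ← mul_sum, sum_const, card_univ,
      nsmul_eq_mul, ← hn, sum_u, sum_v, ← hS2, ← hS3, ← hS4]
    ring
  rw [expand] at sos
  rw [sumF] at cyc
  refine le_trans ?_ cyc
  linarith

end WalkSums

section Counting

variable {V : Type*} [Fintype V]

/-- Tuples indexed by `Fin 5` as iterated products. -/
def finFiveArrowEquiv (V : Type*) : (Fin 5 → V) ≃ V × V × V × V × V where
  toFun f := (f 0, f 1, f 2, f 3, f 4)
  invFun p := ![p.1, p.2.1, p.2.2.1, p.2.2.2.1, p.2.2.2.2]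
  left_inv f := by
    ext i
    fin_cases i <;> rfl
  right_inv _ := rfl

lemma sum_fin_five_arrow (F : V → V → V → V → V → ℝ) :
    ∑ f : Fin 5 → V, F (f 0) (f 1) (f 2) (f 3) (f 4) =
      ∑ a, ∑ b, ∑ c, ∑ d, ∑ e, F a b c d e := by
  refine (Fintype.sum_equiv (finFiveArrowEquiv V) _
    (fun p => F p.1 p.2.1 p.2.2.1 p.2.2.2.1 p.2.2.2.2) fun _ => rfl).trans ?_
  simp only [Fintype.sum_prod_type]

open Classical in
lemma card_closed_walks_five (G : SimpleGraph V) :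
    (#{f : Fin 5 → V | ∀ i, G.Adj (f i) (f (i + 1))} : ℝ) =
      ∑ a, ∑ b, ∑ c, ∑ d, ∑ e, (if G.Adj a b then (1 : ℝ) else 0) * (if G.Adj b c then 1 else 0) *
        (if G.Adj c d then 1 else 0) * (if G.Adj d e then 1 else 0) *
        (if G.Adj e a then 1 else 0) := by
  rw [← sum_fin_five_arrow, card_filter]
  push_cast
  refine sum_congr rfl fun f _ => ?_
  have hcycle : (∀ i, G.Adj (f i) (f (i + 1))) ↔ G.Adj (f 0) (f 1) ∧ G.Adj (f 1) (f 2) ∧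
      G.Adj (f 2) (f 3) ∧ G.Adj (f 3) (f 4) ∧ G.Adj (f 4) (f 0) :=
    ⟨fun h => ⟨h 0, h 1, h 2, h 3, h 4⟩, fun ⟨h0, h1, h2, h3, h4⟩ i => by
      fin_cases i <;> assumption⟩
  simp only [hcycle, ite_and, mul_ite, mul_one, mul_zero]
  split_ifs <;> rfl

lemma descFactorial_five_ge {n : ℕ} (hn : 5 ≤ n) :
    (n : ℝ) ^ 5 - 10 * (n : ℝ) ^ 4 ≤ n.descFactorial 5 := by
  obtain ⟨m, rfl⟩ := Nat.exists_eq_add_of_le' hn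
  have : (m + 5).descFactorial 5 = (m + 5) * (m + 4) * (m + 3) * (m + 2) * (m + 1) := by
    simp [Nat.descFactorial_succ]
    ring
  rw [this]
  push_cast
  have : (0 : ℝ) ≤ m := m.cast_nonneg
  nlinarith [pow_nonneg this 3, pow_nonneg this 2]

open Classical in
/-- Discarding non-injective closed walks costs at most `10 n⁴`. -/
lemma c5Count_ge (G : SimpleGraph V) (hV : 5 ≤ Fintype.card V) :
    ((#{f : Fin 5 → V | ∀ i, G.Adj (f i) (f (i + 1))} : ℝ) - 10 * (Fintype.card V : ℝ) ^ 4) / 10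
      - 1 ≤ c5Count G := by
  set A : Finset (Fin 5 → V) := {f | ∀ i, G.Adj (f i) (f (i + 1))} with hA
  set B : Finset (Fin 5 → V) := {f | Function.Injective f} with hB
  have hcount : c5Count G = #(A ∩ B) / 10 := by
    rw [c5Count, Nat.card_eq_fintype_card, Fintype.card_subtype, hA, hB, ← filter_and]
    simp only [and_comm]
  have hcardB : #B = (Fintype.card V).descFactorial 5 := by
    rw [hB, ← Fintype.card_subtype,
      Fintype.card_congr (Equiv.subtypeInjectiveEquivEmbedding (Fin 5) V)]
    simp [Fintype.card_embedding_eq]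
  have hunion : #(A ∪ B) ≤ Fintype.card V ^ 5 := by
    simpa using card_le_univ (A ∪ B)
  have hsum : (#(A ∪ B) : ℝ) + #(A ∩ B) = #A + #B := by
    exact_mod_cast card_union_add_card_inter A B
  have hunion' : (#(A ∪ B) : ℝ) ≤ (Fintype.card V : ℝ) ^ 5 := by exact_mod_cast hunion
  have hdesc := descFactorial_five_ge hV
  rw [← hcardB] at hdesc
  have hdiv : (#(A ∩ B) : ℝ) ≤ 10 * (c5Count G : ℝ) + 10 := by
    have : #(A ∩ B) ≤ 10 * c5Count G + 10 := by omega
    exact_mod_cast this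
  linarith

open Classical in
lemma sum_adj_eq_two_mul_edgeCount (G : SimpleGraph V) :
    ∑ x, ∑ y, (if G.Adj x y then (1 : ℝ) else 0) = 2 * edgeCount G := by
  have h := G.sum_degrees_eq_twice_card_edges
  have hdeg : ∀ x, ∑ y, (if G.Adj x y then (1 : ℝ) else 0) = G.degree x := by
    intro x
    rw [← G.card_neighborFinset_eq_degree, G.neighborFinset_eq_filter, card_filter]
    push_cast
    rfl
  have hedge : edgeCount G = #G.edgeFinset := by
    rw [edgeCount, Nat.card_eq_fintype_card, SimpleGraph.edgeFinset_card]
  simp only [hdeg, hedge]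
  exact_mod_cast h

/-- The lower bound on the number of 5-cycles in terms of the exact non-edge density `h`. -/
lemma c5Count_ge_of_edgeCount (G : SimpleGraph V) (hV : 5 ≤ Fintype.card V) (n h : ℝ)
    (hn : n = Fintype.card V) (hh : 2 * (edgeCount G : ℝ) = (1 - h) * n ^ 2) :
    n ^ 5 * (1 - 5 * h + 10 * h ^ 2 - 10 * h ^ 3 + 4 * h ^ 4) / 10 - n ^ 4 - 1 ≤ c5Count G := by
  classical
  have main := sum_five_cycle_ge (fun x y => 1 - if G.Adj x y then (1 : ℝ) else 0)
    (fun x y => by simp only [G.adj_comm]) (fun x y => by split_ifs <;> norm_num)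
    (fun x y => by split_ifs <;> norm_num) n h hn (by
      simp only [sum_sub_distrib, sum_adj_eq_two_mul_edgeCount, sum_const, card_univ,
        nsmul_eq_mul, ← hn, hh]
      ring)
  simp only [sub_sub_cancel] at main
  rw [← card_closed_walks_five] at main
  have count := c5Count_ge G hV
  rw [← hn] at count
  linarith

end Counting

/-- A tangent-line bound for the convex polynomial governing the 5-cycle density. -/
lemma cycle_polynomial_tangent (q h δ : ℝ) (hq : 0 ≤ q) (hq' : q ≤ 1 / 2) (hδ : 0 ≤ δ)
    (hh : h ≤ q + δ) :
    1 - 5 * q + 10 * q ^ 2 - 10 * q ^ 3 + 4 * q ^ 4 - 5 * δ ≤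
      1 - 5 * h + 10 * h ^ 2 - 10 * h ^ 3 + 4 * h ^ 4 := by
  have quad : 0 ≤ 4 * h ^ 2 + (8 * q - 10) * h + (10 - 20 * q + 12 * q ^ 2) := by
    nlinarith [sq_nonneg (2 * h + (2 * q - 5 / 2)), sq_nonneg (q - 5 / 8)]
  have slope_nonneg : 0 ≤ 5 - 20 * q + 30 * q ^ 2 - 16 * q ^ 3 := by
    nlinarith [mul_nonneg hq (sq_nonneg (q - 1 / 2)), sq_nonneg (q - 1 / 2)]
  have slope_le : 5 - 20 * q + 30 * q ^ 2 - 16 * q ^ 3 ≤ 5 := by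
    nlinarith [mul_nonneg hq (sq_nonneg (q - 1 / 2)), mul_nonneg hq (sub_nonneg.2 hq')]
  nlinarith [mul_nonneg (sq_nonneg (h - q)) quad,
    mul_nonneg slope_nonneg (sub_nonneg.2 hh), mul_nonneg (sub_nonneg.2 slope_le) hδ]

/-- For every integer `k ≥ 3` and `ε > 0` there is `N` such that every graph on `n ≥ N`
vertices with at least `(1 − 1/k)·n(n−1)/2` edges contains at least `(λ_k − ε)·n^5`
copies of `C₅`. -/
theorem c5_min_density (k : ℕ) (hk : 3 ≤ k) (ε : ℝ) (hε : 0 < ε) :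
    ∃ N : ℕ, ∀ n : ℕ, N ≤ n → ∀ G : SimpleGraph (Fin n),
      (1 - 1/(k:ℝ)) * ((n:ℝ) * ((n:ℝ) - 1) / 2) ≤ (edgeCount G : ℝ) →
      (lam k - ε) * (n:ℝ)^5 ≤ (c5Count G : ℝ) := by
  refine ⟨max 5 ⌈3 / ε⌉₊, fun n hN G hG => ?_⟩
  have hn5 : 5 ≤ n := le_trans (le_max_left _ _) hN
  have hnε : 3 / ε ≤ (n : ℝ) :=
    le_trans (Nat.le_ceil _) (by exact_mod_cast le_trans (le_max_right _ _) hN)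
  have hεn : 3 ≤ ε * n := by rwa [div_le_iff₀' hε] at hnε
  have hn1 : (1 : ℝ) ≤ n := by exact_mod_cast le_trans (by norm_num) hn5
  have hn0 : (n : ℝ) ≠ 0 := by positivity
  have hk3 : (3 : ℝ) ≤ k := by exact_mod_cast hk
  set q : ℝ := 1 / k with hq
  have hq0 : 0 ≤ q := by positivity
  have hq1 : q ≤ 1 / 2 := by
    rw [hq]
    exact one_div_le_one_div_of_le (by norm_num) (by linarith)
  have hlam : lam k = (1 - 5 * q + 10 * q ^ 2 - 10 * q ^ 3 + 4 * q ^ 4) / 10 := by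
    rw [lam, hq]
    field_simp
    ring
  set h : ℝ := 1 - 2 * edgeCount G / (n : ℝ) ^ 2 with hh
  have hedge : 2 * (edgeCount G : ℝ) = (1 - h) * (n : ℝ) ^ 2 := by
    rw [hh]
    field_simp
    ring
  have hle : h ≤ q + 1 / n := by
    have : h * (n : ℝ) ^ 2 ≤ (q + 1 / n) * (n : ℝ) ^ 2 := by
      have e : (q + 1 / n) * (n : ℝ) ^ 2 = q * (n : ℝ) ^ 2 + n := by field_simp
      rw [e]
      nlinarith
    exact le_of_mul_le_mul_right this (by positivity)
  have htan := cycle_polynomial_tangent q h (1 / n) hq0 hq1 (by positivity) hle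
  have hcount := c5Count_ge_of_edgeCount G (by simpa using hn5) n h (by simp) hedge
  have hscaled := mul_le_mul_of_nonneg_left htan (by positivity : (0 : ℝ) ≤ (n : ℝ) ^ 5)
  have herr : (n : ℝ) ^ 5 * (5 * (1 / n)) = 5 * (n : ℝ) ^ 4 := by field_simp
  have hpow : (1 : ℝ) ≤ (n : ℝ) ^ 4 := one_le_pow₀ hn1
  have hεpow : 3 * (n : ℝ) ^ 4 ≤ ε * (n : ℝ) ^ 5 := by
    calc 3 * (n : ℝ) ^ 4 ≤ (ε * n) * (n : ℝ) ^ 4 := by gcongr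
      _ = ε * (n : ℝ) ^ 5 := by ring
  rw [hlam]
  rw [mul_sub, herr] at hscaled
  linarith
end

section
/- For every integer k ≥ 3 and every ε > 0 there exist δ > 0 and N such that the following holds for all n ≥ N: if G is a simple graph on n vertices with at least (1 − 1/k − δ)·n(n−1)/2 edges and at most (λ_k + δ)·n^5 copies of the 5-cycle C₅, then G contains at most ε·n³ induced co-cherries, i.e., at most ε·n³ three-element vertex subsets spanning exactly one edge of G. -/
/-- A vertex set `s` spans exactly one edge of `G`. -/
def spansExactlyOneEdge {V : Type*} (G : SimpleGraph V) (s : Finset V) : Prop :=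
  ∃ u ∈ s, ∃ v ∈ s, G.Adj u v ∧
    ∀ a ∈ s, ∀ b ∈ s, G.Adj a b → (a = u ∧ b = v) ∨ (a = v ∧ b = u)

/-- The number of induced co-cherries in `G`: three-element vertex subsets
spanning exactly one edge. -/
noncomputable def coCherryCount {V : Type*} (G : SimpleGraph V) : ℕ :=
  Nat.card {s : Finset V // s.card = 3 ∧ spansExactlyOneEdge G s}

open Finset

section Kernel

variable {V : Type*} [Fintype V]

/-- The weighted degree of a vertex in a symmetric kernel. -/
def kernelDegree (U : V → V → ℝ) (x : V) : ℝ := ∑ y, U x y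

/-- The weighted number of two-step walks starting at a vertex. -/
def kernelWalkTwo (U : V → V → ℝ) (x : V) : ℝ := ∑ y, U x y * kernelDegree U y

/-- The homomorphism count of the 5-cycle in a kernel. -/
def kernelC5 (U : V → V → ℝ) : ℝ :=
  ∑ a, ∑ b, ∑ c, ∑ d, ∑ e, U a b * U b c * U c d * U d e * U e a

/-- The weight of the triples `x, y, z` with `xy`, `yz` in `U` and `xz` in its complement. -/
def kernelCherry (U : V → V → ℝ) : ℝ :=
  ∑ z, ∑ x, ∑ y, U x y * U y z * (1 - U x z)

/-- The homomorphism count of the 5-cycle through the squared kernel. -/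
theorem kernelC5_eq_sum_codegree (U : V → V → ℝ) :
    kernelC5 U = ∑ a, ∑ c, ∑ e, (∑ b, U a b * U b c) * (∑ d, U c d * U d e) * U e a := by
  unfold kernelC5
  refine sum_congr rfl fun a _ => ?_
  rw [sum_comm]
  refine sum_congr rfl fun c _ => ?_
  simp_rw [sum_mul_sum, sum_mul]
  conv_rhs => rw [sum_comm]
  refine sum_congr rfl fun b _ => ?_
  rw [sum_comm]
  exact sum_congr rfl fun e _ => sum_congr rfl fun d _ => by ring

theorem sum_kernelDegree_mul_left {U : V → V → ℝ} (hU : ∀ x y, U x y = U y x) (f : V → ℝ) :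
    ∑ x, ∑ y, U x y * f y = ∑ y, kernelDegree U y * f y := by
  rw [sum_comm]
  refine sum_congr rfl fun y _ => ?_
  rw [kernelDegree, sum_mul]
  exact sum_congr rfl fun x _ => by rw [hU]

theorem sum_kernelWalkTwo {U : V → V → ℝ} (hU : ∀ x y, U x y = U y x) :
    ∑ x, kernelWalkTwo U x = ∑ x, kernelDegree U x ^ 2 := by
  simp only [kernelWalkTwo, sum_kernelDegree_mul_left hU, sq]

theorem sum_kernelDegree_mul_sum_kernelWalkTwo {U : V → V → ℝ} (hU : ∀ x y, U x y = U y x) :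
    ∑ x, kernelDegree U x * ∑ y, U x y * kernelWalkTwo U y = ∑ x, kernelWalkTwo U x ^ 2 := by
  simp only [mul_sum]
  rw [sum_comm]
  refine sum_congr rfl fun y _ => ?_
  rw [sq]
  nth_rewrite 2 [kernelWalkTwo]
  rw [sum_mul]
  exact sum_congr rfl fun x _ => by rw [hU y x]; ring

/-- The homomorphism count of the path with four edges. -/
theorem sum_path_four {U : V → V → ℝ} (hU : ∀ x y, U x y = U y x) :
    ∑ z, ∑ x, ∑ y, ∑ x', ∑ y', U x y * U y x' * U x' y' * U y' z =
      ∑ x, kernelWalkTwo U x ^ 2 := by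
  rw [← sum_kernelDegree_mul_sum_kernelWalkTwo hU, ← sum_kernelDegree_mul_left hU, sum_comm]
  refine sum_congr rfl fun x _ => ?_
  rw [sum_comm]
  refine sum_congr rfl fun y _ => ?_
  rw [sum_comm, mul_sum]
  refine sum_congr rfl fun x' _ => ?_
  rw [sum_comm, kernelWalkTwo, mul_sum, mul_sum]
  refine sum_congr rfl fun y' _ => ?_
  rw [← mul_sum, kernelDegree]
  ring

theorem kernelC5_compl {U : V → V → ℝ} (hU : ∀ x y, U x y = U y x) :
    kernelC5 (fun x y => 1 - U x y) =
      (Fintype.card V : ℝ) ^ 5 - 5 * (Fintype.card V : ℝ) ^ 3 * ∑ x, kernelDegree U x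
        + 5 * (Fintype.card V : ℝ) ^ 2 * ∑ x, kernelDegree U x ^ 2
        + 5 * (Fintype.card V : ℝ) * (∑ x, kernelDegree U x) ^ 2
        - 5 * (Fintype.card V : ℝ) * ∑ x, kernelDegree U x * kernelWalkTwo U x
        - 5 * (∑ x, kernelDegree U x) * ∑ x, kernelDegree U x ^ 2
        + 5 * ∑ x, kernelWalkTwo U x ^ 2 - kernelC5 U := by
  rw [kernelC5_eq_sum_codegree, kernelC5_eq_sum_codegree U]
  set n : ℝ := (Fintype.card V : ℝ) with hn
  set d := kernelDegree U with hd
  set w := kernelWalkTwo U with hw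
  set E := ∑ x, d x with hE
  set S : V → V → ℝ := fun a c => ∑ b, U a b * U b c with hS
  set T : V → V → ℝ := fun c a => ∑ e, S c e * U e a with hT
  set z : V → ℝ := fun a => ∑ e, U a e * w e with hz
  have hSsymm (a c : V) : S a c = S c a :=
    sum_congr rfl fun b _ => by rw [hU a b, hU b c, mul_comm]
  have hdcol (c : V) : ∑ b, U b c = d c := sum_congr rfl fun b _ => hU b c
  have hcodeg (a c : V) : ∑ b, (1 - U a b) * (1 - U b c) = n - d a - d c + S a c := by
    have h₁ : n = ∑ _b : V, (1 : ℝ) := by simp [hn]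
    rw [h₁, ← hdcol c, hd, kernelDegree, hS, ← sum_sub_distrib, ← sum_sub_distrib,
      ← sum_add_distrib]
    exact sum_congr rfl fun b _ => by ring
  have hSrow (a : V) : ∑ c, S a c = w a := by
    simp only [hS]
    rw [sum_comm]
    exact sum_congr rfl fun b _ => by rw [← mul_sum]; rfl
  have hSd (a : V) : ∑ c, S a c * d c = z a := by
    simp only [hS, hz, sum_mul]
    rw [sum_comm]
    refine sum_congr rfl fun b _ => ?_
    rw [hw, kernelWalkTwo, mul_sum]
    exact sum_congr rfl fun c _ => by ring
  have hTcol (a : V) : ∑ c, T c a = z a := by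
    simp only [hT, hz]
    rw [sum_comm]
    refine sum_congr rfl fun b _ => ?_
    rw [← sum_mul, ← hSrow b, hU a b, mul_comm]
    simp only [hSsymm b]
  have hdT (a : V) : ∑ c, d c * T c a = ∑ e, U a e * z e := by
    simp only [hT, mul_sum]
    rw [sum_comm]
    refine sum_congr rfl fun b _ => ?_
    rw [← hSd b, mul_sum, hU a b]
    exact sum_congr rfl fun c _ => by rw [hSsymm b]; ring
  have hzsum : ∑ a, z a = ∑ a, d a * w a := sum_kernelDegree_mul_left hU w
  have hdz : ∑ a, d a * z a = ∑ a, w a ^ 2 := sum_kernelDegree_mul_sum_kernelWalkTwo hU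
  have hUz : ∑ a, ∑ e, U a e * z e = ∑ a, w a ^ 2 := by
    rw [sum_kernelDegree_mul_left hU z, ← hdz]
  have hwsum : ∑ a, w a = ∑ a, d a ^ 2 := sum_kernelWalkTwo hU
  have hUcol (a c : V) : ∑ e, (n - d c - d e + S c e) * U e a
      = (n * d a - w a) - d a * d c + T c a := by
    have h₁ : w a = ∑ e, d e * U e a :=
      sum_congr rfl fun e _ => by rw [hU a e, mul_comm]
    rw [h₁]
    simp only [hT]
    rw [← hdcol a, mul_sum, sum_mul, ← sum_sub_distrib, ← sum_sub_distrib, ← sum_add_distrib]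
    exact sum_congr rfl fun e _ => by ring
  have hfree (c : V) : ∑ e, (n - d c - d e + S c e) = n ^ 2 - E - n * d c + w c := by
    rw [sum_add_distrib, sum_sub_distrib, sum_const, hSrow, card_univ, nsmul_eq_mul, ← hn, ← hE]
    ring
  have hfree' (c : V) : ∑ a, (n - d a - d c + S a c) = n ^ 2 - E - n * d c + w c := by
    rw [← hfree c]
    exact sum_congr rfl fun a _ => by rw [hSsymm a c]; ring
  have hconst (r : ℝ) : ∑ _x : V, r = n * r := by simp [hn]
  have hsplit : ∑ a, ∑ c, ∑ e, (∑ b, (1 - U a b) * (1 - U b c)) *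
      (∑ b, (1 - U c b) * (1 - U b e)) * (1 - U e a) =
      ∑ c, (n ^ 2 - E - n * d c + w c) ^ 2 - ∑ a, ∑ c, (n - d a - d c + S a c) *
        ((n * d a - w a) - d a * d c + T c a) := by
    have h₁ : ∑ c, (n ^ 2 - E - n * d c + w c) ^ 2 =
        ∑ a, ∑ c, (n - d a - d c + S a c) * ∑ e, (n - d c - d e + S c e) := by
      rw [sum_comm]
      refine sum_congr rfl fun c _ => ?_
      rw [← sum_mul, hfree, hfree', sq]
    rw [h₁, ← sum_sub_distrib]
    refine sum_congr rfl fun a _ => ?_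
    rw [← sum_sub_distrib]
    refine sum_congr rfl fun c _ => ?_
    rw [← hUcol, ← mul_sub, ← sum_sub_distrib, mul_sum]
    exact sum_congr rfl fun e _ => by rw [hcodeg, hcodeg]; ring
  have hinner (a : V) : ∑ c, (n - d a - d c + S a c) * ((n * d a - w a) - d a * d c + T c a) =
      n * (n - d a) * (n * d a - w a) - (n - d a) * d a * E + (n - d a) * z a
        - (n * d a - w a) * E + d a * ∑ c, d c ^ 2 - ∑ e, U a e * z e
        + (n * d a - w a) * w a - d a * z a + ∑ c, S a c * T c a := by
    have h₁ (c : V) : (n - d a - d c + S a c) * ((n * d a - w a) - d a * d c + T c a) =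
        (n - d a) * (n * d a - w a) - (n - d a) * d a * d c + (n - d a) * T c a
          - (n * d a - w a) * d c + d a * d c ^ 2 - d c * T c a
          + (n * d a - w a) * S a c - d a * (S a c * d c) + S a c * T c a := by ring
    simp only [h₁, sum_add_distrib, sum_sub_distrib, ← mul_sum, hconst, hTcol, hdT, hSrow, hSd]
    ring
  have hcycle : ∑ a, ∑ c, ∑ e, S a c * S c e * U e a = ∑ a, ∑ c, S a c * T c a :=
    sum_congr rfl fun a _ => sum_congr rfl fun c _ => by
      simp only [hT, mul_sum, mul_assoc]
  have hsquare : ∑ c, (n ^ 2 - E - n * d c + w c) ^ 2 =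
      n * (n ^ 2 - E) ^ 2 - 2 * n * (n ^ 2 - E) * E + (n ^ 2 + 2 * (n ^ 2 - E)) * ∑ c, d c ^ 2
        - 2 * n * ∑ c, d c * w c + ∑ c, w c ^ 2 := by
    have h₁ (c : V) : (n ^ 2 - E - n * d c + w c) ^ 2 = (n ^ 2 - E) ^ 2
        - 2 * n * (n ^ 2 - E) * d c + n ^ 2 * d c ^ 2 + 2 * (n ^ 2 - E) * w c
        - 2 * n * (d c * w c) + w c ^ 2 := by ring
    simp only [h₁, sum_add_distrib, sum_sub_distrib, ← mul_sum, hconst, hwsum]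
    ring
  have houter : ∑ a, ∑ c, (n - d a - d c + S a c) * ((n * d a - w a) - d a * d c + T c a) =
      n ^ 3 * E - 2 * n ^ 2 * ∑ c, d c ^ 2 - 2 * n * E ^ 2 + 3 * n * ∑ c, d c * w c
        + 3 * E * ∑ c, d c ^ 2 - 4 * ∑ c, w c ^ 2 + ∑ a, ∑ c, S a c * T c a := by
    have h₁ (a : V) : n * (n - d a) * (n * d a - w a) - (n - d a) * d a * E + (n - d a) * z a
        - (n * d a - w a) * E + d a * ∑ c, d c ^ 2 - ∑ e, U a e * z e
        + (n * d a - w a) * w a - d a * z a + ∑ c, S a c * T c a =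
        (n ^ 3 - 2 * n * E + ∑ c, d c ^ 2) * d a + (E - n ^ 2) * d a ^ 2 + (E - n ^ 2) * w a
          + 2 * n * (d a * w a) + n * z a - 2 * (d a * z a) - w a ^ 2
          - ∑ e, U a e * z e + ∑ c, S a c * T c a := by ring
    simp only [hinner, h₁, sum_add_distrib, sum_sub_distrib, ← mul_sum, hwsum, hzsum, hdz, hUz]
    rw [← hE]
    ring
  rw [hsplit, hsquare, houter, hcycle]
  ring

/-- The lower bound on the path terms: a sum of squares of polynomials in the kernel operator. -/
theorem kernel_path_moments {U : V → V → ℝ} (hU : ∀ x y, U x y = U y x) {e : ℝ}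
    (he : ∑ x, kernelDegree U x = e * (Fintype.card V : ℝ) ^ 2) :
    (5 * (1 - e) * e ^ 2 - 5 * e ^ 3 + 4 * e ^ 4) * (Fintype.card V : ℝ) ^ 5 ≤
      5 * (1 - e) * (Fintype.card V : ℝ) ^ 2 * ∑ x, kernelDegree U x ^ 2
        - 5 * (Fintype.card V : ℝ) * ∑ x, kernelDegree U x * kernelWalkTwo U x
        + 4 * ∑ x, kernelWalkTwo U x ^ 2 := by
  set n : ℝ := (Fintype.card V : ℝ) with hn
  have h₁ : 0 ≤ ∑ x, (n * kernelDegree U x - e * n ^ 2) ^ 2 :=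
    sum_nonneg fun x _ => sq_nonneg _
  have h₂ : 0 ≤ ∑ x, (2 * kernelWalkTwo U x + ((8 * e - 5) / 4 - 2 * e) * n * kernelDegree U x
      - e * ((8 * e - 5) / 4) * n ^ 2) ^ 2 :=
    sum_nonneg fun x _ => sq_nonneg _
  have e₁ : ∑ x, (n * kernelDegree U x - e * n ^ 2) ^ 2 =
      n ^ 2 * ∑ x, kernelDegree U x ^ 2 - 2 * e * n ^ 3 * ∑ x, kernelDegree U x
        + e ^ 2 * n ^ 5 := by
    have : e ^ 2 * n ^ 5 = ∑ _x : V, e ^ 2 * n ^ 4 := by simp [← hn]; ring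
    rw [this, mul_sum, mul_sum, ← sum_sub_distrib, ← sum_add_distrib]
    exact sum_congr rfl fun x _ => by ring
  have e₂ (p q r : ℝ) : ∑ x, (p * kernelWalkTwo U x + q * kernelDegree U x + r) ^ 2 =
      p ^ 2 * ∑ x, kernelWalkTwo U x ^ 2
        + 2 * p * q * ∑ x, kernelDegree U x * kernelWalkTwo U x
        + (q ^ 2 + 2 * p * r) * ∑ x, kernelDegree U x ^ 2
        + 2 * q * r * ∑ x, kernelDegree U x + r ^ 2 * n := by
    have h₁ (x : V) : (p * kernelWalkTwo U x + q * kernelDegree U x + r) ^ 2 =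
        p ^ 2 * kernelWalkTwo U x ^ 2 + 2 * p * q * (kernelDegree U x * kernelWalkTwo U x)
          + q ^ 2 * kernelDegree U x ^ 2 + 2 * p * r * kernelWalkTwo U x
          + 2 * q * r * kernelDegree U x + r ^ 2 := by ring
    simp only [h₁, sum_add_distrib, ← mul_sum, sum_kernelWalkTwo hU, sum_const, card_univ,
      nsmul_eq_mul, ← hn]
    ring
  have h₃ := e₂ 2 (((8 * e - 5) / 4 - 2 * e) * n) (-(e * ((8 * e - 5) / 4) * n ^ 2))
  have h₄ : 0 ≤ (128 * e ^ 2 - 160 * e + 55) / 16 := by nlinarith [sq_nonneg (8 * e - 5)]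
  have h₅ := mul_nonneg h₄ h₁
  simp only [sub_eq_add_neg] at h₂ h₃
  rw [h₃, he] at h₂
  rw [e₁, he] at h₅
  linear_combination h₂ + h₅

/-- Sidorenko's inequality for the 4-cycle. -/
theorem pow_four_sum_le_card_mul_sum_rectangle (f : V → V → ℝ) :
    (∑ x, ∑ y, f x y) ^ 4 ≤ (Fintype.card V : ℝ) ^ 4 *
      ∑ x, ∑ y, ∑ x', ∑ y', f x y * f x' y * f x' y' * f x y' := by
  set n : ℝ := (Fintype.card V : ℝ) with hn
  have h₁ : (∑ x, ∑ y, f x y) ^ 2 ≤ n * ∑ y, ∑ y', ∑ x, f x y * f x y' := by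
    have h := sq_sum_le_card_mul_sum_sq (s := univ) (f := fun x => ∑ y, f x y)
    refine h.trans_eq ?_
    rw [card_univ, ← hn]
    simp_rw [sq, sum_mul_sum]
    rw [sum_comm]
    congr 1
    refine sum_congr rfl fun y _ => ?_
    rw [sum_comm]
  have h₂ : (∑ y, ∑ y', ∑ x, f x y * f x y') ^ 2 ≤
      n ^ 2 * ∑ y, ∑ y', (∑ x, f x y * f x y') ^ 2 := by
    have h := sq_sum_le_card_mul_sum_sq (s := (univ : Finset (V × V)))
      (f := fun p => ∑ x, f x p.1 * f x p.2)
    rw [card_univ, Fintype.card_prod, Nat.cast_mul, ← hn, ← sq] at h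
    simpa only [Fintype.sum_prod_type] using h
  have h₃ : ∑ y, ∑ y', (∑ x, f x y * f x y') ^ 2 =
      ∑ x, ∑ y, ∑ x', ∑ y', f x y * f x' y * f x' y' * f x y' := by
    simp_rw [sq, sum_mul_sum]
    conv_rhs => rw [sum_comm]
    refine sum_congr rfl fun y _ => ?_
    rw [sum_comm]
    refine sum_congr rfl fun x _ => ?_
    rw [sum_comm]
    exact sum_congr rfl fun x' _ => sum_congr rfl fun y' _ => by ring
  calc (∑ x, ∑ y, f x y) ^ 4 = ((∑ x, ∑ y, f x y) ^ 2) ^ 2 := by ring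
    _ ≤ (n * ∑ y, ∑ y', ∑ x, f x y * f x y') ^ 2 := pow_le_pow_left₀ (sq_nonneg _) h₁ 2
    _ = n ^ 2 * (∑ y, ∑ y', ∑ x, f x y * f x y') ^ 2 := by ring
    _ ≤ n ^ 2 * (n ^ 2 * ∑ y, ∑ y', (∑ x, f x y * f x y') ^ 2) := by gcongr
    _ = _ := by rw [h₃]; ring

theorem kernelCherry_pow_four_le {U : V → V → ℝ} (hU : ∀ x y, U x y = U y x)
    (h0 : ∀ x y, 0 ≤ U x y) (h1 : ∀ x y, U x y ≤ 1) :
    kernelCherry U ^ 4 ≤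
      (Fintype.card V : ℝ) ^ 7 * (∑ x, kernelWalkTwo U x ^ 2 - kernelC5 U) := by
  set n : ℝ := (Fintype.card V : ℝ) with hn
  have hpath : ∑ x, kernelWalkTwo U x ^ 2 - kernelC5 U =
      ∑ z, ∑ x, ∑ y, ∑ x', ∑ y', U x y * U y x' * U x' y' * U y' z * (1 - U x z) := by
    rw [← sum_path_four hU, kernelC5]
    simp only [← sum_sub_distrib]
    refine sum_congr rfl fun z _ => sum_congr rfl fun x _ => sum_congr rfl fun y _ =>
      sum_congr rfl fun x' _ => sum_congr rfl fun y' _ => ?_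
    rw [hU z x]
    ring
  have hterm (z : V) : (∑ x, ∑ y, U x y * U y z * (1 - U x z)) ^ 4 ≤
      n ^ 4 * ∑ x, ∑ y, ∑ x', ∑ y', U x y * U y x' * U x' y' * U y' z * (1 - U x z) := by
    have hA0 (x : V) : 0 ≤ 1 - U x z := sub_nonneg.2 (h1 x z)
    have hA1 (x : V) : 1 - U x z ≤ 1 := sub_le_self _ (h0 x z)
    refine (pow_four_sum_le_card_mul_sum_rectangle fun x y => U x y * U y z * (1 - U x z)).trans
      (mul_le_mul_of_nonneg_left ?_ (by positivity))
    refine sum_le_sum fun x _ => sum_le_sum fun y _ => sum_le_sum fun x' _ =>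
      sum_le_sum fun y' _ => ?_
    have b₁ : U x y * U y z * (1 - U x z) ≤ U x y * (1 - U x z) :=
      mul_le_mul_of_nonneg_right (mul_le_of_le_one_right (h0 _ _) (h1 _ _)) (hA0 x)
    have b₂ : U x' y * U y z * (1 - U x' z) ≤ U y x' := by
      rw [hU y x', mul_assoc]
      exact mul_le_of_le_one_right (h0 _ _) (mul_le_one₀ (h1 _ _) (hA0 _) (hA1 _))
    have b₃ : U x' y' * U y' z * (1 - U x' z) ≤ U x' y' := by
      rw [mul_assoc]
      exact mul_le_of_le_one_right (h0 _ _) (mul_le_one₀ (h1 _ _) (hA0 _) (hA1 _))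
    have b₄ : U x y' * U y' z * (1 - U x z) ≤ U y' z :=
      (mul_le_of_le_one_right (mul_nonneg (h0 _ _) (h0 _ _)) (hA1 _)).trans
        (mul_le_of_le_one_left (h0 _ _) (h1 _ _))
    have p (u v : V) : 0 ≤ U u v * U v z * (1 - U u z) :=
      mul_nonneg (mul_nonneg (h0 _ _) (h0 _ _)) (hA0 _)
    calc _ ≤ U x y * (1 - U x z) * U y x' * U x' y' * U y' z :=
          mul_le_mul (mul_le_mul (mul_le_mul b₁ b₂ (p _ _) (mul_nonneg (h0 _ _) (hA0 _))) b₃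
            (p _ _) (mul_nonneg (mul_nonneg (h0 _ _) (hA0 _)) (h0 _ _))) b₄ (p _ _)
            (mul_nonneg (mul_nonneg (mul_nonneg (h0 _ _) (hA0 _)) (h0 _ _)) (h0 _ _))
      _ = _ := by ring
  have hpow : kernelCherry U ^ 4 ≤
      n ^ 3 * ∑ z, (∑ x, ∑ y, U x y * U y z * (1 - U x z)) ^ 4 := by
    have h₁ := sq_sum_le_card_mul_sum_sq (s := univ)
      (f := fun z => ∑ x, ∑ y, U x y * U y z * (1 - U x z))
    have h₂ := sq_sum_le_card_mul_sum_sq (s := univ)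
      (f := fun z => (∑ x, ∑ y, U x y * U y z * (1 - U x z)) ^ 2)
    rw [card_univ, ← hn] at h₁ h₂
    simp only [← pow_mul, Nat.reduceMul] at h₂
    calc kernelCherry U ^ 4 = (kernelCherry U ^ 2) ^ 2 := by ring
      _ ≤ (n * ∑ z, (∑ x, ∑ y, U x y * U y z * (1 - U x z)) ^ 2) ^ 2 :=
        pow_le_pow_left₀ (sq_nonneg _) h₁ 2
      _ = n ^ 2 * (∑ z, (∑ x, ∑ y, U x y * U y z * (1 - U x z)) ^ 2) ^ 2 := by ring
      _ ≤ n ^ 2 * (n * ∑ z, (∑ x, ∑ y, U x y * U y z * (1 - U x z)) ^ 4) := by gcongr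
      _ = _ := by ring
  calc kernelCherry U ^ 4
      ≤ n ^ 3 * ∑ z, (∑ x, ∑ y, U x y * U y z * (1 - U x z)) ^ 4 := hpow
    _ ≤ n ^ 3 * ∑ z, n ^ 4 *
        ∑ x, ∑ y, ∑ x', ∑ y', U x y * U y x' * U x' y' * U y' z * (1 - U x z) := by
      gcongr with z
      exact hterm z
    _ = _ := by rw [hpath, ← mul_sum]; ring

/-- A lower bound on 5-cycles in the complement in terms of the density of `U`, with a surplus
coming from cherries. -/
theorem kernelC5_compl_lower_bound {U : V → V → ℝ} (hU : ∀ x y, U x y = U y x)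
    (h0 : ∀ x y, 0 ≤ U x y) (h1 : ∀ x y, U x y ≤ 1) {e : ℝ}
    (he : ∑ x, kernelDegree U x = e * (Fintype.card V : ℝ) ^ 2) :
    (Fintype.card V : ℝ) ^ 12 * (1 - 5 * e + 10 * e ^ 2 - 10 * e ^ 3 + 4 * e ^ 4)
      + kernelCherry U ^ 4 ≤ (Fintype.card V : ℝ) ^ 7 * kernelC5 (fun x y => 1 - U x y) := by
  have h₁ := kernelCherry_pow_four_le hU h0 h1
  have h₂ := mul_le_mul_of_nonneg_left (kernel_path_moments hU he)
    (by positivity : 0 ≤ (Fintype.card V : ℝ) ^ 7)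
  rw [kernelC5_compl hU, he]
  linear_combination h₁ + h₂

end Kernel

section Graph

open scoped Classical in
/-- The indicator of non-adjacency, including the diagonal. -/
noncomputable def nonAdj {V : Type*} (G : SimpleGraph V) (x y : V) : ℝ :=
  if G.Adj x y then 0 else 1

theorem exists_nonAdj_path_of_spansExactlyOneEdge {V : Type*} {G : SimpleGraph V} {s : Finset V}
    (hs : #s = 3) (h : spansExactlyOneEdge G s) :
    ∃ p : V × V × V, (∀ a, a ∈ s ↔ a = p.1 ∨ a = p.2.1 ∨ a = p.2.2) ∧
      ¬ G.Adj p.2.1 p.2.2 ∧ ¬ G.Adj p.2.2 p.1 ∧ G.Adj p.2.1 p.1 := by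
  classical
  obtain ⟨u, hu, v, hv, huv, huniq⟩ := h
  obtain ⟨y, hy, hyu, hyv⟩ : ∃ y ∈ s, y ≠ u ∧ y ≠ v := by
    by_contra! hcon
    have hsub : s ⊆ {u, v} := fun a ha => by
      by_cases hau : a = u
      · simp [hau]
      · simp [hcon a ha hau]
    have := (card_le_card hsub).trans card_le_two
    omega
  have heq : ({u, v, y} : Finset V) = s := by
    refine eq_of_subset_of_card_le (by simp [insert_subset_iff, hu, hv, hy]) ?_
    rw [hs, card_eq_three.2 ⟨u, v, y, huv.ne, hyu.symm, hyv.symm, rfl⟩]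
  refine ⟨(v, u, y), fun a => ?_, fun hadj => ?_, fun hadj => ?_, huv⟩
  · simp only [← heq, mem_insert, mem_singleton]
    tauto
  · rcases huniq u hu y hy hadj with h | h
    · exact hyv h.2
    · exact hyu h.2
  · rcases huniq y hy v hv hadj with h | h
    · exact hyu h.1
    · exact hyv h.1

variable {V : Type*} [Fintype V] (G : SimpleGraph V)

theorem sum_kernelDegree_nonAdj :
    ∑ x, kernelDegree (nonAdj G) x = (Fintype.card V : ℝ) ^ 2 - 2 * edgeCount G := by
  classical
  have h₁ (x : V) : kernelDegree (nonAdj G) x = Fintype.card V - G.degree x := by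
    have h : (G.degree x : ℝ) = ∑ y, if G.Adj x y then 1 else 0 := by
      rw [sum_boole, ← G.card_neighborFinset_eq_degree, G.neighborFinset_eq_filter]
    rw [h, kernelDegree, ← card_univ, ← nsmul_one, ← sum_const, ← sum_sub_distrib]
    refine sum_congr rfl fun y _ => ?_
    rw [nonAdj]
    split_ifs <;> norm_num
  have h₂ : edgeCount G = #G.edgeFinset := by
    rw [edgeCount, Nat.card_eq_fintype_card, SimpleGraph.edgeFinset_card]
  have h₃ := congrArg (Nat.cast : ℕ → ℝ) G.sum_degrees_eq_twice_card_edges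
  push_cast at h₃
  simp only [h₁, sum_sub_distrib, h₃, h₂, sum_const, card_univ, nsmul_eq_mul]
  ring

theorem card_not_injective_le :
    (Nat.card {v : Fin 5 → V // ¬ Function.Injective v} : ℝ) ≤ 10 * (Fintype.card V : ℝ) ^ 4 := by
  classical
  have h₁ : Fintype.card {v : Fin 5 → V // Function.Injective v} =
      (Fintype.card V).descFactorial 5 := by
    rw [← Fintype.card_congr (Equiv.subtypeInjectiveEquivEmbedding (Fin 5) V).symm,
      Fintype.card_embedding_eq, Fintype.card_fin]
  have h₂ := Fintype.card_subtype_compl (fun v : Fin 5 → V => Function.Injective v)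
  have h₃ : Fintype.card V ^ 5 ≤ (Fintype.card V).descFactorial 5 + 10 * Fintype.card V ^ 4 := by
    generalize Fintype.card V = n
    rcases le_or_gt n 4 with h | h
    · interval_cases n <;> decide
    · obtain ⟨m, rfl⟩ := Nat.exists_eq_add_of_le h
      simp only [Nat.descFactorial_succ, Nat.descFactorial_zero]
      rw [show 4 + 1 + m - 4 = m + 1 by omega, show 4 + 1 + m - 3 = m + 2 by omega,
        show 4 + 1 + m - 2 = m + 3 by omega, show 4 + 1 + m - 1 = m + 4 by omega,
        show 4 + 1 + m - 0 = m + 5 by omega]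
      nlinarith [Nat.zero_le m, Nat.zero_le (m ^ 2), Nat.zero_le (m ^ 3)]
  rw [Nat.card_eq_fintype_card, h₂, h₁, Fintype.card_pi_const]
  exact_mod_cast Nat.sub_le_iff_le_add'.2 h₃

theorem kernelC5_adj_le :
    kernelC5 (fun x y => 1 - nonAdj G x y) ≤
      10 * c5Count G + 9 + 10 * (Fintype.card V : ℝ) ^ 4 := by
  classical
  have h₁ : kernelC5 (fun x y => 1 - nonAdj G x y) =
      #{p : V × V × V × V × V | G.Adj p.1 p.2.1 ∧ G.Adj p.2.1 p.2.2.1 ∧ G.Adj p.2.2.1 p.2.2.2.1 ∧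
        G.Adj p.2.2.2.1 p.2.2.2.2 ∧ G.Adj p.2.2.2.2 p.1} := by
    rw [← sum_boole]
    simp only [Fintype.sum_prod_type, kernelC5]
    refine sum_congr rfl fun a _ => sum_congr rfl fun b _ => sum_congr rfl fun c _ =>
      sum_congr rfl fun d _ => sum_congr rfl fun e _ => ?_
    simp only [nonAdj]
    split_ifs <;> simp_all
  have h₂ : #{p : V × V × V × V × V | G.Adj p.1 p.2.1 ∧ G.Adj p.2.1 p.2.2.1 ∧
      G.Adj p.2.2.1 p.2.2.2.1 ∧ G.Adj p.2.2.2.1 p.2.2.2.2 ∧ G.Adj p.2.2.2.2 p.1} ≤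
      #{v : Fin 5 → V | ∀ i, G.Adj (v i) (v (i + 1))} := by
    refine card_le_card_of_injOn (fun p => ![p.1, p.2.1, p.2.2.1, p.2.2.2.1, p.2.2.2.2]) ?_ ?_
    · rintro p hp
      simp only [coe_filter, mem_univ, true_and, Set.mem_ofPred_eq] at hp ⊢
      obtain ⟨h₀, h₁, h₂, h₃, h₄⟩ := hp
      intro i
      fin_cases i <;> assumption
    · rintro ⟨a, b, c, d, e⟩ - ⟨a', b', c', d', e'⟩ - h
      simpa using h
  have h₃ : #{v : Fin 5 → V | ∀ i, G.Adj (v i) (v (i + 1))} ≤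
      Nat.card {v : Fin 5 → V // Function.Injective v ∧ ∀ i : Fin 5, G.Adj (v i) (v (i + 1))}
        + Nat.card {v : Fin 5 → V // ¬ Function.Injective v} := by
    rw [Nat.card_eq_fintype_card, Nat.card_eq_fintype_card, Fintype.card_subtype,
      Fintype.card_subtype]
    refine (card_le_card fun v hv => ?_).trans (card_union_le _ _)
    simp only [mem_union, mem_filter, mem_univ, true_and] at hv ⊢
    tauto
  have h₄ : Nat.card {v : Fin 5 → V // Function.Injective v ∧
      ∀ i : Fin 5, G.Adj (v i) (v (i + 1))} ≤ 10 * c5Count G + 9 := by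
    rw [c5Count]
    omega
  have h₅ := card_not_injective_le (V := V)
  have h₆ := h₂.trans (h₃.trans (Nat.add_le_add_right h₄ _))
  have h₇ := (Nat.cast_le (α := ℝ)).2 h₆
  push_cast at h₇
  rw [h₁]
  linarith

theorem coCherryCount_le_kernelCherry : (coCherryCount G : ℝ) ≤ kernelCherry (nonAdj G) := by
  classical
  have h₁ : kernelCherry (nonAdj G) =
      #{p : V × V × V | ¬ G.Adj p.2.1 p.2.2 ∧ ¬ G.Adj p.2.2 p.1 ∧ G.Adj p.2.1 p.1} := by
    rw [← sum_boole]
    simp only [Fintype.sum_prod_type, kernelCherry]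
    refine sum_congr rfl fun z _ => sum_congr rfl fun x _ => sum_congr rfl fun y _ => ?_
    simp only [nonAdj]
    split_ifs <;> simp_all
  rw [h₁, coCherryCount, Nat.cast_le, ← Fintype.card_subtype, ← Nat.card_eq_fintype_card]
  choose f hf using fun s : {s : Finset V // #s = 3 ∧ spansExactlyOneEdge G s} =>
    exists_nonAdj_path_of_spansExactlyOneEdge s.2.1 s.2.2
  refine Nat.card_le_card_of_injective (fun s => ⟨f s, (hf s).2⟩) fun s t hst => ?_
  have hst' : f s = f t := congrArg Subtype.val hst
  ext a
  rw [(hf s).1, (hf t).1, hst']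

end Graph

theorem turan_density_poly_le {t e η : ℝ} (ht0 : 0 ≤ t) (ht : t ≤ 1 / 3) (he0 : 0 ≤ e)
    (he1 : e ≤ 1) (hη : 0 ≤ η) (het : e ≤ t + η) :
    1 - 5 * t + 10 * t ^ 2 - 10 * t ^ 3 + 4 * t ^ 4 ≤
      1 - 5 * e + 10 * e ^ 2 - 10 * e ^ 3 + 4 * e ^ 4 + 20 * η := by
  set D := 5 * (1 - (t + e)) ^ 2 + (t ^ 2 + e ^ 2) * (5 - 4 * (t + e)) with hD
  suffices (e - t) * D ≤ 20 * η by rw [hD] at this; linarith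
  rcases le_total e t with h | h
  · have : 0 ≤ D :=
      add_nonneg (by positivity) (mul_nonneg (by positivity) (by linarith))
    nlinarith [mul_nonneg (sub_nonneg.2 h) this]
  · have : D ≤ 20 := by
      have h₁ : t ^ 2 + e ^ 2 ≤ 2 := by nlinarith
      have h₂ : (t ^ 2 + e ^ 2) * (5 - 4 * (t + e)) ≤ (t ^ 2 + e ^ 2) * 5 :=
        mul_le_mul_of_nonneg_left (by linarith) (by positivity)
      have h₃ : (1 - (t + e)) ^ 2 ≤ 1 := by
        rw [sq_le_one_iff_abs_le_one, abs_le]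
        constructor <;> linarith
      linarith
    nlinarith [mul_nonneg (sub_nonneg.2 h) (sub_nonneg.2 this)]

/-- For every `k ≥ 3` and `ε > 0` there are `δ > 0` and `N` such that every graph on
`n ≥ N` vertices with at least `(1 − 1/k − δ)·n(n−1)/2` edges and at most
`(λ_k + δ)·n^5` copies of `C₅` has at most `ε·n³` induced co-cherries. -/
theorem few_cocherries (k : ℕ) (hk : 3 ≤ k) (ε : ℝ) (hε : 0 < ε) :
    ∃ δ : ℝ, 0 < δ ∧ ∃ N : ℕ, ∀ n : ℕ, N ≤ n → ∀ G : SimpleGraph (Fin n),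
      (1 - 1/(k:ℝ) - δ) * ((n:ℝ) * ((n:ℝ) - 1) / 2) ≤ (edgeCount G : ℝ) →
      (c5Count G : ℝ) ≤ (lam k + δ) * (n:ℝ)^5 →
      (coCherryCount G : ℝ) ≤ ε * (n:ℝ)^3 := by
  have hδ : 0 < ε ^ 4 / 100 := by positivity
  obtain ⟨N, hN⟩ := exists_nat_gt (1 / (ε ^ 4 / 100))
  refine ⟨ε ^ 4 / 100, hδ, N, fun n hn G hedge hC5 => ?_⟩
  set δ := ε ^ 4 / 100 with hδdef
  have hNn : 1 / δ < n := hN.trans_le (by exact_mod_cast hn)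
  have hnpos : (0 : ℝ) < n := (by positivity : 0 < 1 / δ).trans hNn
  have hn1 : (1 : ℝ) ≤ n := by exact_mod_cast (Nat.cast_pos.1 hnpos)
  have hδn : 1 ≤ δ * n := by
    rw [div_lt_iff₀ hδ] at hNn
    linarith
  have hk' : (3 : ℝ) ≤ k := by exact_mod_cast hk
  set t : ℝ := 1 / k with ht
  have ht0 : 0 ≤ t := by positivity
  have ht3 : t ≤ 1 / 3 := one_div_le_one_div_of_le (by norm_num) hk'
  have hlam : 10 * lam k = 1 - 5 * t + 10 * t ^ 2 - 10 * t ^ 3 + 4 * t ^ 4 := by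
    rw [lam, ht]
    field_simp
    ring
  set e : ℝ := (∑ x, kernelDegree (nonAdj G) x) / n ^ 2 with he
  have he' : ∑ x, kernelDegree (nonAdj G) x = e * n ^ 2 := by
    rw [he]
    field_simp
  have hU0 (x y : Fin n) : 0 ≤ nonAdj G x y := by
    rw [nonAdj]
    split_ifs <;> norm_num
  have hU1 (x y : Fin n) : nonAdj G x y ≤ 1 := by
    rw [nonAdj]
    split_ifs <;> norm_num
  have hU (x y : Fin n) : nonAdj G x y = nonAdj G y x := by
    classical exact if_congr (G.adj_comm x y) rfl rfl
  have hsum := sum_kernelDegree_nonAdj G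
  rw [Fintype.card_fin, he'] at hsum
  have hn2 : (0 : ℝ) < (n : ℝ) ^ 2 := by positivity
  have he0 : 0 ≤ e :=
    div_nonneg (sum_nonneg fun x _ => sum_nonneg fun y _ => hU0 x y) hn2.le
  have he1 : e ≤ 1 := by
    have : (0 : ℝ) ≤ edgeCount G := Nat.cast_nonneg _
    refine le_of_mul_le_mul_right ?_ hn2
    linarith
  have het : e ≤ t + 2 * δ := by
    refine le_of_mul_le_mul_right ?_ hn2
    nlinarith
  have hpoly := turan_density_poly_le ht0 ht3 he0 he1 (by positivity : 0 ≤ 2 * δ) het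
  have hlower := kernelC5_compl_lower_bound hU hU0 hU1 (e := e) (by rw [he', Fintype.card_fin])
  have hupper := kernelC5_adj_le G
  rw [Fintype.card_fin] at hlower hupper
  have hfinal : kernelCherry (nonAdj G) ^ 4 ≤ (ε * (n : ℝ) ^ 3) ^ 4 := by
    have hn4 : (1 : ℝ) ≤ (n : ℝ) ^ 4 := one_le_pow₀ hn1
    have h₁ : kernelC5 (fun x y => 1 - nonAdj G x y) ≤ (10 * lam k + 29 * δ) * (n : ℝ) ^ 5 := by
      have := mul_le_mul_of_nonneg_right hδn (by positivity : 0 ≤ (n : ℝ) ^ 4)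
      linear_combination hupper + 10 * hC5 + 9 * hn4 + 19 * this
    have h₂ := mul_le_mul_of_nonneg_left h₁ (by positivity : 0 ≤ (n : ℝ) ^ 7)
    have h₃ := mul_le_mul_of_nonneg_left hpoly (by positivity : 0 ≤ (n : ℝ) ^ 12)
    have h₄ : (ε * (n : ℝ) ^ 3) ^ 4 = 100 * δ * (n : ℝ) ^ 12 := by
      rw [hδdef]
      ring
    have h₅ : 0 ≤ δ * (n : ℝ) ^ 12 := by positivity
    rw [hlam] at h₂
    rw [h₄]
    linear_combination hlower + h₂ + h₃ + 31 * h₅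
  exact (coCherryCount_le_kernelCherry G).trans
    (le_of_pow_le_pow_left₀ (by norm_num) (by positivity) hfinal)
end

section
/- For all reals ε′ ∈ (0, 1/2) and γ > 0 there exists N such that the following holds for all n ≥ N. Let J be a simple graph on n vertices containing a vertex subset X with |X| = x such that: (i) ε′n ≤ x ≤ (1 − ε′)n and the edge density q := |E(J[X])| / (x choose 2) of the induced subgraph J[X] satisfies q ≤ 1/2; (ii) every vertex of X is adjacent in J to every vertex outside X; (iii) the number of copies of the path P₄ on 4 vertices in J[X] is at least (1/2)x⁴q³ + ε′x⁴. Then there exists a simple graph J′ on the same n vertices with | |E(J′)| − |E(J)| | ≤ γn² and with ν_{C₅}(J′) ≤ ν_{C₅}(J) − (1/2)(ε′)⁶ n^5. -/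
/-- The number of (unordered) copies of the path `P₄` on 4 vertices in `G`:
half the number of injective homomorphisms of the path into `G`. -/
noncomputable def p4Count {V : Type*} (G : SimpleGraph V) : ℕ :=
  Nat.card {v : Fin 4 → V // Function.Injective v ∧
    G.Adj (v 0) (v 1) ∧ G.Adj (v 1) (v 2) ∧ G.Adj (v 2) (v 3)} / 2

/-- The graph obtained from `J` by replacing the induced subgraph on `X` with `H`. -/
def replaceInduced {V : Type*} (J : SimpleGraph V) (X : Set V) (H : SimpleGraph X) :
    SimpleGraph V where
  Adj u v := (∃ (hu : u ∈ X) (hv : v ∈ X), H.Adj ⟨u, hu⟩ ⟨v, hv⟩) ∨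
    (J.Adj u v ∧ ¬(u ∈ X ∧ v ∈ X))
  symm := ⟨by
    rintro u v (⟨hu, hv, h⟩ | ⟨h, hn⟩)
    · exact Or.inl ⟨hv, hu, h.symm⟩
    · exact Or.inr ⟨h.symm, fun hh => hn hh.symm⟩⟩
  loopless := ⟨by
    rintro u (⟨hu, hv, h⟩ | ⟨h, hn⟩)
    · exact H.irrefl h
    · exact J.irrefl h⟩

lemma replaceInduced_induce {V : Type*} (J : SimpleGraph V) (X : Set V) :
    replaceInduced J X (J.induce X) = J := by
  ext u v
  simp only [replaceInduced, SimpleGraph.comap_adj, Function.Embedding.subtype_apply,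
    exists_prop]
  tauto

/-- The number of injective homomorphisms into `H` of the subgraph of the 5-cycle
induced on the positions in `S`. -/
noncomputable def patternCount {U : Type*} (S : Finset (Fin 5)) (H : SimpleGraph U) : ℕ :=
  Nat.card {f : {i // i ∈ S} → U // Function.Injective f ∧
    ∀ i j : {i // i ∈ S}, j.1 = i.1 + 1 → H.Adj (f i) (f j)}

/-- The number of ordered pairs of adjacent vertices. -/
noncomputable def dartCount {U : Type*} (H : SimpleGraph U) : ℕ :=
  Nat.card {p : U × U // H.Adj p.1 p.2}

lemma dartCount_eq_sum {U : Type*} [Fintype U] (H : SimpleGraph U) :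
    dartCount H = ∑ v, Nat.card (H.neighborSet v) := by
  classical
  rw [← Nat.card_sigma]
  exact Nat.card_congr
    { toFun := fun p => ⟨p.1.1, p.1.2, p.2⟩
      invFun := fun s => ⟨(s.1, s.2.1), s.2.2⟩
      left_inv := fun _ => rfl
      right_inv := fun _ => rfl }

lemma dartCount_eq {U : Type*} [Fintype U] (H : SimpleGraph U) :
    dartCount H = 2 * edgeCount H := by
  classical
  rw [dartCount_eq_sum, edgeCount, Nat.card_eq_fintype_card, ← SimpleGraph.edgeFinset_card,
    ← H.sum_degrees_eq_twice_card_edges]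
  refine Finset.sum_congr rfl fun v _ => ?_
  rw [Nat.card_eq_fintype_card, SimpleGraph.card_neighborSet_eq_degree]

lemma dartCount_replaceInduced {V : Type*} [Fintype V] (J : SimpleGraph V) (X : Set V)
    (H : SimpleGraph X) :
    dartCount (replaceInduced J X H) =
      dartCount H + Nat.card {p : V × V // J.Adj p.1 p.2 ∧ ¬(p.1 ∈ X ∧ p.2 ∈ X)} := by
  classical
  rw [dartCount, dartCount, ← Nat.card_sum]
  refine (Nat.card_congr (Equiv.ofBijective (Sum.elim
    (fun p => ⟨(p.1.1.1, p.1.2.1), Or.inl ⟨p.1.1.2, p.1.2.2, p.2⟩⟩)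
    (fun p => ⟨p.1, Or.inr p.2⟩)) ⟨?_, ?_⟩)).symm
  · rintro (⟨⟨⟨a, ha⟩, ⟨b, hb⟩⟩, hab⟩ | ⟨⟨a, b⟩, hab⟩)
      (⟨⟨⟨c, hc⟩, ⟨d, hd⟩⟩, hcd⟩ | ⟨⟨c, d⟩, hcd⟩) h <;>
      obtain ⟨rfl, rfl⟩ := Prod.mk.inj (congrArg Subtype.val h)
    · rfl
    · exact absurd ⟨ha, hb⟩ hcd.2
    · exact absurd ⟨hc, hd⟩ hab.2
    · rfl
  · rintro ⟨⟨a, b⟩, (⟨ha, hb, h⟩ | h)⟩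
    · exact ⟨Sum.inl ⟨(⟨a, ha⟩, ⟨b, hb⟩), h⟩, rfl⟩
    · exact ⟨Sum.inr ⟨(a, b), h⟩, rfl⟩

/-- Injective homomorphisms of the 5-cycle, sorted by the set of positions mapped into `X`. -/
lemma card_c5_replaceInduced {V : Type*} [Fintype V] (J : SimpleGraph V) (X : Set V)
    (hX : ∀ u ∈ X, ∀ v, v ∉ X → J.Adj u v) (H : SimpleGraph X) :
    Nat.card {v : Fin 5 → V // Function.Injective v ∧
      ∀ i : Fin 5, (replaceInduced J X H).Adj (v i) (v (i + 1))} =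
    ∑ S : Finset (Fin 5), patternCount S H * patternCount Sᶜ (J.induce Xᶜ) := by
  classical
  simp only [patternCount, ← Nat.card_prod]
  rw [← Nat.card_sigma]
  refine (Nat.card_congr (Equiv.ofBijective (fun s => ⟨fun i =>
    if h : i ∈ s.1 then (s.2.1.1 ⟨i, h⟩ : V)
      else (s.2.2.1 ⟨i, Finset.mem_compl.2 h⟩ : V), ?_⟩) ⟨?_, ?_⟩)).symm
  case refine_3 =>
    obtain ⟨S, ⟨f, hf, hf'⟩, ⟨g, hg, hg'⟩⟩ := s
    refine ⟨fun i j hij => ?_, fun i => ?_⟩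
    · by_cases hi : i ∈ S <;> by_cases hj : j ∈ S <;> simp only [hi, hj, dif_pos, dif_neg,
        not_false_eq_true] at hij
      · simpa using hf (Subtype.ext hij)
      · exact absurd (hij ▸ (f ⟨i, hi⟩).2) (g ⟨j, _⟩).2
      · exact absurd (hij ▸ (f ⟨j, hj⟩).2) (g ⟨i, _⟩).2
      · simpa using hg (Subtype.ext hij)
    · by_cases hi : i ∈ S <;> by_cases hj : i + 1 ∈ S <;> simp only [hi, hj, dif_pos, dif_neg,
        not_false_eq_true]
      · exact Or.inl ⟨(f ⟨i, hi⟩).2, (f ⟨i + 1, hj⟩).2, hf' ⟨i, hi⟩ ⟨i + 1, hj⟩ rfl⟩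
      · exact Or.inr ⟨hX _ (f ⟨i, hi⟩).2 _ (g ⟨i + 1, _⟩).2,
          fun hh => (g ⟨i + 1, _⟩).2 hh.2⟩
      · exact Or.inr ⟨(hX _ (f ⟨i + 1, hj⟩).2 _ (g ⟨i, _⟩).2).symm,
          fun hh => (g ⟨i, _⟩).2 hh.1⟩
      · exact Or.inr ⟨hg' ⟨i, Finset.mem_compl.2 hi⟩ ⟨i + 1, Finset.mem_compl.2 hj⟩ rfl,
          fun hh => (g ⟨i, _⟩).2 hh.1⟩
  · rintro ⟨S, ⟨f, hf, hf'⟩, ⟨g, hg, hg'⟩⟩ ⟨T, ⟨f₁, hf₁, hf₁'⟩, ⟨g₁, hg₁, hg₁'⟩⟩ h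
    have h1 := congrFun (congrArg Subtype.val h)
    simp only at h1
    obtain rfl : S = T := by
      ext i
      specialize h1 i
      by_cases hi : i ∈ S <;> by_cases hj : i ∈ T <;> simp only [hi, hj, dif_pos, dif_neg,
        not_false_eq_true] at h1 ⊢
      · exact absurd (h1 ▸ (f ⟨i, hi⟩).2) (g₁ ⟨i, _⟩).2
      · exact absurd (h1 ▸ (f₁ ⟨i, hj⟩).2) (g ⟨i, _⟩).2
    obtain rfl : f = f₁ := by
      ext ⟨i, hi⟩
      simpa [hi] using h1 i
    obtain rfl : g = g₁ := by
      ext ⟨i, hi⟩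
      simpa [Finset.mem_compl.1 hi] using h1 i
    rfl
  · rintro ⟨v, hv, hv'⟩
    have hmem : ∀ i, i ∈ (Finset.univ.filter fun i => v i ∈ X) ↔ v i ∈ X := by simp
    have hmem' : ∀ i, i ∈ (Finset.univ.filter fun i => v i ∈ X)ᶜ ↔ v i ∈ Xᶜ := by simp
    refine ⟨⟨Finset.univ.filter fun i => v i ∈ X,
      ⟨fun i => ⟨v i, (hmem i).1 i.2⟩, ?_, ?_⟩, ⟨fun i => ⟨v i, (hmem' i).1 i.2⟩, ?_, ?_⟩⟩, ?_⟩
    · intro i j hij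
      exact Subtype.ext (hv (congrArg Subtype.val hij))
    · rintro ⟨i, hi⟩ ⟨j, hj⟩ hij
      obtain rfl : j = i + 1 := hij
      rcases hv' i with ⟨_, _, h⟩ | h
      · exact h
      · exact absurd ⟨(hmem _).1 hi, (hmem _).1 hj⟩ h.2
    · intro i j hij
      exact Subtype.ext (hv (congrArg Subtype.val hij))
    · rintro ⟨i, hi⟩ ⟨j, hj⟩ hij
      obtain rfl : j = i + 1 := hij
      rcases hv' i with ⟨h, _⟩ | h
      · exact absurd h ((hmem' _).1 hi)
      · exact h.1
    · apply Subtype.ext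
      funext i
      simp only
      split_ifs <;> rfl

lemma patternCount_eq_of_no_edge {U : Type*} {S : Finset (Fin 5)}
    (hS : ∀ i ∈ S, i + 1 ∉ S) (H H' : SimpleGraph U) :
    patternCount S H = patternCount S H' := by
  have key : ∀ (G : SimpleGraph U) (f : {i // i ∈ S} → U),
      ∀ i j : {i // i ∈ S}, j.1 = i.1 + 1 → G.Adj (f i) (f j) :=
    fun _ _ i j hij => absurd (hij ▸ j.2) (hS i i.2)
  exact Nat.card_congr (Equiv.subtypeEquivRight fun f =>
    and_congr_right fun _ => iff_of_true (key H f) (key H' f))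

lemma exists_perm_pair {U : Type*} {a b a' b' : U} (h : a ≠ b) (h' : a' ≠ b') :
    ∃ σ : Equiv.Perm U, σ a = a' ∧ σ b = b' := by
  classical
  refine ⟨(Equiv.swap a a').trans (Equiv.swap (Equiv.swap a a' b) b'), ?_, ?_⟩
  · rw [Equiv.trans_apply, Equiv.swap_apply_left]
    refine Equiv.swap_apply_of_ne_of_ne (fun hh => h ?_) h'
    exact (Equiv.swap a a').injective (by rw [Equiv.swap_apply_left, ← hh])
  · simp

lemma patternCount_le_of_single_edge {U : Type*} [Fintype U] {S : Finset (Fin 5)} {i : Fin 5}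
    (hi : i ∈ S) (hi' : i + 1 ∈ S) (hS : ∀ j ∈ S, j + 1 ∈ S → j = i)
    {H H' : SimpleGraph U} (hle : dartCount H' ≤ dartCount H) :
    patternCount S H' ≤ patternCount S H := by
  classical
  obtain ⟨φ⟩ : Nonempty ({p : U × U // H'.Adj p.1 p.2} ↪ {p : U × U // H.Adj p.1 p.2}) := by
    apply Function.Embedding.nonempty_of_card_le
    simpa only [dartCount, Nat.card_eq_fintype_card] using hle
  choose σ hσ using fun p : {p : U × U // H'.Adj p.1 p.2} =>
    exists_perm_pair p.2.ne (φ p).2.ne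
  refine Nat.card_le_card_of_injective (fun f =>
    ⟨fun j => σ ⟨(f.1 ⟨i, hi⟩, f.1 ⟨i + 1, hi'⟩), f.2.2 _ _ rfl⟩ (f.1 j), ?_, ?_⟩) ?_
  · exact (Equiv.injective _).comp f.2.1
  · rintro ⟨j, hj⟩ ⟨k, hk⟩ hjk
    obtain rfl : k = j + 1 := hjk
    obtain rfl := hS j hj hk
    have := hσ ⟨(f.1 ⟨j, hi⟩, f.1 ⟨j + 1, hi'⟩), f.2.2 _ _ rfl⟩
    simp only at this ⊢
    rw [this.1, this.2]
    exact (φ _).2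
  · intro f g hfg
    have h := congrFun (congrArg Subtype.val hfg)
    have hf := hσ ⟨(f.1 ⟨i, hi⟩, f.1 ⟨i + 1, hi'⟩), f.2.2 _ _ rfl⟩
    have hg := hσ ⟨(g.1 ⟨i, hi⟩, g.1 ⟨i + 1, hi'⟩), g.2.2 _ _ rfl⟩
    have h0 := h ⟨i, hi⟩
    have h1 := h ⟨i + 1, hi'⟩
    simp only at h0 h1 hf hg
    rw [hf.1, hg.1] at h0
    rw [hf.2, hg.2] at h1
    have hp := φ.injective (Subtype.ext (Prod.ext h0 h1))
    apply Subtype.ext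
    funext j
    have hj := h j
    simp only at hj
    rw [hp] at hj
    exact (Equiv.injective _) hj

lemma patternCount_three {U : Type*} [Fintype U] (i : Fin 5) (H : SimpleGraph U) :
    patternCount {i, i + 1, i + 2} H =
      ∑ v, Nat.card (H.neighborSet v) * (Nat.card (H.neighborSet v) - 1) := by
  classical
  have hcard : ∀ v, Nat.card (H.neighborSet v) * (Nat.card (H.neighborSet v) - 1) =
      Nat.card {p : U × U // p ∈ (H.neighborFinset v).offDiag} := by
    intro v
    rw [Nat.card_eq_fintype_card (α := {p : U × U // p ∈ (H.neighborFinset v).offDiag}),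
      Fintype.card_coe, Finset.offDiag_card, Nat.card_eq_fintype_card,
      SimpleGraph.card_neighborSet_eq_degree, SimpleGraph.card_neighborFinset_eq_degree,
      Nat.mul_sub_one]
  simp only [hcard]
  rw [← Nat.card_sigma]
  have m0 : i ∈ ({i, i + 1, i + 2} : Finset (Fin 5)) := by simp
  have m1 : i + 1 ∈ ({i, i + 1, i + 2} : Finset (Fin 5)) := by simp
  have m2 : i + 2 ∈ ({i, i + 1, i + 2} : Finset (Fin 5)) := by simp
  have e2 : i + 2 = i + 1 + 1 := by revert i; decide
  have n02 : i ≠ i + 2 := by revert i; decide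
  refine Nat.card_congr (Equiv.ofBijective (fun f => ⟨f.1 ⟨i + 1, m1⟩,
    (f.1 ⟨i, m0⟩, f.1 ⟨i + 2, m2⟩), ?_⟩) ⟨?_, ?_⟩)
  · simp only [Finset.mem_offDiag, SimpleGraph.mem_neighborFinset]
    exact ⟨(f.2.2 ⟨i, m0⟩ ⟨i + 1, m1⟩ rfl).symm, f.2.2 ⟨i + 1, m1⟩ ⟨i + 2, m2⟩ e2,
      fun h => n02 (congrArg Subtype.val (f.2.1 h))⟩
  · intro f g h
    have h1 : f.1 ⟨i + 1, m1⟩ = g.1 ⟨i + 1, m1⟩ := congrArg Sigma.fst h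
    have h3 : (f.1 ⟨i, m0⟩, f.1 ⟨i + 2, m2⟩) = (g.1 ⟨i, m0⟩, g.1 ⟨i + 2, m2⟩) :=
      congrArg (fun s : Σ v : U, {p : U × U // p ∈ (H.neighborFinset v).offDiag} => s.2.1) h
    simp only [Prod.mk.injEq] at h3
    apply Subtype.ext
    funext ⟨j, hj⟩
    have : j = i ∨ j = i + 1 ∨ j = i + 2 := by simpa using hj
    rcases this with rfl | rfl | rfl
    · exact h3.1
    · exact h1
    · exact h3.2
  · rintro ⟨b, ⟨⟨a, c⟩, h⟩⟩
    have h' := h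
    simp only [Finset.mem_offDiag, SimpleGraph.mem_neighborFinset] at h'
    obtain ⟨hba, hbc, hac⟩ := h'
    have n01 : i + 1 ≠ i := by revert i; decide
    have n12 : i + 2 ≠ i + 1 := by revert i; decide
    have n22 : i + 2 + 1 ≠ i := by revert i; decide
    have n23 : i + 2 + 1 ≠ i + 1 := by revert i; decide
    refine ⟨⟨fun j => if j.1 = i then a else if j.1 = i + 1 then b else c, ?_, ?_⟩, ?_⟩
    · rintro ⟨j, hj⟩ ⟨k, hk⟩ hjk
      simp only [Finset.mem_insert, Finset.mem_singleton] at hj hk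
      rcases hj with rfl | rfl | rfl <;> rcases hk with rfl | rfl | rfl <;>
        simp_all [hba.ne, hbc.ne, hba.ne', hbc.ne']
    · rintro ⟨j, hj⟩ ⟨k, hk⟩ hjk
      obtain rfl : k = j + 1 := hjk
      simp only [Finset.mem_insert, Finset.mem_singleton] at hj
      rcases hj with rfl | rfl | rfl
      · simpa using hba.symm
      · simpa [← e2, n02.symm] using hbc
      · simp [n22, n23] at hk
    · exact Sigma.subtype_ext (by simp) (by simp [n02.symm])

lemma patternCount_four {U : Type*} (i : Fin 5) (H : SimpleGraph U) :
    patternCount {i, i + 1, i + 2, i + 3} H =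
      Nat.card {v : Fin 4 → U // Function.Injective v ∧
        H.Adj (v 0) (v 1) ∧ H.Adj (v 1) (v 2) ∧ H.Adj (v 2) (v 3)} := by
  classical
  let φ : Fin 4 → {j // j ∈ ({i, i + 1, i + 2, i + 3} : Finset (Fin 5))} :=
    fun k => ⟨i + k.castSucc, by revert i k; decide⟩
  have hφ : Function.Bijective φ := by
    constructor
    · intro k l hkl
      have : i + k.castSucc = i + l.castSucc := congrArg Subtype.val hkl
      exact Fin.castSucc_injective _ (add_left_cancel this)
    · rintro ⟨j, hj⟩
      have : ∃ k : Fin 4, i + k.castSucc = j := by revert i j; decide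
      obtain ⟨k, hk⟩ := this
      exact ⟨k, Subtype.ext hk⟩
  let e := Equiv.ofBijective φ hφ
  refine Nat.card_congr (Equiv.subtypeEquiv (Equiv.arrowCongr e.symm (Equiv.refl U)) ?_)
  intro f
  have hval : ∀ k, (Equiv.arrowCongr e.symm (Equiv.refl U)) f k = f (φ k) := fun _ => rfl
  have hinj : Function.Injective ((Equiv.arrowCongr e.symm (Equiv.refl U)) f) ↔
      Function.Injective f := Function.Injective.of_comp_iff' f hφ
  rw [hinj]
  simp only [hval]
  refine and_congr_right fun _ => ⟨fun h => ⟨h _ _ ?_, h _ _ ?_, h _ _ ?_⟩, fun h a b hab => ?_⟩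
  · exact (by decide : ∀ i : Fin 5, i + Fin.castSucc (1 : Fin 4) =
      i + Fin.castSucc (0 : Fin 4) + 1) i
  · exact (by decide : ∀ i : Fin 5, i + Fin.castSucc (2 : Fin 4) =
      i + Fin.castSucc (1 : Fin 4) + 1) i
  · exact (by decide : ∀ i : Fin 5, i + Fin.castSucc (3 : Fin 4) =
      i + Fin.castSucc (2 : Fin 4) + 1) i
  · obtain ⟨k, rfl⟩ := hφ.2 a
    obtain ⟨l, rfl⟩ := hφ.2 b
    have : ∀ (i : Fin 5) (k l : Fin 4), i + l.castSucc = i + k.castSucc + 1 →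
      (k = 0 ∧ l = 1) ∨ (k = 1 ∧ l = 2) ∨ (k = 2 ∧ l = 3) := by decide
    rcases this i k l hab with ⟨rfl, rfl⟩ | ⟨rfl, rfl⟩ | ⟨rfl, rfl⟩
    · exact h.1
    · exact h.2.1
    · exact h.2.2

lemma patternCount_singleton {U : Type*} (i : Fin 5) (H : SimpleGraph U) :
    patternCount {i} H = Nat.card U := by
  refine Nat.card_congr (Equiv.ofBijective (fun f => f.1 ⟨i, by simp⟩) ⟨?_, ?_⟩)
  · intro f g h
    apply Subtype.ext
    funext ⟨j, hj⟩
    obtain rfl := Finset.mem_singleton.1 hj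
    exact h
  · intro u
    refine ⟨⟨fun _ => u, fun a b _ => Subsingleton.elim a b, ?_⟩, rfl⟩
    rintro ⟨j, hj⟩ ⟨k, hk⟩ h
    have h1 := Finset.mem_singleton.1 hj
    have h2 := Finset.mem_singleton.1 hk
    subst h1 h2
    simp at h

lemma patternCount_univ_of_bipartite {U : Type*} {H : SimpleGraph U} (c : U → Bool)
    (hc : ∀ u v, H.Adj u v → c u ≠ c v) : patternCount Finset.univ H = 0 := by
  rw [patternCount, Nat.card_eq_zero]
  left
  refine ⟨fun f => ?_⟩
  have h : ∀ i j : Fin 5, j = i + 1 → c (f.1 ⟨i, by simp⟩) ≠ c (f.1 ⟨j, by simp⟩) :=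
    fun i j hij => hc _ _ (f.2.2 _ _ hij)
  have h0 := h 0 1 rfl
  have h1 := h 1 2 rfl
  have h2 := h 2 3 rfl
  have h3 := h 3 4 rfl
  have h4 := h 4 0 rfl
  revert h0 h1 h2 h3 h4
  generalize c (f.1 ⟨0, _⟩) = a
  generalize c (f.1 ⟨1, _⟩) = b
  generalize c (f.1 ⟨2, _⟩) = x
  generalize c (f.1 ⟨3, _⟩) = y
  generalize c (f.1 ⟨4, _⟩) = z
  cases a <;> cases b <;> cases x <;> cases y <;> cases z <;> simp

lemma card_p4_le {U : Type*} [Fintype U] {H : SimpleGraph U} {d : ℕ}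
    (hd : ∀ v, Nat.card (H.neighborSet v) ≤ d) :
    Nat.card {v : Fin 4 → U // Function.Injective v ∧
        H.Adj (v 0) (v 1) ∧ H.Adj (v 1) (v 2) ∧ H.Adj (v 2) (v 3)} ≤
      Fintype.card U * d ^ 3 := by
  classical
  have hle : ∀ (a : U) (F : H.neighborSet a → ℕ) (M : ℕ), (∀ b, F b ≤ M) →
      ∑ b, F b ≤ d * M := by
    intro a F M hF
    calc ∑ b, F b ≤ ∑ _b : H.neighborSet a, M := Finset.sum_le_sum fun b _ => hF b
      _ = Nat.card (H.neighborSet a) * M := by simp [Nat.card_eq_fintype_card]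
      _ ≤ d * M := Nat.mul_le_mul_right _ (hd a)
  calc _ ≤ Nat.card (Σ a : U, Σ b : H.neighborSet a, Σ c : H.neighborSet b.1,
        H.neighborSet c.1) := by
        refine Nat.card_le_card_of_injective (fun v => ⟨v.1 0, ⟨v.1 1, v.2.2.1⟩,
          ⟨v.1 2, v.2.2.2.1⟩, ⟨v.1 3, v.2.2.2.2⟩⟩) ?_
        intro v w h
        apply Subtype.ext
        funext k
        fin_cases k
        · exact congrArg (fun s : Σ a : U, Σ b : H.neighborSet a, Σ c : H.neighborSet b.1,
            H.neighborSet c.1 => s.1) h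
        · exact congrArg (fun s : Σ a : U, Σ b : H.neighborSet a, Σ c : H.neighborSet b.1,
            H.neighborSet c.1 => s.2.1.1) h
        · exact congrArg (fun s : Σ a : U, Σ b : H.neighborSet a, Σ c : H.neighborSet b.1,
            H.neighborSet c.1 => s.2.2.1.1) h
        · exact congrArg (fun s : Σ a : U, Σ b : H.neighborSet a, Σ c : H.neighborSet b.1,
            H.neighborSet c.1 => s.2.2.2.1) h
    _ = ∑ a : U, ∑ b : H.neighborSet a, ∑ c : H.neighborSet b.1,
        Nat.card (H.neighborSet c.1) := by simp only [Nat.card_sigma]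
    _ ≤ ∑ _a : U, d * (d * d) := Finset.sum_le_sum fun a _ => hle _ _ _ fun b =>
        hle _ _ _ fun c => hd _
    _ = Fintype.card U * d ^ 3 := by
        simp only [Finset.sum_const, Finset.card_univ, smul_eq_mul]; ring

lemma sum_descFactorial_two_le {U : Type*} [Fintype U] {f g : U → ℕ} {d : ℕ}
    (hg : ∀ v, g v ≤ d) (hf : Fintype.card U * d ≤ ∑ v, f v) :
    ∑ v, g v * (g v - 1) ≤ ∑ v, f v * (f v - 1) := by
  have cast : ∀ t : ℕ, ((t * (t - 1) : ℕ) : ℤ) = t * (t - 1) := by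
    intro t
    cases t <;> simp
  have hd : ∑ v, g v * (g v - 1) ≤ Fintype.card U * (d * (d - 1)) := by
    calc _ ≤ ∑ _v : U, d * (d - 1) := Finset.sum_le_sum fun v _ =>
          Nat.mul_le_mul (hg v) (Nat.sub_le_sub_right (hg v) 1)
      _ = _ := by simp
  refine hd.trans ?_
  zify at hf ⊢
  have h1 : ∀ v ∈ Finset.univ, ((d : ℤ) * (d - 1) + 2 * d * (f v - d)) ≤
      ((f v * (f v - 1) : ℕ) : ℤ) := by
    intro v _
    rw [cast]
    have : 0 ≤ ((f v : ℤ) - d) * ((f v - d) - 1) := by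
      rcases le_or_gt ((f v : ℤ) - d) 0 with h | h
      · exact mul_nonneg_of_nonpos_of_nonpos h (by linarith)
      · exact mul_nonneg h.le (by linarith [Int.add_one_le_iff.2 h])
    nlinarith
  have h2 := Finset.sum_le_sum h1
  rw [Finset.sum_add_distrib, ← Finset.mul_sum Finset.univ _ (2 * (d : ℤ)),
    Finset.sum_sub_distrib] at h2
  simp only [Finset.sum_const, Finset.card_univ, nsmul_eq_mul] at h2
  have h3 := cast d
  push_cast at h2 h3 ⊢
  have : 0 ≤ 2 * (d : ℤ) * (∑ v, (f v : ℤ) - Fintype.card U * d) :=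
    mul_nonneg (by positivity) (by linarith)
  rw [h3]
  linarith

lemma exists_bipartite_near_regular (U : Type*) [Fintype U] {d : ℕ}
    (hd : 2 * d ≤ Fintype.card U) :
    ∃ H : SimpleGraph U, (∀ v, Nat.card (H.neighborSet v) ≤ d) ∧
      (∃ c : U → Bool, ∀ u v, H.Adj u v → c u ≠ c v) ∧
      (Fintype.card U - 1) * d ≤ dartCount H := by
  classical
  rcases Nat.eq_zero_or_pos d with rfl | hd0
  · refine ⟨⊥, fun v => ?_, ⟨fun _ => true, fun u v h => h.elim⟩, by simp⟩
    simp [SimpleGraph.neighborSet]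
  obtain ⟨m, r, hm, hr⟩ : ∃ m r, Fintype.card U = 2 * m + r ∧ r ≤ 1 :=
    ⟨Fintype.card U / 2, Fintype.card U % 2, by omega, by omega⟩
  have hdm : d ≤ m := by omega
  have : NeZero m := ⟨by omega⟩
  let e : U ≃ (Bool × Fin m) ⊕ Fin r := Fintype.equivOfCardEq (by simp [hm])
  let H : SimpleGraph U :=
    { Adj := fun u v => ∃ a b : Bool × Fin m, e u = Sum.inl a ∧ e v = Sum.inl b ∧
        a.1 ≠ b.1 ∧ (a.2 + b.2).val < d
      symm := ⟨by
        rintro u v ⟨a, b, h1, h2, h3, h4⟩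
        exact ⟨b, a, h2, h1, h3.symm, by rwa [add_comm]⟩⟩
      loopless := ⟨by
        rintro u ⟨a, b, h1, h2, h3, h4⟩
        exact h3 (congrArg Prod.fst (Sum.inl_injective (h1.symm.trans h2)))⟩ }
  have hcol : ∃ c : U → Bool, ∀ u v, H.Adj u v → c u ≠ c v := by
    refine ⟨fun u => Sum.elim Prod.fst (fun _ => true) (e u), ?_⟩
    rintro u v ⟨a, b, h1, h2, h3, -⟩
    simpa [h1, h2] using h3
  have hfin : Nat.card {k : Fin m // k.val < d} = d := by
    rw [Nat.card_eq_fintype_card, Fintype.card_subtype, Fin.card_filter_val_lt]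
    omega
  have hdeg : ∀ a, Nat.card (H.neighborSet (e.symm (Sum.inl a))) = d := by
    intro a
    refine Eq.trans (Nat.card_congr (Equiv.ofBijective (fun k : {k : Fin m // k.val < d} =>
      ⟨e.symm (Sum.inl (!a.1, k.1 - a.2)), a, (!a.1, k.1 - a.2), by simp, by simp, by simp,
        by simpa using k.2⟩) ⟨?_, ?_⟩)).symm hfin
    · intro k l h
      simpa [Subtype.ext_iff] using h
    · rintro ⟨v, ⟨a', b, h1, h2, h3, h4⟩⟩
      have h1' : a = a' := by simpa using h1
      subst h1'
      refine ⟨⟨a.2 + b.2, h4⟩, ?_⟩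
      apply Subtype.ext
      simp only [add_sub_cancel_left]
      rw [Equiv.symm_apply_eq, h2]
      congr 1
      refine Prod.ext ?_ rfl
      revert h3
      cases a.1 <;> cases b.1 <;> simp
  have hdeg' : ∀ k, Nat.card (H.neighborSet (e.symm (Sum.inr k))) = 0 := by
    intro k
    rw [Nat.card_eq_zero]
    left
    refine ⟨?_⟩
    rintro ⟨v, ⟨a, b, h1, -⟩⟩
    simp at h1
  refine ⟨H, fun v => ?_, hcol, ?_⟩
  · obtain ⟨w, rfl⟩ := e.symm.surjective v
    rcases w with a | k
    · exact (hdeg a).le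
    · exact (hdeg' k).le.trans (Nat.zero_le _)
  · rw [dartCount_eq_sum, ← Equiv.sum_comp e.symm, Fintype.sum_sum_type]
    simp only [hdeg, hdeg', Finset.sum_const, Finset.card_univ, smul_eq_mul]
    simp only [Fintype.card_prod, Fintype.card_bool, Fintype.card_fin, mul_zero, add_zero]
    exact Nat.mul_le_mul_right _ (by omega)

lemma cycle_position_cases : ∀ S : Finset (Fin 5), S = Finset.univ ∨
    (∃ i, S = {i, i + 1, i + 2, i + 3}) ∨ (∃ i, S = {i, i + 1, i + 2}) ∨
    (∃ i, i ∈ S ∧ i + 1 ∈ S ∧ ∀ j ∈ S, j + 1 ∈ S → j = i) ∨ ∀ i ∈ S, i + 1 ∉ S := by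
  decide

/-- Replacing `J[X]` by a bipartite graph `H` of maximum degree at most `d`, where `d` is at most
the average degree of `J[X]`, decreases the number of 5-cycles at least by the change in those
5-cycles that have exactly one vertex outside `X`. -/
lemma card_c5_replaceInduced_le {V : Type*} [Fintype V] (J : SimpleGraph V) (X : Set V)
    [Fintype X] (hX : ∀ u ∈ X, ∀ v, v ∉ X → J.Adj u v) (H : SimpleGraph X) {d : ℕ}
    (hdeg : ∀ v, Nat.card (H.neighborSet v) ≤ d)
    (hcol : ∃ c : X → Bool, ∀ u v, H.Adj u v → c u ≠ c v)
    (hd : Fintype.card X * d ≤ dartCount (J.induce X)) :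
    Nat.card {v : Fin 5 → V // Function.Injective v ∧
      ∀ i : Fin 5, (replaceInduced J X H).Adj (v i) (v (i + 1))} +
      5 * (Nat.card (Xᶜ : Set V) * Nat.card {v : Fin 4 → X // Function.Injective v ∧
        (J.induce X).Adj (v 0) (v 1) ∧ (J.induce X).Adj (v 1) (v 2) ∧
        (J.induce X).Adj (v 2) (v 3)}) ≤
    Nat.card {v : Fin 5 → V // Function.Injective v ∧ ∀ i : Fin 5, J.Adj (v i) (v (i + 1))} +
      5 * (Nat.card (Xᶜ : Set V) * (Fintype.card X * d ^ 3)) := by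
  classical
  have hdart : dartCount H ≤ dartCount (J.induce X) := by
    refine le_trans ?_ hd
    rw [dartCount_eq_sum]
    exact (Finset.sum_le_sum fun v _ => hdeg v).trans (by simp)
  have hJ := card_c5_replaceInduced J X hX (J.induce X)
  rw [replaceInduced_induce] at hJ
  rw [hJ, card_c5_replaceInduced J X hX H]
  have hfive : ∀ a : ℕ, 5 * a = ∑ S : Finset (Fin 5), if S.card = 4 then a else 0 := by
    intro a
    rw [← Finset.sum_filter, Finset.sum_const, smul_eq_mul]
    congr 1
  rw [hfive, hfive, ← Finset.sum_add_distrib, ← Finset.sum_add_distrib]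
  refine Finset.sum_le_sum fun S _ => ?_
  have hp4 := card_p4_le hdeg
  rcases cycle_position_cases S with rfl | ⟨i, rfl⟩ | ⟨i, rfl⟩ | ⟨i, h0, h1, h2⟩ | h
  · obtain ⟨c, hc⟩ := hcol
    rw [patternCount_univ_of_bipartite c hc]
    simp
  · have h4 : ({i, i + 1, i + 2, i + 3} : Finset (Fin 5)).card = 4 := by revert i; decide
    have hc : ({i, i + 1, i + 2, i + 3} : Finset (Fin 5))ᶜ = {i + 4} := by revert i; decide
    rw [if_pos h4, if_pos h4, hc, patternCount_singleton, patternCount_four, patternCount_four]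
    rw [mul_comm _ (Nat.card _), add_comm, mul_comm _ (Nat.card (Xᶜ : Set V))]
    gcongr
  · have h4 : ({i, i + 1, i + 2} : Finset (Fin 5)).card ≠ 4 := by revert i; decide
    rw [if_neg h4, if_neg h4, patternCount_three, patternCount_three]
    gcongr ?_ * _ + _
    exact sum_descFactorial_two_le hdeg (by rwa [← dartCount_eq_sum])
  · have h4 : S.card ≠ 4 := by
      revert S i; decide
    rw [if_neg h4, if_neg h4]
    gcongr ?_ * _ + _
    exact patternCount_le_of_single_edge h0 h1 h2 hdart
  · have h4 : S.card ≠ 4 := by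
      revert S; decide
    rw [if_neg h4, if_neg h4, patternCount_eq_of_no_edge h H (J.induce X)]

/-- For all `ε′ ∈ (0, 1/2)` and `γ > 0` and all large `n`: if a graph `J` on `n` vertices
has a vertex subset `X` of size `x` with `ε′n ≤ x ≤ (1−ε′)n`, of edge density
`q = |E(J[X])| / (x choose 2) ≤ 1/2`, complete to the outside, and containing at least
`(1/2)x⁴q³ + ε′x⁴` copies of `P₄`, then there is a graph `J′` on the same vertices with
almost the same number of edges and `ν_{C₅}(J′) ≤ ν_{C₅}(J) − (1/2)(ε′)⁶ n⁵`. -/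
theorem reduce_c5 (ε' γ : ℝ) (hε'0 : 0 < ε') (hε'1 : ε' < 1/2) (hγ : 0 < γ) :
    ∃ N : ℕ, ∀ n : ℕ, N ≤ n → ∀ J : SimpleGraph (Fin n), ∀ X : Finset (Fin n), ∀ q : ℝ,
      q = (edgeCount (SimpleGraph.induce (X : Set (Fin n)) J) : ℝ) / (X.card.choose 2 : ℝ) →
      ε' * (n:ℝ) ≤ (X.card : ℝ) → (X.card : ℝ) ≤ (1 - ε') * (n:ℝ) →
      q ≤ 1/2 →
      (∀ u ∈ X, ∀ v, v ∉ X → J.Adj u v) →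
      (1/2) * (X.card : ℝ)^4 * q^3 + ε' * (X.card : ℝ)^4 ≤
        (p4Count (SimpleGraph.induce (X : Set (Fin n)) J) : ℝ) →
      ∃ J' : SimpleGraph (Fin n),
        |(edgeCount J' : ℝ) - (edgeCount J : ℝ)| ≤ γ * (n:ℝ)^2 ∧
        (c5Count J' : ℝ) ≤ (c5Count J : ℝ) - (1/2) * ε'^6 * (n:ℝ)^5 := by
  obtain ⟨N, hN⟩ := exists_nat_ge (2 / ε' + 1 / γ + 2 / ε' ^ 6 + 1)
  refine ⟨N, fun n hn J X q hq hx1 hx2 hq2 hX hp4 => ?_⟩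
  have hnN : 2 / ε' + 1 / γ + 2 / ε' ^ 6 + 1 ≤ (n : ℝ) := hN.trans (by exact_mod_cast hn)
  have a1 : 0 < 2 / ε' := by positivity
  have a2 : 0 < 1 / γ := by positivity
  have a3 : 0 < 2 / ε' ^ 6 := by positivity
  have hn1 : (1 : ℝ) ≤ n := by linarith
  have hnε : 2 ≤ ε' * (n : ℝ) := by
    have : 2 / ε' ≤ (n : ℝ) := by linarith
    rwa [div_le_iff₀' hε'0] at this
  have hnγ : 1 ≤ γ * (n : ℝ) := by
    have : 1 / γ ≤ (n : ℝ) := by linarith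
    rwa [div_le_iff₀' hγ] at this
  have hnε6 : 2 ≤ ε' ^ 6 * (n : ℝ) := by
    have : 2 / ε' ^ 6 ≤ (n : ℝ) := by linarith
    rwa [div_le_iff₀' (by positivity)] at this
  have hcardX : Fintype.card ((X : Set (Fin n)) : Type) = X.card := by simp
  have hcardY : Nat.card (((X : Set (Fin n))ᶜ : Set (Fin n)) : Type) = n - X.card := by
    rw [← Finset.coe_compl, Nat.card_coe_set_eq, Set.ncard_coe_finset, Finset.card_compl,
      Fintype.card_fin]
  have hxn : X.card ≤ n := by simpa using X.card_le_univ
  set H := SimpleGraph.induce (X : Set (Fin n)) J with hH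
  set x := X.card with hx
  set m := edgeCount H with hm
  have hxr : (2 : ℝ) ≤ x := hnε.trans hx1
  have hx0 : 0 < x := by
    have : (0 : ℝ) < x := by linarith
    exact_mod_cast this
  obtain ⟨d, hd⟩ : ∃ d, d = 2 * m / x := ⟨_, rfl⟩
  have hd1 : x * d ≤ 2 * m := by rw [hd]; exact Nat.mul_div_le _ _
  have hd2 : 2 * m < x * (d + 1) := by
    rw [hd]; exact Nat.lt_mul_div_succ _ hx0
  have hqm : q * (x * (x - 1)) = 2 * m := by
    rw [hq, Nat.cast_choose_two]
    have : (x : ℝ) - 1 ≠ 0 := by linarith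
    field_simp
  have hd1r : (x : ℝ) * d ≤ 2 * m := by exact_mod_cast hd1
  have hdq : (d : ℝ) ≤ q * (x - 1) := by
    refine le_of_mul_le_mul_left (a := (x : ℝ)) ?_ (by linarith)
    linarith
  have hq0 : 0 ≤ q := by rw [hq]; positivity
  have hdqx : (d : ℝ) ≤ q * x := by linarith
  have h2d : 2 * d ≤ x := by
    have : (2 : ℝ) * d ≤ x := by nlinarith
    exact_mod_cast this
  have hdart := dartCount_eq H
  obtain ⟨H', hdeg, hcol, hdart'⟩ :=
    exists_bipartite_near_regular ((X : Set (Fin n)) : Type) (d := d) (by rwa [hcardX])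
  have hXset : ∀ u ∈ (X : Set (Fin n)), ∀ v, v ∉ (X : Set (Fin n)) → J.Adj u v :=
    fun u hu v hv => hX u (by simpa using hu) v (by simpa using hv)
  have key := card_c5_replaceInduced_le J X hXset H' hdeg hcol
    (by rw [hcardX, ← hH, hdart]; exact hd1)
  have hdartle : dartCount H' ≤ x * d := by
    rw [dartCount_eq_sum]
    exact (Finset.sum_le_sum fun v _ => hdeg v).trans (by simp [hx])
  have hedge := dartCount_replaceInduced J X H'
  have hedge0 := dartCount_replaceInduced J X H
  rw [hH, replaceInduced_induce, ← hH] at hedge0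
  rw [dartCount_eq] at hedge hedge0
  rw [hcardX] at hdart' key
  rw [hcardY] at key
  refine ⟨replaceInduced J X H', ?_, ?_⟩
  · have hle : edgeCount (replaceInduced J X H') ≤ edgeCount J := by omega
    have hge : edgeCount J ≤ edgeCount (replaceInduced J X H') + x := by
      have : (x - 1) * d + d = x * d := by
        obtain ⟨y, hy⟩ := Nat.exists_eq_add_of_lt hx0
        rw [hy]; simp; ring
      rw [Nat.mul_succ] at hd2
      omega
    have hle' : (edgeCount (replaceInduced J X H') : ℝ) ≤ edgeCount J := by exact_mod_cast hle
    have hge' : (edgeCount J : ℝ) ≤ edgeCount (replaceInduced J X H') + x := by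
      exact_mod_cast hge
    have hxn' : (x : ℝ) ≤ n := by exact_mod_cast hxn
    rw [abs_sub_comm, abs_of_nonneg (by linarith)]
    nlinarith
  · rw [c5Count, c5Count]
    rw [p4Count] at hp4
    set T' := Nat.card {v : Fin 5 → Fin n // Function.Injective v ∧
      ∀ i : Fin 5, (replaceInduced J X H').Adj (v i) (v (i + 1))}
    set T := Nat.card {v : Fin 5 → Fin n // Function.Injective v ∧
      ∀ i : Fin 5, J.Adj (v i) (v (i + 1))}
    set P := Nat.card {v : Fin 4 → (X : Set (Fin n)) // Function.Injective v ∧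
      H.Adj (v 0) (v 1) ∧ H.Adj (v 1) (v 2) ∧ H.Adj (v 2) (v 3)}
    have hP : (((P / 2 : ℕ) : ℝ)) ≤ P / 2 := Nat.cast_div_le
    have hT' : (((T' / 10 : ℕ) : ℝ)) ≤ T' / 10 := Nat.cast_div_le
    have hT : (T : ℝ) / 10 - 1 ≤ ((T / 10 : ℕ) : ℝ) := by
      have : T ≤ 10 * (T / 10) + 10 := by omega
      have : (T : ℝ) ≤ 10 * ((T / 10 : ℕ) : ℝ) + 10 := by exact_mod_cast this
      linarith
    have keyr : (T' : ℝ) + 5 * ((n - x) * P) ≤ T + 5 * ((n - x) * (x * d ^ 3)) := by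
      have : ((n - x : ℕ) : ℝ) = n - x := Nat.cast_sub hxn
      rw [← this]
      exact_mod_cast key
    have hd3 : (x : ℝ) * d ^ 3 ≤ x ^ 4 * q ^ 3 := by
      calc (x : ℝ) * d ^ 3 ≤ x * (q * x) ^ 3 := by gcongr
        _ = x ^ 4 * q ^ 3 := by ring
    have hgap : 2 * ε' * (x : ℝ) ^ 4 ≤ P - x * d ^ 3 := by linarith
    have hx4 : (ε' * (n : ℝ)) ^ 4 ≤ (x : ℝ) ^ 4 := by gcongr
    have hgain : (ε' * n) * (2 * ε' * (ε' * (n : ℝ)) ^ 4) ≤ (n - x) * (P - x * d ^ 3) := by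
      refine mul_le_mul (by linarith) (le_trans (by gcongr) hgap) (by positivity) (by linarith)
    have hn5 : (2 : ℝ) ≤ ε' ^ 6 * (n : ℝ) ^ 5 := by
      calc (2 : ℝ) ≤ ε' ^ 6 * n := hnε6
        _ ≤ ε' ^ 6 * (n : ℝ) ^ 5 := by
          gcongr
          exact le_self_pow₀ hn1 (by norm_num)
    have hexp : (ε' * n) * (2 * ε' * (ε' * (n : ℝ)) ^ 4) = 2 * (ε' ^ 6 * (n : ℝ) ^ 5) := by ring
    linarith
end

section
/- Let k ≥ 2 be an integer and let x, y ≥ 0 and 0 < ρ < 1/2 be reals with (k−1)x + y = 1. Define g = (k−1)(k−2)x² + 2(k−1)xy + ρy², and define f = [ (k−1)₅/10 + (k−1)₄/2 + (k−1)₃/2 ]·x⁵ + [ (k−1)₄/2 + 3(k−1)₃/2 + (k−1)₂/2 ]·x⁴y + [ (1/2 + ρ/2)(k−1)₃ + (1 + ρ/2)(k−1)₂ ]·x³y² + [ (ρ/2 + ρ²/2)(k−1)₂ + (ρ/2)(k−1) ]·x²y³ + (ρ³/2)(k−1)·xy⁴, where (m)_ℓ = m(m−1)···(m−ℓ+1)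 denotes the falling factorial. Then for every ε > 0 there exists N such that for every n ≥ N there exists a simple graph G on n vertices with | |E(G)| − g·n(n−1)/2 | ≤ εn² and with at most (f + ε)·n^5 copies of the 5-cycle C₅. -/
open Matrix Finset

section Counting

variable {V : Type*} [Fintype V]

theorem two_mul_edgeCount_eq_sum (G : SimpleGraph V) [DecidableRel G.Adj] :
    2 * (edgeCount G : ℝ) = ∑ u, ∑ v, G.adjMatrix ℝ u v := by
  have h := G.sum_degrees_eq_twice_card_edges
  rw [edgeCount, Nat.card_eq_fintype_card, ← SimpleGraph.edgeFinset_card]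
  have h' : ((∑ v, G.degree v : ℕ) : ℝ) = 2 * (#G.edgeFinset : ℝ) := by rw [h]; push_cast; rfl
  rw [← h']
  push_cast
  refine sum_congr rfl fun u _ => ?_
  simp [SimpleGraph.adjMatrix_apply, ← SimpleGraph.card_neighborFinset_eq_degree,
    SimpleGraph.neighborFinset_eq_filter]

variable [DecidableEq V]

/-- The number of closed walks of length five, as a sum over cyclic sequences of vertices. -/
theorem Matrix.trace_pow_five (A : Matrix V V ℝ) :
    (A ^ 5).trace = ∑ v : Fin 5 → V, ∏ i, A (v i) (v (i + 1)) := by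
  let e : V × V × V × V × V ≃ (Fin 5 → V) :=
    { toFun := fun p => ![p.1, p.2.1, p.2.2.1, p.2.2.2.1, p.2.2.2.2]
      invFun := fun v => (v 0, v 1, v 2, v 3, v 4)
      left_inv := fun p => rfl
      right_inv := fun v => by ext i; fin_cases i <;> rfl }
  have h : A ^ 5 = A * (A * (A * (A * A))) := by noncomm_ring
  rw [← e.sum_comp, h]
  simp only [trace, diag_apply, mul_apply, Fintype.sum_prod_type, mul_sum]
  refine sum_congr rfl fun a _ => sum_congr rfl fun b _ => sum_congr rfl fun c _ =>
    sum_congr rfl fun d _ => sum_congr rfl fun f _ => ?_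
  rw [Fin.prod_univ_five]
  change _ = A a b * A b c * A c d * A d f * A f a
  ring

theorem ten_mul_c5Count_le_trace (G : SimpleGraph V) [DecidableRel G.Adj] :
    10 * (c5Count G : ℝ) ≤ (G.adjMatrix ℝ ^ 5).trace := by
  classical
  have hdiv : 10 * c5Count G ≤ Nat.card {v : Fin 5 → V //
      Function.Injective v ∧ ∀ i : Fin 5, G.Adj (v i) (v (i + 1))} := Nat.mul_div_le _ _
  have hcast : 10 * (c5Count G : ℝ) ≤ (Nat.card {v : Fin 5 → V //
      Function.Injective v ∧ ∀ i : Fin 5, G.Adj (v i) (v (i + 1))} : ℝ) := mod_cast hdiv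
  refine hcast.trans ?_
  rw [trace_pow_five, Nat.card_eq_fintype_card, Fintype.card_subtype, card_filter]
  push_cast
  refine sum_le_sum fun v _ => ?_
  split_ifs with hv
  · exact (Finset.prod_eq_one fun i _ => by simp [hv.2 i]).ge
  · exact prod_nonneg fun i _ => by rw [SimpleGraph.adjMatrix_apply]; split_ifs <;> norm_num

/-- A `0/1` symmetric matrix, padded by isolated vertices, gives a graph on `Fin n`. -/
theorem Matrix.IsAdjMatrix.exists_graph_fin {A : Matrix V V ℝ} (hA : A.IsAdjMatrix) {n : ℕ}
    (hn : Fintype.card V ≤ n) :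
    ∃ G : SimpleGraph (Fin n), 2 * (edgeCount G : ℝ) = ∑ u, ∑ v, A u v ∧
      10 * (c5Count G : ℝ) ≤ (A ^ 5).trace := by
  classical
  let e : Fin n ≃ V ⊕ Fin (n - Fintype.card V) := Fintype.equivOfCardEq (by simp; omega)
  let B : Matrix (V ⊕ Fin (n - Fintype.card V)) (V ⊕ Fin (n - Fintype.card V)) ℝ :=
    fromBlocks A 0 0 0
  have hB : B.IsAdjMatrix :=
    { zero_or_one := by
        rintro (i | i) (j | j) <;> simp [B, hA.zero_or_one]
      symm := by simp [B, IsSymm, fromBlocks_transpose, hA.symm.eq]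
      apply_diag := by rintro (i | i) <;> simp [B, hA.apply_diag] }
  have hC := hB.submatrix e
  refine ⟨hC.toGraph, ?_, ?_⟩
  · rw [two_mul_edgeCount_eq_sum, hC.adjMatrix_toGraph_eq]
    simp only [submatrix_apply]
    rw [e.sum_comp (fun u => ∑ v, B u (e v))]
    simp_rw [fun u => e.sum_comp (fun v => B u v)]
    simp [B]
  · refine (ten_mul_c5Count_le_trace _).trans_eq ?_
    rw [hC.adjMatrix_toGraph_eq]
    have hpow : (B.submatrix e e) ^ 5 = (B ^ 5).submatrix e e :=
      (map_pow (reindexAlgEquiv ℝ ℝ e.symm) B 5).symm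
    rw [hpow]
    simp only [trace, diag_apply, submatrix_apply]
    rw [e.sum_comp (fun u => (B ^ 5) u u)]
    simp [B, fromBlocks_diagonal_pow]

end Counting

section Construction

variable {q a : ℕ} {Y : Type*}

/-- The matrices of the form `(α I + β J) ⊗ J` on `q` parts of size `a`, bordered by constant
blocks `γ`, `δ` and with a corner `ε J + H` indexed by `Y`. -/
def borderedMatrix (q a : ℕ) (α β γ δ ε : ℝ) (H : Matrix Y Y ℝ) :
    Matrix ((Fin q × Fin a) ⊕ Y) ((Fin q × Fin a) ⊕ Y) ℝ :=
  fromBlocks (of fun i j => (if i.1 = j.1 then α else 0) + β) (of fun _ _ => γ)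
    (of fun _ _ => δ) (of fun i j => ε + H i j)

theorem isAdjMatrix_borderedMatrix {H : Matrix Y Y ℝ} (hH : H.IsAdjMatrix) :
    (borderedMatrix q a (-1) 1 1 1 0 H).IsAdjMatrix where
  zero_or_one := by
    rintro (i | i) (j | j)
    · by_cases h : i.1 = j.1 <;> simp [borderedMatrix, h]
    · simp [borderedMatrix]
    · simp [borderedMatrix]
    · simpa [borderedMatrix] using hH.zero_or_one i j
  symm := by
    ext (i | i) (j | j)
    · simp [borderedMatrix, eq_comm]
    · simp [borderedMatrix]
    · simp [borderedMatrix]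
    · simpa [borderedMatrix] using hH.symm.apply i j
  apply_diag := by
    rintro (i | i)
    · simp [borderedMatrix]
    · simpa [borderedMatrix] using hH.apply_diag i

variable [Fintype Y]

theorem borderedMatrix_mul (α β γ δ ε α' β' γ' δ' ε' : ℝ) (H H' : Matrix Y Y ℝ) (r c : ℝ)
    (hr : ∀ i, ∑ j, H i j = r) (hc : ∀ j, ∑ i, H' i j = c) :
    borderedMatrix q a α β γ δ ε H * borderedMatrix q a α' β' γ' δ' ε' H' =
      borderedMatrix q a (a * α * α')
        (a * (α * β' + β * α' + q * β * β') + Fintype.card Y * γ * δ')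
        (a * (α + q * β) * γ' + γ * (Fintype.card Y * ε' + c))
        (a * δ * (α' + q * β') + (Fintype.card Y * ε + r) * δ')
        (q * a * δ * γ' + Fintype.card Y * ε * ε' + ε * c + r * ε') (H * H') := by
  rw [borderedMatrix, borderedMatrix, borderedMatrix, fromBlocks_multiply]
  congr 1
  · ext i j
    simp [mul_apply, Fintype.sum_prod_type_right, add_mul, mul_add, sum_add_distrib]
    split_ifs <;> simp <;> ring
  · ext i j
    simp [mul_apply, Fintype.sum_prod_type_right, add_mul, mul_add, sum_add_distrib, ← mul_sum, hc]
    ring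
  · ext i j
    simp [mul_apply, Fintype.sum_prod_type_right, add_mul, mul_add, sum_add_distrib, ← sum_mul,
      hr]
    ring
  · ext i j
    simp [mul_apply, add_mul, mul_add, sum_add_distrib, ← mul_sum, ← sum_mul, hr, hc]
    ring

theorem trace_borderedMatrix (α β γ δ ε : ℝ) (H : Matrix Y Y ℝ) :
    (borderedMatrix q a α β γ δ ε H).trace =
      q * a * (α + β) + Fintype.card Y * ε + H.trace := by
  simp [borderedMatrix, trace, sum_add_distrib]
  ring

theorem sum_borderedMatrix (α β γ δ ε : ℝ) (H : Matrix Y Y ℝ) (r : ℝ)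
    (hr : ∀ i, ∑ j, H i j = r) :
    ∑ i, ∑ j, borderedMatrix q a α β γ δ ε H i j =
      q * a * a * (α + q * β) + q * a * Fintype.card Y * (γ + δ)
        + Fintype.card Y * (Fintype.card Y * ε + r) := by
  simp [borderedMatrix, sum_add_distrib, Fintype.sum_prod_type_right, hr]
  ring

theorem Matrix.sum_col_pow [DecidableEq Y] {H : Matrix Y Y ℝ} {d : ℝ}
    (hc : ∀ j, ∑ i, H i j = d) (k : ℕ) (j : Y) : ∑ i, (H ^ k) i j = d ^ k := by
  induction k generalizing j with
  | zero => simp [one_apply]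
  | succ k ih =>
    simp only [pow_succ, mul_apply]
    rw [sum_comm]
    simp [← sum_mul, ih, ← mul_sum, hc]

theorem trace_borderedMatrix_pow_five [DecidableEq Y] {H : Matrix Y Y ℝ} {d : ℝ}
    (hr : ∀ i, ∑ j, H i j = d) (hc : ∀ j, ∑ i, H i j = d) (hH : (H ^ 5).trace = 0) {m : ℝ}
    (hm : (Fintype.card Y : ℝ) = m) :
    (borderedMatrix q a (-1) 1 1 1 0 H ^ 5).trace =
      q * (q - 1) * (q - 2) * ((q - 3) * (q - 4) + 5 * (q - 3) + 5) * a ^ 5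
      + 5 * q * (q - 1) ^ 3 * a ^ 4 * m
      + 5 * q ^ 2 * (q - 1) * a ^ 3 * m ^ 2
      + 5 * q * (q - 1) ^ 2 * a ^ 3 * (m * d)
      + 5 * q ^ 2 * a ^ 2 * (m ^ 2 * d)
      + 5 * q * (q - 1) * a ^ 2 * (m * d ^ 2)
      + 5 * q * a * (m * d ^ 3) := by
  have hpow (k : ℕ) := sum_col_pow hc k
  rw [pow_succ', pow_succ', pow_succ', pow_succ', pow_one,
    borderedMatrix_mul _ _ _ _ _ _ _ _ _ _ H H d d hr hc, ← pow_two,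
    borderedMatrix_mul _ _ _ _ _ _ _ _ _ _ H _ d _ hr (hpow 2), ← pow_succ',
    borderedMatrix_mul _ _ _ _ _ _ _ _ _ _ H _ d _ hr (hpow 3), ← pow_succ',
    borderedMatrix_mul _ _ _ _ _ _ _ _ _ _ H _ d _ hr (hpow 4), ← pow_succ',
    trace_borderedMatrix, hH, hm]
  ring

/-- Circulant `0/1` matrices have constant row and column sums. -/
theorem exists_zero_one_matrix_of_le {h d : ℕ} (hd : d ≤ h) :
    ∃ C : Matrix (Fin h) (Fin h) ℝ, (∀ i j, C i j = 0 ∨ C i j = 1) ∧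
      (∀ i, ∑ j, C i j = d) ∧ ∀ j, ∑ i, C i j = d := by
  rcases Nat.eq_zero_or_pos h with rfl | hpos
  · exact ⟨0, fun i => i.elim0, fun i => i.elim0, fun i => i.elim0⟩
  have : NeZero h := ⟨hpos.ne'⟩
  let φ : Fin h → ℝ := fun i => if i.val < d then 1 else 0
  have hφ : ∑ i, φ i = d := by
    simp only [φ, sum_boole]
    rw [Fin.card_filter_val_lt, min_eq_right hd]
  refine ⟨of fun i j => φ (i - j), fun i j => ?_, fun i => ?_, fun j => ?_⟩
  · simp only [of_apply, φ]
    split_ifs <;> simp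
  · exact ((Equiv.subLeft i).sum_comp φ).trans hφ
  · exact ((Equiv.subRight j).sum_comp φ).trans hφ

/-- A `d`-regular bipartite graph with parts of size `h`, as an adjacency matrix. -/
theorem exists_regular_bipartite_adjMatrix {h d : ℕ} (hd : d ≤ h) :
    ∃ H : Matrix (Fin h ⊕ Fin h) (Fin h ⊕ Fin h) ℝ, H.IsAdjMatrix ∧ (∀ i, ∑ j, H i j = d) ∧
      (∀ j, ∑ i, H i j = d) ∧ (H ^ 5).trace = 0 := by
  obtain ⟨C, h01, hrow, hcol⟩ := exists_zero_one_matrix_of_le hd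
  refine ⟨fromBlocks 0 C Cᵀ 0, ⟨?_, ?_, ?_⟩, ?_, ?_, ?_⟩
  · rintro (i | i) (j | j) <;> simp [h01]
  · simp [IsSymm, fromBlocks_transpose]
  · rintro (i | i) <;> simp
  · rintro (i | i) <;> simp [hrow, hcol]
  · rintro (i | i) <;> simp [hrow, hcol]
  · simp [pow_succ, fromBlocks_multiply, trace]

end Construction

theorem exists_graph_edgeCount_c5Count {q a h d n : ℕ} (hd : d ≤ h) (hn : q * a + 2 * h ≤ n) :
    ∃ G : SimpleGraph (Fin n),
      2 * (edgeCount G : ℝ) = q * (q - 1) * a ^ 2 + 2 * q * a * (2 * h) + 2 * h * d ∧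
      10 * (c5Count G : ℝ) ≤
        q * (q - 1) * (q - 2) * ((q - 3) * (q - 4) + 5 * (q - 3) + 5) * a ^ 5
        + 5 * q * (q - 1) ^ 3 * a ^ 4 * (2 * h)
        + 5 * q ^ 2 * (q - 1) * a ^ 3 * (2 * h) ^ 2
        + 5 * q * (q - 1) ^ 2 * a ^ 3 * (2 * h * d)
        + 5 * q ^ 2 * a ^ 2 * ((2 * h) ^ 2 * d)
        + 5 * q * (q - 1) * a ^ 2 * (2 * h * d ^ 2)
        + 5 * q * a * (2 * h * d ^ 3) := by
  obtain ⟨H, hadj, hrow, hcol, htr⟩ := exists_regular_bipartite_adjMatrix hd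
  have hm : (Fintype.card (Fin h ⊕ Fin h) : ℝ) = 2 * h := by simp; ring
  obtain ⟨G, hE, hC⟩ :=
    (isAdjMatrix_borderedMatrix (q := q) (a := a) hadj).exists_graph_fin (n := n)
      (by simp; omega)
  refine ⟨G, ?_, hC.trans_eq (trace_borderedMatrix_pow_five hrow hcol htr hm)⟩
  rw [hE, sum_borderedMatrix _ _ _ _ _ _ _ hrow, hm]
  ring

theorem mul_sub_le_mul_of_le_add {X A Y B s t : ℝ} (hX : 0 ≤ X) (hB : 0 ≤ B) (hs : 0 ≤ s)
    (hXA : X ≤ A + s) (hYB : Y ≤ B + t) (hBY : B ≤ Y) : X * Y - (t * X + s * Y) ≤ A * B := by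
  nlinarith [mul_nonneg hX (sub_nonneg.2 hYB), mul_nonneg hB (sub_nonneg.2 hXA),
    mul_nonneg hs (sub_nonneg.2 hBY)]

theorem exists_nat_le_le_add_one {t : ℝ} (ht : 0 ≤ t) : ∃ a : ℕ, (a : ℝ) ≤ t ∧ t ≤ a + 1 :=
  ⟨⌊t⌋₊, Nat.floor_le ht, (Nat.lt_floor_add_one t).le⟩

theorem exists_half_degree {t ρ : ℝ} (ht : 0 ≤ t) (hρ0 : 0 ≤ ρ) (hρ1 : ρ < 1 / 2) :
    ∃ h d : ℕ, d ≤ h ∧ (h : ℝ) ≤ t / 2 ∧ t / 2 ≤ h + 1 ∧ (d : ℝ) ≤ ρ * t ∧ ρ * t ≤ d + 1 :=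
  ⟨⌊t / 2⌋₊, ⌊ρ * t⌋₊, Nat.floor_le_floor (by nlinarith), Nat.floor_le (by positivity),
    (Nat.lt_floor_add_one _).le, Nat.floor_le (by positivity), (Nat.lt_floor_add_one _).le⟩

/-- Upper-bound construction: for `k ≥ 2`, reals `x, y ≥ 0` and `0 < ρ < 1/2` with
`(k−1)x + y = 1`, letting `g` be the target edge density and `f` the target `C₅` density
(expressed with falling factorials `(k−1)_ℓ`), for every `ε > 0` and all large `n` there
is a graph on `n` vertices with edge count within `εn²` of `g·n(n−1)/2` and at most
`(f + ε)·n⁵` copies of `C₅`. -/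
theorem upper_bound_construction (k : ℕ) (hk : 2 ≤ k) (x y ρ : ℝ)
    (hx : 0 ≤ x) (hy : 0 ≤ y) (hρ0 : 0 < ρ) (hρ1 : ρ < 1/2)
    (hsum : ((k:ℝ) - 1) * x + y = 1) (g f : ℝ)
    (hg : g = ((k-1).descFactorial 2 : ℝ) * x^2 + 2 * ((k:ℝ) - 1) * x * y + ρ * y^2)
    (hf : f =
      (((k-1).descFactorial 5 : ℝ)/10 + ((k-1).descFactorial 4 : ℝ)/2
          + ((k-1).descFactorial 3 : ℝ)/2) * x^5
      + (((k-1).descFactorial 4 : ℝ)/2 + 3 * ((k-1).descFactorial 3 : ℝ)/2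
          + ((k-1).descFactorial 2 : ℝ)/2) * x^4 * y
      + ((1/2 + ρ/2) * ((k-1).descFactorial 3 : ℝ)
          + (1 + ρ/2) * ((k-1).descFactorial 2 : ℝ)) * x^3 * y^2
      + ((ρ/2 + ρ^2/2) * ((k-1).descFactorial 2 : ℝ)
          + (ρ/2) * ((k:ℝ) - 1)) * x^2 * y^3
      + (ρ^3/2) * ((k:ℝ) - 1) * x * y^4) :
    ∀ ε : ℝ, 0 < ε → ∃ N : ℕ, ∀ n : ℕ, N ≤ n →
      ∃ G : SimpleGraph (Fin n),
        |(edgeCount G : ℝ) - g * ((n:ℝ) * ((n:ℝ) - 1) / 2)| ≤ ε * (n:ℝ)^2 ∧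
        (c5Count G : ℝ) ≤ (f + ε) * (n:ℝ)^5 := by
  obtain ⟨q, rfl⟩ : ∃ q, k = q + 1 := ⟨k - 1, by omega⟩
  have hq : (1 : ℝ) ≤ q := by exact_mod_cast (by omega : 1 ≤ q)
  simp only [Nat.add_sub_cancel] at hg hf
  have hk' : (((q + 1 : ℕ) : ℝ) - 1) = q := by push_cast; ring
  rw [hk'] at hg hf hsum
  have hdesc (l : ℕ) : (q.descFactorial (l + 1) : ℝ) = (q - l) * q.descFactorial l := by
    rw [Nat.descFactorial_succ]
    rcases le_or_gt l q with h | h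
    · push_cast [h]; ring
    · simp [Nat.descFactorial_of_lt h]
  have h1 : (q.descFactorial 1 : ℝ) = q := by simp
  have h2 : (q.descFactorial 2 : ℝ) = (q - 1) * q := by rw [hdesc, h1]; norm_num
  have h3 : (q.descFactorial 3 : ℝ) = (q - 2) * ((q - 1) * q) := by rw [hdesc, h2]; norm_num
  have h4 : (q.descFactorial 4 : ℝ) = (q - 3) * ((q - 2) * ((q - 1) * q)) := by
    rw [hdesc, h3]; norm_num
  have h5 : (q.descFactorial 5 : ℝ) = (q - 4) * ((q - 3) * ((q - 2) * ((q - 1) * q))) := by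
    rw [hdesc, h4]; norm_num
  have hnn5 : 0 ≤ (q.descFactorial 5 : ℝ) + 5 * q.descFactorial 4 + 5 * q.descFactorial 3 := by
    positivity
  have hq1 : (0 : ℝ) ≤ q - 1 := by linarith
  have hg0 : 0 ≤ g := by rw [hg]; positivity
  rw [h2] at hg
  rw [h2, h3, h4, h5] at hf
  rw [h3, h4, h5] at hnn5
  have hK : 0 ≤ (q : ℝ) * (q - 1) * (q - 2) * ((q - 3) * (q - 4) + 5 * (q - 3) + 5) := by
    linarith
  intro ε hε
  set M : ℝ := q * (q - 1) * (2 * x) + 2 * q * (2 * x + y) + (y + 2 * (ρ * y)) + g with hM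
  refine ⟨⌈M / ε⌉₊, fun n hn => ?_⟩
  have hn0 : (0 : ℝ) ≤ n := n.cast_nonneg
  have hMn : M ≤ ε * n := by
    have := (Nat.le_ceil (M / ε)).trans (Nat.cast_le.mpr hn)
    rwa [div_le_iff₀' hε] at this
  have hxn : 0 ≤ x * n := by positivity
  have hyn : 0 ≤ y * n := by positivity
  have hρn : 0 ≤ ρ * y * n := by positivity
  obtain ⟨a, ha, ha'⟩ := exists_nat_le_le_add_one hxn
  obtain ⟨h, d, hdh, hh, hh', hd, hd'⟩ := exists_half_degree hyn hρ0.le hρ1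
  rw [← mul_assoc] at hd hd'
  have hm : 2 * (h : ℝ) ≤ y * n := by linarith
  have hcard : q * a + 2 * h ≤ n := by
    have : (q : ℝ) * a + 2 * h ≤ n := by
      calc (q : ℝ) * a + 2 * h ≤ q * (x * n) + y * n := by gcongr
        _ = (q * x + y) * n := by ring
        _ = n := by rw [hsum, one_mul]
    exact_mod_cast this
  obtain ⟨G, hE, hC⟩ := exists_graph_edgeCount_c5Count (q := q) hdh hcard
  refine ⟨G, ?_, ?_⟩
  · have hupper : 2 * (edgeCount G : ℝ) ≤ g * n ^ 2 := by
      calc 2 * (edgeCount G : ℝ) = q * (q - 1) * a ^ 2 + 2 * q * a * (2 * h) + 2 * h * d := hE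
        _ ≤ q * (q - 1) * (x * n) ^ 2 + 2 * q * (x * n) * (y * n) + y * n * (ρ * y * n) := by
          gcongr
        _ = g * n ^ 2 := by rw [hg]; ring
    have hlower : g * n ^ 2 - (M - g) * n ≤ 2 * (edgeCount G : ℝ) := by
      have haa := mul_sub_le_mul_of_le_add hxn a.cast_nonneg zero_le_one ha' ha' ha
      have ham := mul_sub_le_mul_of_le_add (B := 2 * h) (t := 2) hxn (by positivity) zero_le_one
        ha' (by linarith) hm
      have hmd := mul_sub_le_mul_of_le_add (A := 2 * h) (s := 2) hyn d.cast_nonneg zero_le_two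
        (by linarith) hd' hd
      have haa' := mul_le_mul_of_nonneg_left haa (by positivity : 0 ≤ (q : ℝ) * (q - 1))
      have ham' := mul_le_mul_of_nonneg_left ham (by positivity : 0 ≤ 2 * (q : ℝ))
      rw [hE, hM, hg]
      linarith
    have hMn' : M * n ≤ ε * n ^ 2 := by
      calc M * n ≤ ε * n * n := by gcongr
        _ = ε * n ^ 2 := by ring
    have hgn : 0 ≤ g * n := by positivity
    have hεn : 0 ≤ ε * (n : ℝ) ^ 2 := by positivity
    have hM0 : 0 ≤ (M - g) * n := by
      have : 0 ≤ M - g := by rw [hM, add_sub_cancel_right]; positivity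
      positivity
    rw [abs_le]
    constructor <;> linarith
  · have hfn : 10 * (c5Count G : ℝ) ≤ 10 * (f * n ^ 5) := by
      refine hC.trans ?_
      calc _ ≤ (q : ℝ) * (q - 1) * (q - 2) * ((q - 3) * (q - 4) + 5 * (q - 3) + 5) * (x * n) ^ 5
            + 5 * q * (q - 1) ^ 3 * (x * n) ^ 4 * (y * n)
            + 5 * q ^ 2 * (q - 1) * (x * n) ^ 3 * (y * n) ^ 2
            + 5 * q * (q - 1) ^ 2 * (x * n) ^ 3 * (y * n * (ρ * y * n))
            + 5 * q ^ 2 * (x * n) ^ 2 * ((y * n) ^ 2 * (ρ * y * n))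
            + 5 * q * (q - 1) * (x * n) ^ 2 * (y * n * (ρ * y * n) ^ 2)
            + 5 * q * (x * n) * (y * n * (ρ * y * n) ^ 3) := by gcongr
        _ = 10 * (f * n ^ 5) := by rw [hf]; ring
    have hεn : 0 ≤ ε * (n : ℝ) ^ 5 := by positivity
    linarith
end

section
/- Let k ≥ 3 be an integer, p = 1 − 1/k, and λ_k = 1/10 − 1/(2k) + 1/k² − 1/k³ + 2/(5k⁴). Let (G_m) be a sequence of simple graphs with n_m := |V(G_m)| → ∞ such that |E(G_m)| ≥ (p − 1/m)·n_m(n_m−1)/2 and the number of copies of C₅ in G_m is at most (λ_k + 1/m)·n_m^5, for every m. Then for every finite simple graph F on vertex set {1,…,ℓ}, the number of injective maps φ : {1,…,ℓ} → V(G_m) such that, for all distinct u, v ∈ {1,…,ℓ}, uv is an edge of F if and only if φ(u)φ(v) is an edge of G_m, equals (N_F·k^{−ℓ} + o(1))·n_m^ℓ as m → ∞, where N_F is the number of maps f : {1,…,ℓ} → {1,…,k} such that for all distinct u, v, uv is an edge of F if and only if f(u) ≠ f(v). -/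
open Filter

/-- The number of injective maps `φ : V(F) → V(G)` inducing `F`, i.e. such that distinct
`u, v` are adjacent in `F` iff their images are adjacent in `G`. -/
noncomputable def injIndCount {l : ℕ} {V : Type*} (F : SimpleGraph (Fin l))
    (G : SimpleGraph V) : ℕ :=
  Nat.card {φ : Fin l → V // Function.Injective φ ∧
    ∀ u v : Fin l, u ≠ v → (F.Adj u v ↔ G.Adj (φ u) (φ v))}

/-- `N_F`: the number of maps `f : V(F) → {1,…,k}` such that distinct `u, v` are adjacent
in `F` iff `f u ≠ f v`. -/
noncomputable def NFcount {l : ℕ} (k : ℕ) (F : SimpleGraph (Fin l)) : ℕ :=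
  Nat.card {f : Fin l → Fin k // ∀ u v : Fin l, u ≠ v → (F.Adj u v ↔ f u ≠ f v)}


open Polynomial in
/-- Expansion of a linear functional on a polynomial of degree at most six. -/
lemma functional_expand (φ : ℝ[X] →ₗ[ℝ] ℝ) (a b c d e f g : ℝ) :
    φ (C a + C b * X + C c * X ^ 2 + C d * X ^ 3 + C e * X ^ 4 + C f * X ^ 5 + C g * X ^ 6) =
      a * φ 1 + b * φ X + c * φ (X ^ 2) + d * φ (X ^ 3) + e * φ (X ^ 4) + f * φ (X ^ 5)
        + g * φ (X ^ 6) := by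
  have h1 : (C a : ℝ[X]) = a • 1 := by rw [smul_eq_C_mul, mul_one]
  rw [h1]
  simp only [← smul_eq_C_mul, map_add, map_smul, smul_eq_mul]

section Functional
open Polynomial

variable (φ : ℝ[X] →ₗ[ℝ] ℝ)

lemma variance_nonneg (hpos : ∀ f, 0 ≤ φ (f * f)) (h1 : φ 1 = 1) :
    (φ X) ^ 2 ≤ φ (X ^ 2) := by
  set m := φ X with hm
  have h := hpos (X - C m)
  have e : (X - C m) * (X - C m) = C (m ^ 2) + C (-2 * m) * X + C 1 * X ^ 2 + C 0 * X ^ 3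
      + C 0 * X ^ 4 + C 0 * X ^ 5 + C 0 * X ^ 6 := by
    simp only [map_mul, map_pow, map_neg, map_one, map_zero, C_ofNat]; ring
  rw [e, functional_expand, h1, ← hm] at h
  linarith

lemma jensen_fourth (hpos : ∀ f, 0 ≤ φ (f * f)) (h1 : φ 1 = 1) :
    (φ X) ^ 4 ≤ φ (X ^ 4) := by
  have hv := variance_nonneg φ hpos h1
  set m := φ X with hm
  have h := hpos (X ^ 2 - C (m ^ 2))
  have e : (X ^ 2 - C (m ^ 2)) * (X ^ 2 - C (m ^ 2)) = C (m ^ 4) + C 0 * X + C (-2 * m ^ 2) * X ^ 2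
      + C 0 * X ^ 3 + C 1 * X ^ 4 + C 0 * X ^ 5 + C 0 * X ^ 6 := by
    simp only [map_mul, map_pow, map_neg, map_one, map_zero, C_ofNat]; ring
  rw [e, functional_expand, h1] at h
  nlinarith [mul_le_mul_of_nonneg_left hv (sq_nonneg m)]

/-- A quantitative Jensen inequality for `5 (1 - m) x ^ 2 - 5 x ^ 3 + 4 x ^ 4`, which is strictly
convex, at the mean `m`. -/
lemma jensen_quartic (hpos : ∀ f, 0 ≤ φ (f * f)) (h1 : φ 1 = 1) {m : ℝ} (hm : φ X = m) :
    5 * (1 - m) * m ^ 2 - 5 * m ^ 3 + 4 * m ^ 4 + 5 / 16 * (φ (X ^ 2) - m ^ 2) ≤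
      5 * (1 - m) * φ (X ^ 2) - 5 * φ (X ^ 3) + 4 * φ (X ^ 4) := by
  have hv := variance_nonneg φ hpos h1
  rw [hm] at hv
  have h := hpos ((X - C m) * (X + C (m - 5 / 8)))
  have e : ((X - C m) * (X + C (m - 5 / 8))) * ((X - C m) * (X + C (m - 5 / 8))) =
      C (m ^ 2 * (m - 5 / 8) ^ 2) + C (2 * (-5 / 8) * (-(m * (m - 5 / 8)))) * X
      + C ((-5 / 8) ^ 2 - 2 * (m * (m - 5 / 8))) * X ^ 2
      + C (2 * (-5 / 8)) * X ^ 3 + C 1 * X ^ 4 + C 0 * X ^ 5 + C 0 * X ^ 6 := by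
    have : (X - C m) * (X + C (m - 5 / 8)) = X ^ 2 + C (-5 / 8) * X - C (m * (m - 5 / 8)) := by
      have h2 : (C (-5 / 8 : ℝ)) = C (m - 5 / 8) - C m := by rw [← C_sub]; congr 1; ring
      rw [h2, C_mul]; ring
    rw [this]
    set r := m * (m - 5 / 8)
    have h3 : m ^ 2 * (m - 5 / 8) ^ 2 = r ^ 2 := by simp only [r]; ring
    rw [h3]
    set t : ℝ := -5 / 8
    simp only [map_mul, map_pow, map_neg, map_one, map_zero, C_ofNat, map_sub]; ring
  rw [e, functional_expand, h1, hm] at h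
  nlinarith [mul_nonneg (sub_nonneg.2 hv) (sq_nonneg (m - 5 / 8))]

lemma fifth_moment_le (hpos : ∀ f, 0 ≤ φ (f * f)) (hle : ∀ f, 0 ≤ φ ((1 - X) * (f * f)))
    (h1 : φ 1 = 1) {m : ℝ} (hm : φ X = m) (hm0 : 0 ≤ m) (hm1 : m ≤ 1) :
    φ (X ^ 5) ≤ m ^ 5 + 10 * (φ (X ^ 2) - m ^ 2) := by
  have hv := variance_nonneg φ hpos h1
  rw [hm] at hv
  have h := hle ((X - C m) * (X + C ((1 + 2 * m) / 2)))
  have h' := hle (X - C m)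
  have e : (1 - X) * (((X - C m) * (X + C ((1 + 2 * m) / 2))) *
        ((X - C m) * (X + C ((1 + 2 * m) / 2)))) =
      C ((m * ((1 + 2 * m) / 2)) ^ 2)
      + C (-(m * ((1 + 2 * m) / 2)) - (m * ((1 + 2 * m) / 2)) ^ 2) * X
      + C (1 / 4 - 2 * (m * ((1 + 2 * m) / 2)) + (m * ((1 + 2 * m) / 2))) * X ^ 2
      + C (1 - 1 / 4 + 2 * (m * ((1 + 2 * m) / 2))) * X ^ 3
      + C (0) * X ^ 4 + C (-1) * X ^ 5 + C 0 * X ^ 6 := by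
    have : (X - C m) * (X + C ((1 + 2 * m) / 2)) =
        X ^ 2 + C (1 / 2) * X - C (m * ((1 + 2 * m) / 2)) := by
      have h2 : (C (1 / 2 : ℝ)) = C ((1 + 2 * m) / 2) - C m := by rw [← C_sub]; congr 1; ring
      rw [h2, C_mul]; ring
    rw [this]
    set r := m * ((1 + 2 * m) / 2)
    have h4 : (C (1 / 4 : ℝ)) = C (1 / 2) * C (1 / 2) := by rw [← C_mul]; congr 1; norm_num
    have h5 : (1 : ℝ[X]) = C (1 / 2) + C (1 / 2) := by rw [← C_add, ← C_1]; congr 1; norm_num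
    set t : ℝ[X] := C (1 / 2)
    simp only [map_mul, map_pow, map_neg, map_one, map_zero, C_ofNat, map_sub, map_add, h4]
    linear_combination (X * C r - X ^ 2 * C r - X ^ 3 + X ^ 4) * h5
  have e' : (1 - X) * ((X - C m) * (X - C m)) = C (m ^ 2) + C (-2 * m - m ^ 2) * X
      + C (1 + 2 * m) * X ^ 2 + C (-1) * X ^ 3
      + C 0 * X ^ 4 + C 0 * X ^ 5 + C 0 * X ^ 6 := by
    simp only [map_mul, map_pow, map_neg, map_one, map_zero, C_ofNat, map_sub, map_add]; ring
  rw [e, functional_expand, h1, hm] at h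
  rw [e', functional_expand, h1, hm] at h'
  have k1 : 0 ≤ (1 + 2 * m + 3 * m ^ 2) - (1 + 2 * m) ^ 2 / 4 := by nlinarith
  have k2 := mul_nonneg k1 h'
  have k3 : 1 + 2 * m + 3 * m ^ 2 + 4 * m ^ 3 ≤ 10 := by
    nlinarith [pow_le_one₀ hm0 hm1 (n := 3), pow_le_one₀ hm0 hm1 (n := 2)]
  have k4 := mul_nonneg (sub_nonneg.2 k3) (sub_nonneg.2 hv)
  nlinarith

/-- Multiplying out `x ^ 2 (x - m) ^ 2 (3 x ^ 2 + 2 m x + m ^ 2)` and completing the square in the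
last factor. -/
lemma projection_defect_le (hpos : ∀ f, 0 ≤ φ (f * f)) (m : ℝ) :
    2 * m ^ 2 * φ ((X ^ 2 - C m * X) * (X ^ 2 - C m * X)) ≤
      3 * (m ^ 4 * φ (X ^ 2) - 4 * m * φ (X ^ 5) + 3 * φ (X ^ 6)) := by
  have h := hpos (X * (X - C m) * (C 3 * X + C m))
  have e : (X * (X - C m) * (C 3 * X + C m)) * (X * (X - C m) * (C 3 * X + C m)) =
      C 0 + C 0 * X + C (m ^ 4) * X ^ 2 + C (4 * m ^ 3) * X ^ 3
      + C (-2 * m ^ 2) * X ^ 4 + C (-12 * m) * X ^ 5 + C 9 * X ^ 6 := by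
    simp only [map_mul, map_pow, map_neg, map_zero, C_ofNat]; ring
  have e' : (X ^ 2 - C m * X) * (X ^ 2 - C m * X) =
      C 0 + C 0 * X + C (m ^ 2) * X ^ 2 + C (-2 * m) * X ^ 3
      + C 1 * X ^ 4 + C 0 * X ^ 5 + C 0 * X ^ 6 := by
    simp only [map_mul, map_pow, map_neg, map_one, map_zero, C_ofNat]; ring
  rw [e, functional_expand] at h
  rw [e', functional_expand]
  linarith

end Functional

section Kernel
open Polynomial Matrix

variable {V : Type*} [Fintype V] [DecidableEq V]

/-- The functional sending `f` to the average row sum of `f(M)`. -/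
noncomputable def walkFunctional (M : Matrix V V ℝ) : ℝ[X] →ₗ[ℝ] ℝ where
  toFun f := ((1 : V → ℝ) ⬝ᵥ (aeval M f *ᵥ 1)) / Fintype.card V
  map_add' f g := by simp [add_mulVec, add_div]
  map_smul' a f := by simp [smul_mulVec, mul_div_assoc]

/-- The functional sending `f` to the trace of `f(M)`. -/
noncomputable def traceFunctional (M : Matrix V V ℝ) : ℝ[X] →ₗ[ℝ] ℝ where
  toFun f := (aeval M f).trace
  map_add' f g := by simp
  map_smul' a f := by simp

lemma transpose_aeval {M : Matrix V V ℝ} (hM : Mᵀ = M) (f : ℝ[X]) :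
    (aeval M f)ᵀ = aeval M f := by
  induction f using Polynomial.induction_on' with
  | add p q hp hq => simp [hp, hq]
  | monomial n a => simp [aeval_monomial, Algebra.algebraMap_eq_smul_one, transpose_pow, hM]

lemma walkFunctional_mul_self_nonneg {M : Matrix V V ℝ} (hM : Mᵀ = M) (f : ℝ[X]) :
    0 ≤ walkFunctional M (f * f) := by
  refine div_nonneg ?_ (Nat.cast_nonneg _)
  rw [map_mul, ← mulVec_mulVec, dotProduct_mulVec, ← mulVec_transpose, transpose_aeval hM]
  exact Finset.sum_nonneg fun x _ => mul_self_nonneg _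

lemma traceFunctional_mul_self {M : Matrix V V ℝ} (hM : Mᵀ = M) (f : ℝ[X]) :
    traceFunctional M (f * f) = ∑ x, ∑ y, (aeval M f x y) ^ 2 := by
  have h := transpose_aeval hM f
  simp only [traceFunctional, LinearMap.coe_mk, AddHom.coe_mk, map_mul, trace, diag_apply,
    mul_apply]
  refine Finset.sum_congr rfl fun x _ => Finset.sum_congr rfl fun y _ => ?_
  rw [sq]
  congr 1
  exact congrFun (congrFun h x) y

lemma traceFunctional_mul_self_nonneg {M : Matrix V V ℝ} (hM : Mᵀ = M) (f : ℝ[X]) :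
    0 ≤ traceFunctional M (f * f) := by
  rw [traceFunctional_mul_self hM]
  positivity

lemma walkFunctional_one [Nonempty V] (M : Matrix V V ℝ) : walkFunctional M 1 = 1 := by
  simp [walkFunctional]

lemma walkFunctional_one_sub_X_mul_nonneg [Nonempty V] {M : Matrix V V ℝ} (hM : Mᵀ = M)
    (h0 : ∀ x y, 0 ≤ M x y) (h1 : ∀ x y, M x y ≤ 1 / Fintype.card V) (f : ℝ[X]) :
    0 ≤ walkFunctional M ((1 - X) * (f * f)) := by
  refine div_nonneg ?_ (Nat.cast_nonneg _)
  set g := aeval M f *ᵥ 1 with hg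
  have e : (1 : V → ℝ) ⬝ᵥ (aeval M ((1 - X) * (f * f)) *ᵥ 1) =
      ∑ x, g x ^ 2 - ∑ x, ∑ y, M x y * (g x * g y) := by
    have : (1 - X) * (f * f) = f * ((1 - X) * f) := by ring
    rw [this, map_mul, map_mul, ← mulVec_mulVec, dotProduct_mulVec, ← mulVec_transpose,
      transpose_aeval hM, ← mulVec_mulVec, ← hg]
    simp only [map_sub, map_one, aeval_X, sub_mulVec, one_mulVec, dotProduct_sub]
    congr 1
    · exact Finset.sum_congr rfl fun x _ => (sq _).symm
    · simp only [dotProduct, mulVec, Finset.mul_sum]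
      exact Finset.sum_congr rfl fun x _ => Finset.sum_congr rfl fun y _ => by ring
  rw [e, sub_nonneg]
  have hN : (0 : ℝ) < Fintype.card V := by exact_mod_cast Fintype.card_pos
  calc ∑ x, ∑ y, M x y * (g x * g y)
      ≤ ∑ x, ∑ y, 1 / (Fintype.card V : ℝ) * ((g x ^ 2 + g y ^ 2) / 2) := by
        refine Finset.sum_le_sum fun x _ => Finset.sum_le_sum fun y _ => ?_
        calc M x y * (g x * g y) ≤ M x y * ((g x ^ 2 + g y ^ 2) / 2) :=
              mul_le_mul_of_nonneg_left (by nlinarith [sq_nonneg (g x - g y)]) (h0 x y)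
          _ ≤ _ := mul_le_mul_of_nonneg_right (h1 x y) (by positivity)
    _ = ∑ x, g x ^ 2 := by
        simp only [← Finset.mul_sum, ← Finset.sum_div, Finset.sum_add_distrib, Finset.sum_const,
          Finset.card_univ, nsmul_eq_mul]
        field_simp
        ring

lemma pow_entry_nonneg {M : Matrix V V ℝ} (h0 : ∀ x y, 0 ≤ M x y) (i : ℕ) (x y : V) :
    0 ≤ (M ^ i) x y := by
  induction i generalizing x y with
  | zero => rw [pow_zero, one_apply]; positivity
  | succ i ih =>
    rw [pow_succ, mul_apply]
    exact Finset.sum_nonneg fun z _ => mul_nonneg (ih _ _) (h0 _ _)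

/-- Dropping one edge of a closed walk. -/
lemma trace_pow_succ_le {M : Matrix V V ℝ} (h0 : ∀ x y, 0 ≤ M x y)
    (h1 : ∀ x y, M x y ≤ 1 / Fintype.card V) (i : ℕ) :
    traceFunctional M (X ^ (i + 1)) ≤ walkFunctional M (X ^ i) := by
  simp only [traceFunctional, walkFunctional, LinearMap.coe_mk, AddHom.coe_mk, map_pow, map_mul,
    aeval_X, pow_succ, trace, diag_apply, mul_apply, dotProduct, mulVec, Pi.one_apply, one_mul,
    mul_one, Finset.sum_div]
  refine Finset.sum_le_sum fun x _ => Finset.sum_le_sum fun y _ => ?_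
  rw [div_eq_mul_one_div]
  exact mul_le_mul_of_nonneg_left (h1 _ _) (pow_entry_nonneg h0 i _ _)

lemma trace_sq_eq {M : Matrix V V ℝ} (hM : Mᵀ = M)
    (h01 : ∀ x y, M x y ^ 2 = M x y / Fintype.card V) :
    traceFunctional M (X ^ 2) = walkFunctional M X := by
  rw [sq, traceFunctional_mul_self hM]
  simp [walkFunctional, dotProduct, mulVec, Finset.sum_div, h01]

/-- The normalised all-ones matrix. -/
noncomputable def meanMatrix (V : Type*) [Fintype V] : Matrix V V ℝ :=
  Matrix.of fun _ _ => 1 / (Fintype.card V : ℝ)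

lemma trace_meanMatrix_mul (M : Matrix V V ℝ) (i : ℕ) :
    (meanMatrix V * M ^ i).trace = walkFunctional M (X ^ i) := by
  simp only [meanMatrix, walkFunctional, LinearMap.coe_mk, AddHom.coe_mk, map_pow, aeval_X,
    trace, diag_apply, mul_apply, of_apply, dotProduct, mulVec, Pi.one_apply, one_mul, mul_one,
    Finset.sum_div]
  rw [Finset.sum_comm]
  exact Finset.sum_congr rfl fun x _ => Finset.sum_congr rfl fun y _ => by ring

lemma meanMatrix_mul_mul (M : Matrix V V ℝ) (i : ℕ) :
    meanMatrix V * M ^ i * meanMatrix V = walkFunctional M (X ^ i) • meanMatrix V := by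
  rw [← trace_meanMatrix_mul]
  ext x y
  simp only [meanMatrix, mul_apply, of_apply, trace, diag_apply, Matrix.smul_apply, smul_eq_mul,
    Finset.sum_mul]

/-- The fifth closed-walk moment of the complement `J - M`. -/
lemma trace_complement_pow_five [Nonempty V] (M : Matrix V V ℝ) :
    ((meanMatrix V - M) ^ 5).trace =
      1 - 5 * walkFunctional M X + 5 * walkFunctional M (X ^ 2) + 5 * walkFunctional M X ^ 2
      - 5 * walkFunctional M (X ^ 3) - 5 * walkFunctional M X * walkFunctional M (X ^ 2)
      + 5 * walkFunctional M (X ^ 4) - traceFunctional M (X ^ 5) := by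
  set E := meanMatrix V
  set B := E - M with hB
  have key : ∀ i, E * M ^ i * B = walkFunctional M (X ^ i) • (E * M ^ 0) - E * M ^ (i + 1) := by
    intro i
    rw [hB, mul_sub, meanMatrix_mul_mul, pow_zero, mul_one, pow_succ, mul_assoc _ _ M]
  have tel : B ^ 5 = B ^ 4 * E * 1 - B ^ 3 * E * M + B ^ 2 * E * M ^ 2 - B * E * M ^ 3
      + E * M ^ 4 - M ^ 5 := by
    have : E = B + M := by rw [hB]; abel
    rw [this]; noncomm_ring
  have w0 : walkFunctional M (X ^ 0) = 1 := by rw [pow_zero, walkFunctional_one]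
  have cyc : ∀ i j, (B ^ i * E * M ^ j).trace = (E * M ^ j * B ^ i).trace := by
    intro i j; rw [mul_assoc, trace_mul_comm]
  have hT : traceFunctional M (X ^ 5) = (M ^ 5).trace := by simp [traceFunctional]
  have c4 := cyc 4 0
  have c3 := cyc 3 1
  have c2 := cyc 2 2
  have c1 := cyc 1 3
  rw [pow_zero] at c4
  rw [pow_one] at c3 c1
  rw [tel, hT]
  simp only [trace_sub, trace_add, c4, c3, c2, c1]
  have p1 : walkFunctional M (X ^ 1) = walkFunctional M X := by rw [pow_one]
  have e4 : E * 1 * B ^ 4 = E * M ^ 0 * B * B * B * B := by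
    rw [pow_zero]; noncomm_ring
  have e3 : E * M * B ^ 3 = E * M ^ 1 * B * B * B := by
    rw [pow_one]; noncomm_ring
  have e2 : E * M ^ 2 * B ^ 2 = E * M ^ 2 * B * B := by
    noncomm_ring
  rw [e4, e3, e2]
  simp only [key, sub_mul, smul_mul_assoc, smul_sub, smul_smul, trace_sub, trace_smul,
    trace_meanMatrix_mul, E, smul_eq_mul, w0, zero_add, p1, Nat.reduceAdd, one_mul]
  ring

end Kernel

section Stability
open Polynomial Matrix
open scoped BigOperators

variable {V : Type*}

open Classical in
/-- The `0/1` indicator of non-adjacency; it is `1` on the diagonal. -/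
noncomputable def nonadj (G : SimpleGraph V) (x y : V) : ℝ := if G.Adj x y then 0 else 1

lemma nonadj_eq_zero_or_one (G : SimpleGraph V) (x y : V) :
    nonadj G x y = 0 ∨ nonadj G x y = 1 := by
  unfold nonadj; split_ifs <;> simp

lemma nonadj_nonneg (G : SimpleGraph V) (x y : V) : 0 ≤ nonadj G x y := by
  rcases nonadj_eq_zero_or_one G x y with h | h <;> simp [h]

lemma nonadj_le_one (G : SimpleGraph V) (x y : V) : nonadj G x y ≤ 1 := by
  rcases nonadj_eq_zero_or_one G x y with h | h <;> simp [h]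

lemma nonadj_comm (G : SimpleGraph V) (x y : V) : nonadj G x y = nonadj G y x := by
  unfold nonadj
  split_ifs with h h' h'
  exacts [rfl, absurd h.symm h', absurd h'.symm h, rfl]

lemma nonadj_self (G : SimpleGraph V) (x : V) : nonadj G x x = 1 := by
  simp [nonadj]

variable [Fintype V]

/-- Average deviation of the non-adjacency degrees from `q`. -/
noncomputable def degreeDefect (q : ℝ) (G : SimpleGraph V) : ℝ :=
  𝔼 x, |𝔼 y, nonadj G x y - q|

/-- Density of the triples violating transitivity of non-adjacency. -/
noncomputable def transitivityDefect (G : SimpleGraph V) : ℝ :=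
  𝔼 x, 𝔼 y, 𝔼 z, nonadj G x y * nonadj G y z * (1 - nonadj G x z)

lemma degreeDefect_nonneg (q : ℝ) (G : SimpleGraph V) : 0 ≤ degreeDefect q G :=
  Finset.expect_nonneg fun _ _ => abs_nonneg _

lemma transitivityDefect_nonneg (G : SimpleGraph V) : 0 ≤ transitivityDefect G :=
  Finset.expect_nonneg fun _ _ => Finset.expect_nonneg fun _ _ => Finset.expect_nonneg fun _ _ =>
    mul_nonneg (mul_nonneg (nonadj_nonneg _ _ _) (nonadj_nonneg _ _ _))
      (sub_nonneg.2 (nonadj_le_one _ _ _))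

/-- The non-adjacency matrix divided by the number of vertices. -/
noncomputable def nonadjMatrix (G : SimpleGraph V) : Matrix V V ℝ :=
  Matrix.of fun x y => nonadj G x y / Fintype.card V

variable [DecidableEq V]

lemma degreeDefect_sq_le [Nonempty V] (q : ℝ) (G : SimpleGraph V) :
    degreeDefect q G ^ 2 ≤ walkFunctional (nonadjMatrix G) (X ^ 2)
      - 2 * q * walkFunctional (nonadjMatrix G) X + q ^ 2 := by
  have hN : (0 : ℝ) < Fintype.card V := by exact_mod_cast Fintype.card_pos
  set M := nonadjMatrix G with hMdef
  have hM : Mᵀ = M := by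
    ext x y; simp [hMdef, nonadjMatrix, nonadj_comm G x y]
  set d := M *ᵥ (1 : V → ℝ) with hd
  have hdx : ∀ x, 𝔼 y, nonadj G x y = d x := by
    intro x
    simp [hd, mulVec, dotProduct, hMdef, nonadjMatrix, Fintype.expect_eq_sum_div_card,
      Finset.sum_div]
  have e1 : walkFunctional M X = (∑ x, d x) / Fintype.card V := by
    simp [walkFunctional, ← hd, dotProduct]
  have e2 : walkFunctional M (X ^ 2) = (∑ x, d x ^ 2) / Fintype.card V := by
    simp only [walkFunctional, LinearMap.coe_mk, AddHom.coe_mk, map_pow, aeval_X]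
    rw [sq, ← mulVec_mulVec, dotProduct_mulVec, ← mulVec_transpose, hM, ← hd]
    simp [dotProduct, sq]
  have h := sq_sum_le_card_mul_sum_sq (s := Finset.univ) (f := fun x => |d x - q|)
  simp only [sq_abs, Finset.card_univ] at h
  have e3 : ∑ x, (d x - q) ^ 2 = ∑ x, d x ^ 2 - 2 * q * ∑ x, d x + Fintype.card V * q ^ 2 := by
    simp only [sub_sq, Finset.sum_add_distrib, Finset.sum_sub_distrib, Finset.sum_const,
      Finset.card_univ, nsmul_eq_mul, Finset.mul_sum]
    congr 2
    exact Finset.sum_congr rfl fun x _ => by ring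
  rw [e3] at h
  have e4 : degreeDefect q G = (∑ x, |d x - q|) / Fintype.card V := by
    simp [degreeDefect, Fintype.expect_eq_sum_div_card, ← hdx]
  rw [e4, e1, e2, div_pow, div_le_iff₀ (by positivity)]
  refine h.trans (le_of_eq ?_)
  field_simp

lemma transitivityDefect_sq_le [Nonempty V] (m : ℝ) (G : SimpleGraph V) :
    transitivityDefect G ^ 2 ≤
      traceFunctional (nonadjMatrix G) ((X ^ 2 - C m * X) * (X ^ 2 - C m * X)) := by
  have hN : (0 : ℝ) < Fintype.card V := by exact_mod_cast Fintype.card_pos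
  set M := nonadjMatrix G with hMdef
  have hM : Mᵀ = M := by
    ext x y; simp [hMdef, nonadjMatrix, nonadj_comm G x y]
  set D := aeval M (X ^ 2 - C m * X) with hD
  have hDxz : ∀ x z, D x z = ∑ y, M x y * M y z - m * M x z := by
    intro x z
    simp [hD, sq, mul_apply, Algebra.algebraMap_eq_smul_one]
  have e : transitivityDefect G =
      ∑ p : V × V, D p.1 p.2 * ((1 - nonadj G p.1 p.2) / Fintype.card V) := by
    simp only [transitivityDefect, Fintype.expect_eq_sum_div_card, Finset.sum_div,
      Fintype.sum_prod_type]
    refine Finset.sum_congr rfl fun x _ => ?_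
    rw [Finset.sum_comm]
    refine Finset.sum_congr rfl fun z _ => ?_
    have hz : M x z * (1 - nonadj G x z) = 0 := by
      rcases nonadj_eq_zero_or_one G x z with h | h <;> simp [hMdef, nonadjMatrix, h]
    have : D x z * ((1 - nonadj G x z) / Fintype.card V) =
        ∑ y, M x y * M y z * ((1 - nonadj G x z) / Fintype.card V) := by
      rw [hDxz, sub_mul, Finset.sum_mul]
      linear_combination (-m / Fintype.card V) * hz
    rw [this]
    refine Finset.sum_congr rfl fun y _ => ?_
    simp only [hMdef, nonadjMatrix, of_apply]
    field_simp
  rw [traceFunctional_mul_self hM, e]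
  refine (Finset.sum_mul_sq_le_sq_mul_sq _ _ _).trans ?_
  rw [Fintype.sum_prod_type]
  refine mul_le_of_le_one_right (by positivity) ?_
  calc ∑ p : V × V, ((1 - nonadj G p.1 p.2) / (Fintype.card V : ℝ)) ^ 2
      ≤ ∑ p : V × V, (1 / (Fintype.card V : ℝ)) ^ 2 := by
        refine Finset.sum_le_sum fun p _ => pow_le_pow_left₀ ?_ ?_ 2
        · exact div_nonneg (sub_nonneg.2 (nonadj_le_one _ _ _)) hN.le
        · gcongr
          linarith [nonadj_nonneg G p.1 p.2]
    _ = 1 := by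
        simp only [Finset.sum_const, Finset.card_univ, Fintype.card_prod, nsmul_eq_mul]
        push_cast
        field_simp

/-- The Turán value of the `C₅` homomorphism density, in terms of the non-edge density. -/
noncomputable def turanValue (e : ℝ) : ℝ := 1 - 5 * e + 10 * e ^ 2 - 10 * e ^ 3 + 4 * e ^ 4

/-- The slope of `turanValue` on `[0, 1/2]` lies between `-5` and `-1/2`. -/
lemma gap_of_turanValue_le {q e ε g : ℝ} (hq0 : 0 ≤ q) (hq : q ≤ 1 / 3) (hε0 : 0 ≤ ε)
    (he0 : 0 ≤ e) (he1 : e ≤ 1 / 2) (hedge : e ≤ q + ε) (hg : 0 ≤ g)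
    (h : turanValue e + g ≤ turanValue q + ε) :
    q - 2 * ε ≤ e ∧ g ≤ 6 * ε := by
  have hK : turanValue e - turanValue q = (q - e) * (5 - 10 * (q + e)
      + 10 * (q ^ 2 + q * e + e ^ 2) - 4 * (q + e) * (q ^ 2 + e ^ 2)) := by
    unfold turanValue; ring
  set K := 5 - 10 * (q + e) + 10 * (q ^ 2 + q * e + e ^ 2) - 4 * (q + e) * (q ^ 2 + e ^ 2)
    with hKdef
  obtain ⟨a, ha⟩ : ∃ a, a = q + e := ⟨_, rfl⟩
  have ha0 : 0 ≤ a := by linarith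
  have ha1 : a ≤ 5 / 6 := by linarith
  have hKa : K = 5 - 10 * a + 10 * a ^ 2 - 4 * a ^ 3 - q * e * (10 - 8 * a) := by
    rw [hKdef, ha]; ring
  have hqe : 4 * (q * e) ≤ a ^ 2 := by rw [ha]; nlinarith [sq_nonneg (q - e)]
  have hqe0 : 0 ≤ q * e := mul_nonneg hq0 he0
  have hprod := mul_le_mul_of_nonneg_right hqe (by linarith : (0 : ℝ) ≤ 10 - 8 * a)
  have hK1 : 1 / 2 ≤ K := by
    have : 1 / 2 ≤ 5 - 10 * a + 15 / 2 * a ^ 2 - 2 * a ^ 3 := by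
      nlinarith [mul_nonneg (sub_nonneg.2 ha1) (sq_nonneg (a - 35 / 24))]
    rw [hKa]; linarith
  have hK2 : K ≤ 5 := by
    have h1 := mul_nonneg hqe0 (by linarith : (0 : ℝ) ≤ 10 - 8 * a)
    have h2 : 0 ≤ a * (10 - 10 * a + 4 * a ^ 2) :=
      mul_nonneg ha0 (by nlinarith [sq_nonneg (a - 5 / 4)])
    rw [hKa]; linarith
  rcases le_total e q with hle | hle
  · have h3 := mul_le_mul_of_nonneg_left hK1 (sub_nonneg.2 hle)
    have h4 : 0 ≤ (q - e) * K := by nlinarith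
    constructor <;> linarith
  · have h3 := mul_le_mul_of_nonneg_left hK2 (sub_nonneg.2 hle)
    constructor <;> linarith

/-- Near-extremal graphs have almost regular and almost transitive non-adjacency. -/
lemma defects_sq_le [Nonempty V] (G : SimpleGraph V) {q ε : ℝ} (hq0 : 0 < q) (hq : q ≤ 1 / 3)
    (hε0 : 0 ≤ ε) (hεq : 4 * ε ≤ q)
    (hedge : walkFunctional (nonadjMatrix G) X ≤ q + ε)
    (hcyc : ((meanMatrix V - nonadjMatrix G) ^ 5).trace ≤ turanValue q + ε) :
    degreeDefect q G ^ 2 ≤ 24 * ε ∧ transitivityDefect G ^ 2 ≤ 3800 / q ^ 2 * ε := by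
  have hN : (0 : ℝ) < Fintype.card V := by exact_mod_cast Fintype.card_pos
  have hdeg := degreeDefect_sq_le q G
  have htrans := transitivityDefect_sq_le (walkFunctional (nonadjMatrix G) X) G
  set M := nonadjMatrix G with hMdef
  have hM : Mᵀ = M := by
    ext x y; simp [hMdef, nonadjMatrix, nonadj_comm G x y]
  have h0 : ∀ x y, 0 ≤ M x y := fun x y => div_nonneg (nonadj_nonneg _ _ _) hN.le
  have h1 : ∀ x y, M x y ≤ 1 / Fintype.card V := fun x y => by
    simp only [hMdef, nonadjMatrix, of_apply]
    gcongr
    exact nonadj_le_one _ _ _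
  have h01 : ∀ x y, M x y ^ 2 = M x y / Fintype.card V := fun x y => by
    simp only [hMdef, nonadjMatrix, of_apply]
    rcases nonadj_eq_zero_or_one G x y with h | h <;> simp [h]
    field_simp
  have wpos := walkFunctional_mul_self_nonneg hM
  have wone := walkFunctional_one M
  have he0 : 0 ≤ walkFunctional M X := by
    refine div_nonneg ?_ hN.le
    simp only [aeval_X, dotProduct, mulVec, Pi.one_apply, one_mul, mul_one]
    exact Finset.sum_nonneg fun x _ => Finset.sum_nonneg fun y _ => h0 x y
  set e := walkFunctional M X with he
  have he1 : e ≤ 1 / 2 := by linarith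
  have hvar := variance_nonneg _ wpos wone
  have hj4 := jensen_fourth _ wpos wone
  have hjen := jensen_quartic _ wpos wone he.symm
  have h5 := fifth_moment_le _ wpos (walkFunctional_one_sub_X_mul_nonneg hM h0 h1) wone he.symm
    he0 (by linarith)
  have ht5 := trace_pow_succ_le h0 h1 4
  have ht6 := trace_pow_succ_le h0 h1 5
  have ht2 := trace_sq_eq hM h01
  have hproj := projection_defect_le _ (traceFunctional_mul_self_nonneg hM) e
  rw [trace_complement_pow_five] at hcyc
  rw [← he] at hvar hj4 ht2 hcyc
  norm_num only at ht5 ht6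
  rw [ht2] at hproj
  set p2 := walkFunctional M (X ^ 2)
  set p4 := walkFunctional M (X ^ 4)
  set p5 := walkFunctional M (X ^ 5)
  set c5 := traceFunctional M (X ^ 5)
  set c6 := traceFunctional M (X ^ 6)
  set Δ := traceFunctional M ((X ^ 2 - C e * X) * (X ^ 2 - C e * X))
  have hmain : turanValue e + 5 / 16 * (p2 - e ^ 2) + (p4 - c5) ≤ turanValue q + ε := by
    unfold turanValue at hcyc ⊢
    nlinarith
  obtain ⟨hlow, hgap⟩ := gap_of_turanValue_le hq0.le hq hε0 he0 he1 hedge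
    (by linarith [sub_nonneg.2 hvar, sub_nonneg.2 ht5] : 0 ≤ 5 / 16 * (p2 - e ^ 2) + (p4 - c5))
    (by linarith)
  have hs : p2 - e ^ 2 ≤ 96 / 5 * ε := by linarith
  have hη : p4 - c5 ≤ 6 * ε := by linarith
  constructor
  · have h6 : 0 ≤ (2 * ε - (e - q)) * (2 * ε + (e - q)) :=
      mul_nonneg (by linarith) (by linarith)
    have h7 : ε * ε ≤ 1 / 12 * ε := mul_le_mul_of_nonneg_right (by linarith) hε0
    linarith
  · have hΔ0 : 0 ≤ Δ := traceFunctional_mul_self_nonneg hM _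
    have hΔ : 2 * e ^ 2 * Δ ≤ 3 * (4 * e * (p4 - c5) + 30 * (p2 - e ^ 2)) := by
      have := mul_le_mul_of_nonneg_left hj4 he0
      linarith
    have h6 : e * (p4 - c5) ≤ 1 / 2 * (6 * ε) := mul_le_mul he1 hη (by linarith) (by norm_num)
    have h7 : (q / 2) ^ 2 * Δ ≤ e ^ 2 * Δ :=
      mul_le_mul_of_nonneg_right (pow_le_pow_left₀ (by linarith) (by linarith) 2) hΔ0
    refine htrans.trans ?_
    rw [div_mul_eq_mul_div, le_div_iff₀ (by positivity)]
    linarith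

end Stability

section Counting
open scoped BigOperators

lemma expect_fin_cons {V : Type*} [Fintype V] {l : ℕ} (f : (Fin (l + 1) → V) → ℝ) :
    𝔼 φ, f φ = 𝔼 x, 𝔼 φ : Fin l → V, f (Fin.cons x φ) := by
  rw [← Fintype.expect_equiv (Fin.consEquiv fun _ => V) (fun p => f (Fin.cons p.1 p.2)) f
    (fun _ => rfl), ← Finset.univ_product_univ, Finset.expect_product]

lemma expect_apply {ι V : Type*} [Fintype ι] [DecidableEq ι] [Fintype V] [Nonempty V] (u : ι)
    (f : V → ℝ) : 𝔼 φ : ι → V, f (φ u) = 𝔼 x, f x := by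
  rw [Fintype.expect_equiv (Equiv.funSplitAt u V) (fun φ => f (φ u)) (fun p => f p.1)
    (fun _ => rfl), ← Finset.univ_product_univ, Finset.expect_product]
  exact Finset.expect_congr rfl fun x _ => Fintype.expect_const (f x)

lemma expect_apply₂ {ι V : Type*} [Fintype ι] [DecidableEq ι] [Fintype V] [Nonempty V] {u v : ι}
    (huv : u ≠ v) (f : V → V → ℝ) :
    𝔼 φ : ι → V, f (φ u) (φ v) = 𝔼 x, 𝔼 y, f x y := by
  rw [Fintype.expect_equiv (Equiv.funSplitAt u V) (fun φ => f (φ u) (φ v))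
    (fun p => f p.1 (p.2 ⟨v, huv.symm⟩))
    (fun _ => rfl), ← Finset.univ_product_univ, Finset.expect_product]
  exact Finset.expect_congr rfl fun x _ => expect_apply _ (f x)

/-- The product of the non-adjacency indicators along a list of pairs. -/
noncomputable def nonadjProd {ι V : Type*} (G : SimpleGraph V) (A : List (ι × ι)) (φ : ι → V) : ℝ :=
  (A.map fun e => nonadj G (φ e.1) (φ e.2)).prod

/-- The product of the adjacency indicators along a list of pairs. -/
noncomputable def adjProd {ι V : Type*} (G : SimpleGraph V) (B : List (ι × ι)) (φ : ι → V) : ℝ :=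
  (B.map fun e => 1 - nonadj G (φ e.1) (φ e.2)).prod

section
variable {ι κ V : Type*} (G : SimpleGraph V)

@[simp] lemma nonadjProd_nil (φ : ι → V) : nonadjProd G [] φ = 1 := rfl

@[simp] lemma nonadjProd_cons (e : ι × ι) (A : List (ι × ι)) (φ : ι → V) :
    nonadjProd G (e :: A) φ = nonadj G (φ e.1) (φ e.2) * nonadjProd G A φ := by
  simp [nonadjProd]

lemma nonadjProd_eq_zero_or_one (A : List (ι × ι)) (φ : ι → V) :
    nonadjProd G A φ = 0 ∨ nonadjProd G A φ = 1 := by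
  induction A with
  | nil => simp
  | cons e A ih =>
    rcases ih with h | h <;> rcases nonadj_eq_zero_or_one G (φ e.1) (φ e.2) with h' | h' <;>
      simp [h, h']

lemma abs_nonadjProd_le_one (A : List (ι × ι)) (φ : ι → V) : |nonadjProd G A φ| ≤ 1 := by
  rcases nonadjProd_eq_zero_or_one G A φ with h | h <;> simp [h]

lemma nonadj_mul_nonadjProd {A : List (ι × ι)} {e : ι × ι} (he : e ∈ A) (φ : ι → V) :
    nonadj G (φ e.1) (φ e.2) * nonadjProd G A φ = nonadjProd G A φ := by
  induction A with
  | nil => simp at he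
  | cons e' A ih =>
    rw [nonadjProd_cons]
    rcases List.mem_cons.1 he with rfl | h
    · rcases nonadj_eq_zero_or_one G (φ e.1) (φ e.2) with h' | h' <;> simp [h']
    · rw [mul_left_comm, ih h]

/-- Replacing the indicators in a product one at a time. -/
lemma abs_mul_nonadjProd_sub_le (c : ℝ) (σ : κ → ι) (A : List (κ × κ)) (ψ : κ → V) (φ : ι → V) :
    |c * (nonadjProd G A ψ - nonadjProd G (A.map (Prod.map σ σ)) φ)| ≤
      (A.map fun e => |c * (nonadj G (ψ e.1) (ψ e.2)
        - nonadj G (φ (σ e.1)) (φ (σ e.2)))|).sum := by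
  induction A with
  | nil => simp
  | cons e A ih =>
    simp only [List.map_cons, nonadjProd_cons, List.sum_cons, Prod.map_fst, Prod.map_snd]
    set a := nonadj G (ψ e.1) (ψ e.2)
    set b := nonadj G (φ (σ e.1)) (φ (σ e.2))
    set P := nonadjProd G A ψ
    set Q := nonadjProd G (A.map (Prod.map σ σ)) φ
    have hP : |P| ≤ 1 := abs_nonadjProd_le_one _ _ _
    have hb : |b| ≤ 1 := abs_le.2 ⟨by linarith [nonadj_nonneg G (φ (σ e.1)) (φ (σ e.2))],
      nonadj_le_one _ _ _⟩
    have : c * (a * P - b * Q) = c * (a - b) * P + c * (P - Q) * b := by ring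
    rw [this]
    refine (abs_add_le _ _).trans (add_le_add ?_ (le_trans ?_ ih))
    · rw [abs_mul]; exact mul_le_of_le_one_right (abs_nonneg _) hP
    · rw [abs_mul (c * (P - Q))]; exact mul_le_of_le_one_right (abs_nonneg _) hb

lemma abs_nonadj_mul_sub_le (x y z : V) :
    |nonadj G x y * (nonadj G x z - nonadj G y z)| ≤
      nonadj G y x * nonadj G x z * (1 - nonadj G y z)
        + nonadj G x y * nonadj G y z * (1 - nonadj G x z) := by
  rw [nonadj_comm G y x]
  rcases nonadj_eq_zero_or_one G x y with h | h <;>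
  rcases nonadj_eq_zero_or_one G x z with h' | h' <;>
  rcases nonadj_eq_zero_or_one G y z with h'' | h'' <;> simp [h, h', h'']

end

/-- The error of replacing one indicator after identifying the first vertex with `u`. -/
lemma expect_identify_le {V : Type*} [Fintype V] [Nonempty V] (G : SimpleGraph V) {l : ℕ}
    (u v : Fin l) :
    𝔼 x, 𝔼 φ : Fin l → V, |nonadj G x (φ u) * (nonadj G x (φ v) - nonadj G (φ u) (φ v))| ≤
      2 * transitivityDefect G := by
  by_cases huv : u = v
  · subst huv
    have : ∀ x y : V, |nonadj G x y * (nonadj G x y - nonadj G y y)| = 0 := by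
      intro x y
      rw [nonadj_self]
      rcases nonadj_eq_zero_or_one G x y with h | h <;> simp [h]
    simp only [this, Finset.expect_const_zero]
    exact mul_nonneg zero_le_two (transitivityDefect_nonneg G)
  · calc 𝔼 x, 𝔼 φ : Fin l → V, |nonadj G x (φ u) * (nonadj G x (φ v) - nonadj G (φ u) (φ v))|
        = 𝔼 x, 𝔼 y, 𝔼 z, |nonadj G x y * (nonadj G x z - nonadj G y z)| :=
          Finset.expect_congr rfl fun x _ =>
            expect_apply₂ huv fun y z => |nonadj G x y * (nonadj G x z - nonadj G y z)|
      _ ≤ 𝔼 x, 𝔼 y, 𝔼 z, (nonadj G y x * nonadj G x z * (1 - nonadj G y z)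
            + nonadj G x y * nonadj G y z * (1 - nonadj G x z)) := by
          refine Finset.expect_le_expect fun x _ => Finset.expect_le_expect fun y _ =>
            Finset.expect_le_expect fun z _ => abs_nonadj_mul_sub_le G x y z
      _ = 2 * transitivityDefect G := by
          simp only [Finset.expect_add_distrib]
          rw [Finset.expect_comm, two_mul]
          rfl

lemma expect_degree_le {V : Type*} [Fintype V] [Nonempty V] (G : SimpleGraph V) (q : ℝ) {l : ℕ}
    (u : Fin l) (w : (Fin l → V) → ℝ) (hw : ∀ φ, |w φ| ≤ 1) :
    |(𝔼 x, 𝔼 φ : Fin l → V, nonadj G x (φ u) * w φ) - q * 𝔼 φ, w φ| ≤ degreeDefect q G := by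
  have e : (𝔼 x, 𝔼 φ : Fin l → V, nonadj G x (φ u) * w φ) - q * 𝔼 φ, w φ =
      𝔼 φ, ((𝔼 x, nonadj G (φ u) x) - q) * w φ := by
    rw [Finset.expect_comm, Finset.mul_expect, ← Finset.expect_sub_distrib]
    refine Finset.expect_congr rfl fun φ _ => ?_
    rw [sub_mul, Finset.expect_mul]
    simp only [nonadj_comm G _ (φ u)]
  rw [e, degreeDefect, ← expect_apply u fun y => |(𝔼 x, nonadj G y x) - q|]
  refine (Finset.abs_expect_le _ _).trans (Finset.expect_le_expect fun φ _ => ?_)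
  rw [abs_mul]
  exact mul_le_of_le_one_right (abs_nonneg _) (hw φ)

lemma exists_nonadjProd_tail {l : ℕ} (A : List (Fin (l + 1) × Fin (l + 1)))
    (hA : ∀ u : Fin l, (0, u.succ) ∉ A ∧ (u.succ, 0) ∉ A) :
    ∃ A' : List (Fin l × Fin l), ∀ {V : Type} (G : SimpleGraph V) (x : V) (φ : Fin l → V),
      nonadjProd G A (Fin.cons x φ : Fin (l + 1) → V) = nonadjProd G A' φ := by
  induction A with
  | nil => exact ⟨[], fun G x φ => rfl⟩
  | cons e A ih =>
    obtain ⟨A', hA'⟩ := ih fun u => ⟨fun h => (hA u).1 (List.mem_cons_of_mem _ h),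
      fun h => (hA u).2 (List.mem_cons_of_mem _ h)⟩
    obtain ⟨i, j⟩ := e
    cases i using Fin.cases with
    | zero =>
      cases j using Fin.cases with
      | zero => exact ⟨A', fun G x φ => by simp [hA', nonadj_self]⟩
      | succ v => exact absurd List.mem_cons_self (hA v).1
    | succ u =>
      cases j using Fin.cases with
      | zero => exact absurd List.mem_cons_self (hA u).2
      | succ v => exact ⟨(u, v) :: A', fun G x φ => by simp [hA']⟩

/-- The density of any pattern of non-adjacencies is determined up to the two defects. -/
theorem exists_nonadj_density (q : ℝ) {l : ℕ} (A : List (Fin l × Fin l)) :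
    ∃ c C : ℝ, 0 ≤ C ∧ ∀ {V : Type} [Fintype V] [Nonempty V] (G : SimpleGraph V),
      |(𝔼 φ, nonadjProd G A φ) - c| ≤ C * (degreeDefect q G + transitivityDefect G) := by
  induction l with
  | zero =>
    refine ⟨1, 0, le_rfl, fun G => ?_⟩
    match A with
    | [] => simp
    | e :: _ => exact e.1.elim0
  | succ l ih =>
    by_cases hA : ∃ u : Fin l, (0, u.succ) ∈ A ∨ (u.succ, 0) ∈ A
    · obtain ⟨u, hu⟩ := hA
      set σ : Fin (l + 1) → Fin l := Fin.cons u id with hσ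
      obtain ⟨c, C, hC, h⟩ := ih (A.map (Prod.map σ σ))
      refine ⟨q * c, |q| * C + 2 * A.length + 1, by positivity, fun {V} _ _ G => ?_⟩
      set d₁ := degreeDefect q G with hd₁
      set d₂ := transitivityDefect G with hd₂
      have hd₁0 : 0 ≤ d₁ := degreeDefect_nonneg q G
      have hd₂0 : 0 ≤ d₂ := transitivityDefect_nonneg G
      set w : (Fin l → V) → ℝ := nonadjProd G (A.map (Prod.map σ σ)) with hw
      have hmem : ∀ (x : V) (φ : Fin l → V), nonadjProd G A (Fin.cons x φ : Fin (l + 1) → V) =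
          nonadj G x (φ u) * nonadjProd G A (Fin.cons x φ : Fin (l + 1) → V) := by
        intro x φ
        rcases hu with hu | hu
        · simpa using (nonadj_mul_nonadjProd G hu (Fin.cons x φ : Fin (l + 1) → V)).symm
        · simpa [nonadj_comm G _ x] using
            (nonadj_mul_nonadjProd G hu (Fin.cons x φ : Fin (l + 1) → V)).symm
      have herr : ∀ e : Fin (l + 1) × Fin (l + 1), 𝔼 x, 𝔼 φ : Fin l → V,
          |nonadj G x (φ u) * (nonadj G ((Fin.cons x φ : Fin (l + 1) → V) e.1)
            ((Fin.cons x φ : Fin (l + 1) → V) e.2) - nonadj G (φ (σ e.1)) (φ (σ e.2)))|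
            ≤ 2 * d₂ := by
        rintro ⟨i, j⟩
        cases i using Fin.cases with
        | zero =>
          cases j using Fin.cases with
          | zero => simpa [nonadj_self] using hd₂0
          | succ v => simpa [hσ] using expect_identify_le G u v
        | succ v =>
          cases j using Fin.cases with
          | zero => simpa [hσ, nonadj_comm G (_ : V) (_ : V)] using expect_identify_le G u v
          | succ v' => simpa [hσ] using hd₂0
      have hsum : ∀ B : List (Fin (l + 1) × Fin (l + 1)), 𝔼 x, 𝔼 φ : Fin l → V,
          (B.map fun e => |nonadj G x (φ u) * (nonadj G ((Fin.cons x φ : Fin (l + 1) → V) e.1)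
            ((Fin.cons x φ : Fin (l + 1) → V) e.2) - nonadj G (φ (σ e.1)) (φ (σ e.2)))|).sum
            ≤ 2 * B.length * d₂ := by
        intro B
        induction B with
        | nil => simp
        | cons e B ihB =>
          simp only [List.map_cons, List.sum_cons, Finset.expect_add_distrib, List.length_cons]
          refine (add_le_add (herr e) ihB).trans (le_of_eq ?_)
          push_cast
          ring
      have h1 : |(𝔼 φ, nonadjProd G A φ) - 𝔼 x, 𝔼 φ : Fin l → V, nonadj G x (φ u) * w φ|
          ≤ 2 * A.length * d₂ := by
        rw [expect_fin_cons]
        simp only [← Finset.expect_sub_distrib]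
        refine le_trans ?_ (hsum A)
        refine (Finset.abs_expect_le _ _).trans (Finset.expect_le_expect fun x _ => ?_)
        refine (Finset.abs_expect_le _ _).trans (Finset.expect_le_expect fun φ _ => ?_)
        rw [hmem, ← mul_sub]
        exact abs_mul_nonadjProd_sub_le G _ σ A _ φ
      have h2 := expect_degree_le G q u w fun φ => abs_nonadjProd_le_one _ _ _
      have h3 : |q * (𝔼 φ, w φ) - q * c| ≤ |q| * (C * (d₁ + d₂)) := by
        rw [← mul_sub, abs_mul]
        exact mul_le_mul_of_nonneg_left (h G) (abs_nonneg q)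
      have h4 := abs_sub_le (𝔼 φ, nonadjProd G A φ) (𝔼 x, 𝔼 φ : Fin l → V, nonadj G x (φ u) * w φ)
        (q * c)
      have h5 := abs_sub_le (𝔼 x, 𝔼 φ : Fin l → V, nonadj G x (φ u) * w φ) (q * 𝔼 φ, w φ) (q * c)
      have h6 : 0 ≤ 2 * (A.length : ℝ) * d₁ := by positivity
      calc _ ≤ 2 * A.length * d₂ + (d₁ + |q| * (C * (d₁ + d₂))) := by linarith
        _ ≤ _ := by linarith
    · push Not at hA
      obtain ⟨A', hA'⟩ := exists_nonadjProd_tail A hA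
      obtain ⟨c, C, hC, h⟩ := ih A'
      refine ⟨c, C, hC, fun {V} _ _ G => ?_⟩
      rw [expect_fin_cons]
      simp only [hA', Fintype.expect_const]
      exact h G

/-- The density of any pattern of adjacencies and non-adjacencies is determined up to the two
defects. -/
theorem exists_pattern_density (q : ℝ) {l : ℕ} (A B : List (Fin l × Fin l)) :
    ∃ c C : ℝ, 0 ≤ C ∧ ∀ {V : Type} [Fintype V] [Nonempty V] (G : SimpleGraph V),
      |(𝔼 φ, nonadjProd G A φ * adjProd G B φ) - c| ≤
        C * (degreeDefect q G + transitivityDefect G) := by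
  induction B generalizing A with
  | nil => simpa [adjProd] using exists_nonadj_density q A
  | cons e B ih =>
    obtain ⟨c, C, hC, h⟩ := ih A
    obtain ⟨c', C', hC', h'⟩ := ih (e :: A)
    refine ⟨c - c', C + C', by positivity, fun {V} _ _ G => ?_⟩
    have : (𝔼 φ, nonadjProd G A φ * adjProd G (e :: B) φ) =
        (𝔼 φ, nonadjProd G A φ * adjProd G B φ)
          - 𝔼 φ, nonadjProd G (e :: A) φ * adjProd G B φ := by
      rw [← Finset.expect_sub_distrib]
      refine Finset.expect_congr rfl fun φ _ => ?_
      simp only [adjProd, nonadjProd_cons, List.map_cons, List.prod_cons]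
      ring
    rw [this, sub_sub_sub_comm, add_mul]
    exact (abs_sub _ _).trans (add_le_add (h G) (h' G))

/-- The number of maps inducing `F`, not necessarily injective. -/
noncomputable def indCount {l : ℕ} {V : Type*} (F : SimpleGraph (Fin l)) (G : SimpleGraph V) : ℕ :=
  Nat.card {φ : Fin l → V // ∀ u v : Fin l, u ≠ v → (F.Adj u v ↔ G.Adj (φ u) (φ v))}

open Classical in
lemma nonadjProd_eq_ite {ι V : Type*} (G : SimpleGraph V) (A : List (ι × ι)) (φ : ι → V) :
    nonadjProd G A φ = if ∀ e ∈ A, ¬ G.Adj (φ e.1) (φ e.2) then 1 else 0 := by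
  induction A with
  | nil => simp
  | cons e A ih =>
    by_cases h : G.Adj (φ e.1) (φ e.2) <;> simp [ih, nonadj, h]

open Classical in
lemma adjProd_eq_ite {ι V : Type*} (G : SimpleGraph V) (A : List (ι × ι)) (φ : ι → V) :
    adjProd G A φ = if ∀ e ∈ A, G.Adj (φ e.1) (φ e.2) then 1 else 0 := by
  induction A with
  | nil => simp [adjProd]
  | cons e A ih =>
    simp only [adjProd] at ih
    by_cases h : G.Adj (φ e.1) (φ e.2)
    · have h' : nonadj G (φ e.1) (φ e.2) = 0 := by simp [nonadj, h]
      simp [adjProd, ih, h', h]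
    · have h' : nonadj G (φ e.1) (φ e.2) = 1 := by simp [nonadj, h]
      simp [adjProd, h', h]

open Classical in
/-- Induced densities are determined up to the two defects. -/
theorem exists_ind_density (q : ℝ) {l : ℕ} (F : SimpleGraph (Fin l)) :
    ∃ c C : ℝ, 0 ≤ C ∧ ∀ {V : Type} [Fintype V] [Nonempty V] (G : SimpleGraph V),
      |(indCount F G : ℝ) / (Fintype.card V : ℝ) ^ l - c| ≤
        C * (degreeDefect q G + transitivityDefect G) := by
  obtain ⟨c, C, hC, h⟩ := exists_pattern_density q
    (Finset.univ.filter fun e : Fin l × Fin l => e.1 ≠ e.2 ∧ ¬ F.Adj e.1 e.2).toList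
    (Finset.univ.filter fun e : Fin l × Fin l => F.Adj e.1 e.2).toList
  refine ⟨c, C, hC, fun {V} _ _ G => ?_⟩
  convert h G using 3
  rw [Fintype.expect_eq_sum_div_card, Fintype.card_fun, Fintype.card_fin, Nat.cast_pow]
  congr 1
  have : ∀ φ : Fin l → V, nonadjProd G
      (Finset.univ.filter fun e : Fin l × Fin l => e.1 ≠ e.2 ∧ ¬ F.Adj e.1 e.2).toList φ
      * adjProd G (Finset.univ.filter fun e : Fin l × Fin l => F.Adj e.1 e.2).toList φ
      = if ∀ u v : Fin l, u ≠ v → (F.Adj u v ↔ G.Adj (φ u) (φ v)) then 1 else 0 := by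
    intro φ
    rw [nonadjProd_eq_ite, adjProd_eq_ite]
    simp only [Finset.mem_toList, Finset.mem_filter, Finset.mem_univ, true_and, Prod.forall]
    split_ifs with h1 h2 h h h2 h h
    · exact mul_one 1
    · exact absurd (fun u v huv => ⟨h2 u v, fun hG => by_contra fun hF => h1 u v ⟨huv, hF⟩ hG⟩) h
    · exact absurd (fun u v hF => (h u v hF.ne).1 hF) h2
    · exact mul_zero 1
    · exact absurd (fun u v huv hG => huv.2 ((h u v huv.1).2 hG)) h1
    · exact zero_mul _
    · exact absurd (fun u v huv hG => huv.2 ((h u v huv.1).2 hG)) h1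
    · exact zero_mul _
  simp only [this, indCount, Nat.card_eq_fintype_card, Fintype.card_subtype,
    Finset.sum_boole]

end Counting

section Limit
open scoped BigOperators Topology
open Matrix Polynomial

lemma degreeDefect_top {k : ℕ} [NeZero k] :
    degreeDefect (1 / (k : ℝ)) (⊤ : SimpleGraph (Fin k)) = 0 := by
  have : ∀ x : Fin k, 𝔼 y, nonadj (⊤ : SimpleGraph (Fin k)) x y = 1 / (k : ℝ) := by
    intro x
    have h : ∀ y, nonadj (⊤ : SimpleGraph (Fin k)) x y = if x = y then 1 else 0 := by
      intro y; by_cases h : x = y <;> simp [nonadj, h]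
    simp [h]
  simp [degreeDefect, this]

lemma transitivityDefect_top {k : ℕ} : transitivityDefect (⊤ : SimpleGraph (Fin k)) = 0 := by
  refine Finset.expect_eq_zero fun x _ => Finset.expect_eq_zero fun y _ =>
    Finset.expect_eq_zero fun z _ => ?_
  by_cases h : x = y
  · by_cases h' : y = z
    · subst h h'; simp [nonadj]
    · simp [nonadj, h']
  · simp [nonadj, h]

lemma indCount_top {k l : ℕ} (F : SimpleGraph (Fin l)) :
    indCount F (⊤ : SimpleGraph (Fin k)) = NFcount k F := by
  simp [indCount, NFcount]

/-- Maps satisfying `P` are injective up to the number of non-injective maps. -/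
lemma card_le_card_injective_add {l n : ℕ} (P : (Fin l → Fin n) → Prop) :
    Nat.card {φ // P φ} + n.descFactorial l ≤
      Nat.card {φ : Fin l → Fin n // Function.Injective φ ∧ P φ} + n ^ l := by
  classical
  have hinj : (Finset.univ.filter fun φ : Fin l → Fin n => Function.Injective φ).card
      = n.descFactorial l := by
    rw [← Fintype.card_subtype, Fintype.card_congr (Equiv.subtypeInjectiveEquivEmbedding _ _),
      Fintype.card_embedding_eq, Fintype.card_fin, Fintype.card_fin]
  have hcard (Q : (Fin l → Fin n) → Prop) [DecidablePred Q] :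
      Nat.card {φ // Q φ} = (Finset.univ.filter Q).card := by
    rw [Nat.card_eq_fintype_card, Fintype.card_subtype]
  have h := Finset.card_union_add_card_inter (Finset.univ.filter P)
    (Finset.univ.filter fun φ : Fin l → Fin n => Function.Injective φ)
  have hle := Finset.card_le_univ (Finset.univ.filter P ∪
    Finset.univ.filter fun φ : Fin l → Fin n => Function.Injective φ)
  rw [Fintype.card_fun, Fintype.card_fin, Fintype.card_fin] at hle
  rw [← Finset.filter_and, hinj] at h
  simp only [and_comm (a := Function.Injective _)]
  rw [hcard P, hcard fun φ => P φ ∧ Function.Injective φ]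
  omega

lemma injIndCount_le_indCount {l n : ℕ} (F : SimpleGraph (Fin l)) (G : SimpleGraph (Fin n)) :
    injIndCount F G ≤ indCount F G :=
  Nat.card_le_card_of_injective (Subtype.impEmbedding _ _ fun _ h => h.2)
    (Function.Embedding.injective _)

lemma tendsto_descFactorial_div_pow (l : ℕ) :
    Tendsto (fun n : ℕ => (n.descFactorial l : ℝ) / (n : ℝ) ^ l) atTop (𝓝 1) := by
  induction l with
  | zero => simp
  | succ l ih =>
    have h : Tendsto (fun n : ℕ => ((n - l : ℕ) : ℝ) / n) atTop (𝓝 1) := by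
      have h1 : Tendsto (fun n : ℕ => 1 - (l : ℝ) / n) atTop (𝓝 (1 - 0)) :=
        tendsto_const_nhds.sub (tendsto_const_div_atTop_nhds_zero_nat _)
      rw [sub_zero] at h1
      refine h1.congr' ?_
      filter_upwards [eventually_ge_atTop (l + 1)] with n hn
      have : (n : ℝ) ≠ 0 := Nat.cast_ne_zero.2 (by omega)
      rw [Nat.cast_sub (by omega)]
      field_simp
    have := h.mul ih
    rw [mul_one] at this
    refine this.congr fun n => ?_
    rw [Nat.descFactorial_succ, pow_succ, Nat.cast_mul]
    ring

lemma sum_fin_cons {V : Type*} [Fintype V] {l : ℕ} (f : (Fin (l + 1) → V) → ℝ) :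
    ∑ φ, f φ = ∑ x, ∑ φ : Fin l → V, f (Fin.cons x φ) := by
  rw [← Fintype.sum_equiv (Fin.consEquiv fun _ => V) (fun p => f (Fin.cons p.1 p.2)) f
    (fun _ => rfl), Fintype.sum_prod_type]

open Classical in
/-- Closed walks of length five are homomorphisms from the five-cycle. -/
lemma trace_adjMatrix_pow_five {V : Type*} [Fintype V] (G : SimpleGraph V) :
    ((G.adjMatrix ℝ) ^ 5).trace =
      Nat.card {v : Fin 5 → V // ∀ i : Fin 5, G.Adj (v i) (v (i + 1))} := by
  have h : (Nat.card {v : Fin 5 → V // ∀ i : Fin 5, G.Adj (v i) (v (i + 1))} : ℝ) =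
      ∑ v : Fin 5 → V, ∏ i, G.adjMatrix ℝ (v i) (v (i + 1)) := by
    rw [Nat.card_eq_fintype_card, Fintype.card_subtype, ← Finset.sum_boole]
    refine Finset.sum_congr rfl fun v _ => ?_
    simp only [SimpleGraph.adjMatrix_apply, Finset.prod_boole, Finset.mem_univ, true_imp_iff]
  rw [h]
  simp only [sum_fin_cons (V := V), Fin.prod_univ_five, Fintype.sum_unique, pow_succ', pow_zero,
    mul_one, trace, diag_apply, mul_apply, Finset.mul_sum]
  refine Finset.sum_congr rfl fun a _ => Finset.sum_congr rfl fun b _ =>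
    Finset.sum_congr rfl fun c _ => Finset.sum_congr rfl fun d _ =>
    Finset.sum_congr rfl fun e _ => ?_
  change _ = G.adjMatrix ℝ a b * G.adjMatrix ℝ b c * G.adjMatrix ℝ c d * G.adjMatrix ℝ d e *
    G.adjMatrix ℝ e a
  ring

lemma walkFunctional_nonadjMatrix_X {n : ℕ} (hn : 0 < n) (G : SimpleGraph (Fin n)) :
    walkFunctional (nonadjMatrix G) X = 1 - 2 * edgeCount G / (n : ℝ) ^ 2 := by
  classical
  have hs := G.sum_degrees_eq_twice_card_edges
  have he : edgeCount G = G.edgeFinset.card := by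
    rw [edgeCount, Nat.card_eq_fintype_card, SimpleGraph.edgeFinset_card]
  have h2 : ∑ x, ∑ y, nonadj G x y = (n : ℝ) ^ 2 - 2 * edgeCount G := by
    have h3 : ∀ x, ∑ y, nonadj G x y = n - (G.degree x : ℝ) := by
      intro x
      have : ∀ y, nonadj G x y = 1 - if G.Adj x y then 1 else 0 := by
        intro y; by_cases h : G.Adj x y <;> simp [nonadj, h]
      simp only [this, Finset.sum_sub_distrib, Finset.sum_boole, Finset.sum_const,
        Finset.card_univ, Fintype.card_fin, nsmul_eq_mul, mul_one]
      rw [← SimpleGraph.card_neighborFinset_eq_degree, SimpleGraph.neighborFinset_eq_filter]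
    simp only [h3, Finset.sum_sub_distrib, Finset.sum_const, Finset.card_univ, Fintype.card_fin,
      nsmul_eq_mul, ← Nat.cast_sum, hs, he]
    push_cast
    ring
  have hn' : (n : ℝ) ≠ 0 := by positivity
  simp only [walkFunctional, nonadjMatrix, LinearMap.coe_mk, AddHom.coe_mk, aeval_X, dotProduct,
    mulVec, of_apply, Pi.one_apply, one_mul, mul_one, ← Finset.sum_div, h2, Fintype.card_fin]
  field_simp

lemma trace_complement_le {n : ℕ} (hn : 0 < n) (G : SimpleGraph (Fin n)) :
    ((meanMatrix (Fin n) - nonadjMatrix G) ^ 5).trace ≤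
      (10 * c5Count G + 9) / (n : ℝ) ^ 5 + (1 - n.descFactorial 5 / (n : ℝ) ^ 5) := by
  classical
  have hn' : (0 : ℝ) < n := by positivity
  have e : meanMatrix (Fin n) - nonadjMatrix G = (1 / (n : ℝ)) • G.adjMatrix ℝ := by
    ext x y
    by_cases h : G.Adj x y <;> simp [meanMatrix, nonadjMatrix, nonadj, h]
  rw [e, _root_.smul_pow, trace_smul, smul_eq_mul]
  have ht := trace_adjMatrix_pow_five G
  have hc := card_le_card_injective_add fun v : Fin 5 → Fin n => ∀ i, G.Adj (v i) (v (i + 1))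
  have hdiv : Nat.card {v : Fin 5 → Fin n //
      Function.Injective v ∧ ∀ i : Fin 5, G.Adj (v i) (v (i + 1))} ≤ 10 * c5Count G + 9 := by
    unfold c5Count; omega
  have hc' : (Nat.card {v : Fin 5 → Fin n // ∀ i : Fin 5, G.Adj (v i) (v (i + 1))} : ℝ)
      + n.descFactorial 5 ≤ 10 * c5Count G + 9 + (n : ℝ) ^ 5 := by
    exact_mod_cast hc.trans (Nat.add_le_add_right hdiv _)
  have ht' : ((G.adjMatrix ℝ) ^ 5).trace =
      Nat.card {v : Fin 5 → Fin n // ∀ i : Fin 5, G.Adj (v i) (v (i + 1))} := by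
    convert ht
  rw [ht', div_pow, one_pow, one_div_mul_eq_div, div_le_iff₀ (by positivity)]
  have : ((10 * (c5Count G : ℝ) + 9) / (n : ℝ) ^ 5 + (1 - n.descFactorial 5 / (n : ℝ) ^ 5))
      * (n : ℝ) ^ 5 = 10 * c5Count G + 9 + (n : ℝ) ^ 5 - n.descFactorial 5 := by
    field_simp
    ring
  rw [this]
  linarith

lemma turanValue_one_div {k : ℕ} (hk : 0 < k) : turanValue (1 / (k : ℝ)) = 10 * lam k := by
  have : (k : ℝ) ≠ 0 := by positivity
  unfold turanValue lam
  field_simp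
  ring

/-- Squeezing a nonnegative sequence through its square. -/
lemma tendsto_zero_of_sq_le {f ε : ℕ → ℝ} {K : ℝ} (h0 : ∀ m, 0 ≤ f m)
    (h : ∀ᶠ m in atTop, f m ^ 2 ≤ K * ε m) (hε : Tendsto ε atTop (𝓝 0)) :
    Tendsto f atTop (𝓝 0) := by
  have h1 : Tendsto (fun m => f m ^ 2) atTop (𝓝 0) := by
    refine squeeze_zero' (Eventually.of_forall fun m => sq_nonneg _) h ?_
    simpa using hε.const_mul K
  have h2 := (Real.continuous_sqrt.tendsto 0).comp h1
  rw [Real.sqrt_zero] at h2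
  exact h2.congr fun m => Real.sqrt_sq (h0 m)

end Limit

/-- Any sequence of graphs with edge density approaching `1 − 1/k` and `C₅`-density
approaching `λ_k` converges (in induced densities of every fixed graph `F`) to the limit
of the Turán graphs `T_k^n`. -/
theorem converges_to_turan (k : ℕ) (hk : 3 ≤ k) (n : ℕ → ℕ)
    (hn : Tendsto n atTop atTop)
    (G : ∀ m, SimpleGraph (Fin (n m)))
    (hedge : ∀ m : ℕ, 1 ≤ m →
      (1 - 1/(k:ℝ) - 1/(m:ℝ)) * ((n m : ℝ) * ((n m : ℝ) - 1) / 2) ≤ (edgeCount (G m) : ℝ))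
    (hc5 : ∀ m : ℕ, 1 ≤ m →
      (c5Count (G m) : ℝ) ≤ (lam k + 1/(m:ℝ)) * (n m : ℝ)^5) :
    ∀ (l : ℕ) (F : SimpleGraph (Fin l)),
      Tendsto (fun m => (injIndCount F (G m) : ℝ) / (n m : ℝ)^l) atTop
        (nhds ((NFcount k F : ℝ) / (k:ℝ)^l)) := by
  intro l F
  have hk0 : (0 : ℝ) < k := by positivity
  set q : ℝ := 1 / (k : ℝ) with hqdef
  have hq0 : 0 < q := by positivity
  have hq : q ≤ 1 / 3 := one_div_le_one_div_of_le (by norm_num) (by exact_mod_cast hk)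
  have hnR : Tendsto (fun m => (n m : ℝ)) atTop atTop := tendsto_natCast_atTop_atTop.comp hn
  have hm0 : Tendsto (fun m : ℕ => 1 / (m : ℝ)) atTop (nhds 0) :=
    tendsto_const_div_atTop_nhds_zero_nat 1
  have hn0 : Tendsto (fun m => 1 / (n m : ℝ)) atTop (nhds 0) :=
    tendsto_const_nhds.div_atTop hnR
  have hdesc : ∀ j, Tendsto (fun m => 1 - ((n m).descFactorial j : ℝ) / (n m : ℝ) ^ j) atTop
      (nhds 0) := by
    intro j
    simpa using (tendsto_const_nhds (x := (1 : ℝ))).sub ((tendsto_descFactorial_div_pow j).comp hn)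
  set ε : ℕ → ℝ := fun m => 10 * (1 / (m : ℝ)) + 9 * (1 / (n m : ℝ))
    + |1 - ((n m).descFactorial 5 : ℝ) / (n m : ℝ) ^ 5| with hεdef
  have hε : Tendsto ε atTop (nhds 0) := by
    have h := ((hm0.const_mul 10).add (hn0.const_mul 9)).add (hdesc 5).abs
    rwa [mul_zero, mul_zero, abs_zero, add_zero, add_zero] at h
  have hdefects : ∀ᶠ m in atTop, degreeDefect q (G m) ^ 2 ≤ 24 * ε m ∧
      transitivityDefect (G m) ^ 2 ≤ 3800 / q ^ 2 * ε m := by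
    filter_upwards [eventually_ge_atTop 1, hn.eventually_ge_atTop 1,
      hε.eventually_le_const (by positivity : (0 : ℝ) < q / 4)] with m hm hnm hεm
    have hN : (1 : ℝ) ≤ n m := by exact_mod_cast hnm
    have hN0 : (0 : ℝ) < n m := by linarith
    have hm1 : (0 : ℝ) ≤ 1 / (m : ℝ) := by positivity
    have hn1 : (0 : ℝ) ≤ 1 / (n m : ℝ) := by positivity
    have habs := abs_nonneg (1 - ((n m).descFactorial 5 : ℝ) / (n m : ℝ) ^ 5)
    have hself := le_abs_self (1 - ((n m).descFactorial 5 : ℝ) / (n m : ℝ) ^ 5)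
    have : NeZero (n m) := ⟨by omega⟩
    refine defects_sq_le (G m) hq0 hq (by positivity) (by linarith) ?_ ?_
    · rw [walkFunctional_nonadjMatrix_X hnm]
      have h1 := hedge m hm
      have h2 : (1 - q - 1 / (m : ℝ)) * (1 - 1 / (n m : ℝ)) ≤
          2 * edgeCount (G m) / (n m : ℝ) ^ 2 := by
        rw [le_div_iff₀ (by positivity)]
        have : (1 - q - 1 / (m : ℝ)) * (1 - 1 / (n m : ℝ)) * (n m : ℝ) ^ 2 =
            2 * ((1 - q - 1 / (m : ℝ)) * ((n m : ℝ) * ((n m : ℝ) - 1) / 2)) := by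
          field_simp
        rw [this]
        linarith
      have h3 : 0 ≤ (q + 1 / (m : ℝ)) * (1 / (n m : ℝ)) := by positivity
      simp only [hεdef]
      linarith
    · refine (trace_complement_le hnm (G m)).trans ?_
      rw [hqdef, turanValue_one_div (by omega)]
      have h1 : (c5Count (G m) : ℝ) / (n m : ℝ) ^ 5 ≤ lam k + 1 / (m : ℝ) := by
        rw [div_le_iff₀ (by positivity)]
        exact hc5 m hm
      have h2 : 1 / (n m : ℝ) ^ 5 ≤ 1 / (n m : ℝ) :=
        one_div_le_one_div_of_le hN0 (le_self_pow₀ hN (by norm_num))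
      have h3 : (10 * (c5Count (G m) : ℝ) + 9) / (n m : ℝ) ^ 5 =
          10 * ((c5Count (G m) : ℝ) / (n m : ℝ) ^ 5) + 9 * (1 / (n m : ℝ) ^ 5) := by ring
      rw [h3]
      simp only [hεdef]
      linarith
  have hd₁ : Tendsto (fun m => degreeDefect q (G m)) atTop (nhds 0) :=
    tendsto_zero_of_sq_le (fun m => degreeDefect_nonneg _ _) (hdefects.mono fun m h => h.1) hε
  have hd₂ : Tendsto (fun m => transitivityDefect (G m)) atTop (nhds 0) :=
    tendsto_zero_of_sq_le (fun m => transitivityDefect_nonneg _) (hdefects.mono fun m h => h.2) hε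
  obtain ⟨c, C, -, hcount⟩ := exists_ind_density q F
  have hc : (NFcount k F : ℝ) / (k : ℝ) ^ l = c := by
    have : NeZero k := ⟨by omega⟩
    have h := hcount (⊤ : SimpleGraph (Fin k))
    rw [hqdef, degreeDefect_top, transitivityDefect_top, add_zero, mul_zero, indCount_top,
      Fintype.card_fin] at h
    exact sub_eq_zero.1 (abs_nonpos_iff.1 h)
  rw [hc]
  rw [← tendsto_sub_nhds_zero_iff]
  have hbound : Tendsto (fun m => C * (degreeDefect q (G m) + transitivityDefect (G m))
      + (1 - ((n m).descFactorial l : ℝ) / (n m : ℝ) ^ l)) atTop (nhds 0) := by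
    simpa using ((hd₁.add hd₂).const_mul C).add (hdesc l)
  refine squeeze_zero_norm' ?_ hbound
  filter_upwards [hn.eventually_ge_atTop 1] with m hnm
  have : NeZero (n m) := ⟨by omega⟩
  have hN0 : (0 : ℝ) < n m := by exact_mod_cast hnm
  have h1 := hcount (G m)
  rw [Fintype.card_fin] at h1
  have h2 : (injIndCount F (G m) : ℝ) / (n m : ℝ) ^ l ≤ indCount F (G m) / (n m : ℝ) ^ l := by
    gcongr
    exact injIndCount_le_indCount F (G m)
  have h3 : (indCount F (G m) : ℝ) / (n m : ℝ) ^ l ≤ injIndCount F (G m) / (n m : ℝ) ^ l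
      + (1 - ((n m).descFactorial l : ℝ) / (n m : ℝ) ^ l) := by
    have h4 : (indCount F (G m) : ℝ) + (n m).descFactorial l ≤
        injIndCount F (G m) + (n m : ℝ) ^ l := by
      exact_mod_cast card_le_card_injective_add fun φ : Fin l → Fin (n m) =>
        ∀ u v : Fin l, u ≠ v → (F.Adj u v ↔ (G m).Adj (φ u) (φ v))
    have h5 : (indCount F (G m) : ℝ) / (n m : ℝ) ^ l +
        (n m).descFactorial l / (n m : ℝ) ^ l ≤ injIndCount F (G m) / (n m : ℝ) ^ l + 1 := by
      rw [← add_div, div_add_one (by positivity)]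
      gcongr
    linarith
  rw [abs_le] at h1
  rw [Real.norm_eq_abs, abs_le]
  constructor <;> linarith
end
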